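/- For d = 4, b = 3 (the pushforward of O_{ℙ²}(3) under the 4-uple embedding): dim K_{p,0}(ℙ²,3;4) for p = 0,…,9 equals 10, 114, 588, 1804, 3630, 4950, 4488, 2376, 450, 55 respectively; dim K_{p,1}(ℙ²,3;4) for p = 7,…,12 equals 252, 825, 660, 276, 62, 6 respectively; and K_{p,q}(ℙ²,3;4) = 0 for all other pairs (p,q) with p ≥ 0 and q ∈ ℤ. -/

import Mathlib

open scoped TensorProduct

set_option maxHeartbeats 2000000
set_option synthInstance.maxHeartbeats 1000000

noncomputable section

/-- The dimension (over `ℂ`) of a complex vector space, as a natural number. -/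
def cdim (M : Type*) [AddCommMonoid M] [Module ℂ M] : ℕ := (Module.rank ℂ M).toNat

/-- The polynomial ring `S = ℂ[x₀,…,x_{N-1}]`. -/
abbrev PolyC (N : ℕ) : Type := MvPolynomial (Fin N) ℂ

/-- The space `S_e` of homogeneous polynomials of degree `e` (zero for `e < 0`). -/
def Sdeg (N : ℕ) (e : ℤ) : Submodule ℂ (PolyC N) :=
  if 0 ≤ e then MvPolynomial.homogeneousSubmodule (Fin N) ℂ e.toNat else ⊥

/-- The monomial `x^σ`. -/
def monoC (N : ℕ) (σ : Fin N →₀ ℕ) : PolyC N := MvPolynomial.monomial σ (1 : ℂ)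

/-- The wedge product `m₁ ∧ ⋯ ∧ mₙ` as an element of the `n`-th exterior power. -/
def wedgeE (R : Type*) [CommRing R] (M : Type*) [AddCommGroup M] [Module R M]
    (n : ℕ) (m : Fin n → M) : ↥(⋀[R]^n M) :=
  ⟨ExteriorAlgebra.ιMulti R n m, ExteriorAlgebra.ιMulti_range R n ⟨m, rfl⟩⟩

/-- The module `⋀^p S_d ⊗ S_e`. -/
abbrev KosModule (N : ℕ) (d : ℤ) (p : ℕ) (e : ℤ) : Type :=
  (↥(⋀[ℂ]^p ↥(Sdeg N d))) ⊗[ℂ] ↥(Sdeg N e)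

/-- `D` satisfies the defining formula of the Koszul differential
`∂_{p+1} : ⋀^{p+1} S_d ⊗ S_e → ⋀^p S_d ⊗ S_{e'}` (for `e' = e + d`), namely
`∂(m₁∧⋯∧m_{p+1} ⊗ f) = ∑ₖ (−1)ᵏ m₁∧⋯∧m̂ₖ∧⋯∧m_{p+1} ⊗ (mₖ·f)`; the equality is
stated after applying the (injective) inclusion `⋀^p S_d ⊗ S_{e'} → ⋀^p S_d ⊗ S`. -/
def IsKoszulDiff (N : ℕ) (d e e' : ℤ) (p : ℕ)
    (D : KosModule N d (p + 1) e →ₗ[ℂ] KosModule N d p e') : Prop :=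
  ∀ (m : Fin (p + 1) → ↥(Sdeg N d)) (f : ↥(Sdeg N e)),
    TensorProduct.map (LinearMap.id (R := ℂ) (M := ↥(⋀[ℂ]^p ↥(Sdeg N d)))) (Sdeg N e').subtype
        (D (wedgeE ℂ ↥(Sdeg N d) (p + 1) m ⊗ₜ[ℂ] f)) =
      ∑ k : Fin (p + 1), ((-1 : ℂ) ^ ((k : ℕ) + 1)) •
        (wedgeE ℂ ↥(Sdeg N d) p (fun i => m (Fin.succAbove k i)) ⊗ₜ[ℂ]
          ((m k : PolyC N) * (f : PolyC N)))

/-- A family of maps of the shape of the Koszul differentials. -/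
def KFam (N : ℕ) (d : ℤ) : Type :=
  ∀ (p : ℕ) (e e' : ℤ), KosModule N d (p + 1) e →ₗ[ℂ] KosModule N d p e'

/-- The family `D` consists of the Koszul differentials (at all meaningful degrees). -/
def IsKoszulFam (N : ℕ) (d : ℤ) (D : KFam N d) : Prop :=
  ∀ (p : ℕ) (e e' : ℤ), e' = e + d → IsKoszulDiff N d e e' p (D p e e')

/-- `dim K_{p,q}(ℙ^{N-1}, b; d)`: the dimension of the homology `ker ∂_p / im ∂_{p+1}` at the
middle term of `⋀^{p+1} S_d ⊗ S_{b+(q-1)d} → ⋀^p S_d ⊗ S_{b+qd} → ⋀^{p-1} S_d ⊗ S_{b+(q+1)d}`,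
where for `p = 0` the right-hand map is the zero map (the dimension of the quotient is expressed
as `dim ker − dim (im ⊓ ker)`, which agrees with it since all spaces here are
finite-dimensional). -/
def Kdim (N : ℕ) (d : ℤ) (D : KFam N d) (b : ℤ) : ℕ → ℤ → ℕ
  | 0, q =>
      cdim (KosModule N d 0 (b + q * d)) -
        cdim ↥(LinearMap.range (D 0 (b + (q - 1) * d) (b + q * d)))
  | p + 1, q =>
      cdim ↥(LinearMap.ker (D p (b + q * d) (b + (q + 1) * d))) -
        cdim
          ↥(LinearMap.range (D (p + 1) (b + (q - 1) * d) (b + q * d)) ⊓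
            LinearMap.ker (D p (b + q * d) (b + (q + 1) * d)))

/-- The multidegree-`a` component of `⋀^p S_d ⊗ S_e`: the span of the pure tensors
`m₁∧⋯∧m_p ⊗ f` with the `mᵢ` and `f` monomials of total multidegree `a`. -/
def KComp (N : ℕ) (d : ℤ) (p : ℕ) (e : ℤ) (a : Fin N →₀ ℕ) :
    Submodule ℂ (KosModule N d p e) :=
  Submodule.span ℂ
    { x | ∃ (σ : Fin p → (Fin N →₀ ℕ)) (τ : Fin N →₀ ℕ)
        (hσ : ∀ i, monoC N (σ i) ∈ Sdeg N d) (hτ : monoC N τ ∈ Sdeg N e),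
        (∑ i, σ i) + τ = a ∧
        x = wedgeE ℂ ↥(Sdeg N d) p (fun i => (⟨monoC N (σ i), hσ i⟩ : ↥(Sdeg N d))) ⊗ₜ[ℂ]
            (⟨monoC N τ, hτ⟩ : ↥(Sdeg N e)) }

/-- `dim K_{p,q}(ℙ^{N-1}, b; d)_a`: the dimension of the multidegree-`a` component of the
homology, i.e. of `(ker ∂_p ∩ (⋀^p S_d ⊗ S_{b+qd})_a) / (im ∂_{p+1} ∩ (⋀^p S_d ⊗ S_{b+qd})_a)`
(again expressed as a difference of dimensions). -/
def KdimA (N : ℕ) (d : ℤ) (D : KFam N d) (b : ℤ) : ℕ → ℤ → (Fin N →₀ ℕ) → ℕ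
  | 0, q, a =>
      cdim ↥(KComp N d 0 (b + q * d) a) -
        cdim
          ↥(LinearMap.range (D 0 (b + (q - 1) * d) (b + q * d)) ⊓ KComp N d 0 (b + q * d) a)
  | p + 1, q, a =>
      cdim
        ↥(LinearMap.ker (D p (b + q * d) (b + (q + 1) * d)) ⊓ KComp N d (p + 1) (b + q * d) a) -
        cdim
          ↥(LinearMap.range (D (p + 1) (b + (q - 1) * d) (b + q * d)) ⊓
            (LinearMap.ker (D p (b + q * d) (b + (q + 1) * d)) ⊓
              KComp N d (p + 1) (b + q * d) a))

/-- Build a multidegree in `Fin 3 →₀ ℕ` from three exponents. -/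
def mdeg3 (i j k : ℕ) : Fin 3 →₀ ℕ := Finsupp.equivFunOnFinite.symm ![i, j, k]

end

inductive Tr where
  | E
  | L (v : ℕ)
  | N (l r : Tr)

/-- value stored at key `k` (low bits first) in a tree of depth `n` -/
noncomputable def Tr.get (n : ℕ) : Tr → ℕ → ℕ :=
  Nat.rec (motive := fun _ => Tr → ℕ → ℕ)
    (fun t _ => Tr.rec (motive := fun _ => ℕ) 0 (fun v => v) (fun _ _ _ _ => 0) t)
    (fun _ ih t k => Tr.rec (motive := fun _ => ℕ) 0 (fun _ => 0)
      (fun l r _ _ => Nat.rec (motive := fun _ => ℕ) (ih l (Nat.div k 2))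
        (fun _ _ => ih r (Nat.div k 2)) (Nat.mod k 2)) t) n

/-- forcing a natural number -/
noncomputable def frc {α : Type} (k : ℕ) (c : ℕ → α) : α :=
  Nat.rec (motive := fun _ => α) (c 0) (fun j _ => c (Nat.succ j)) k

noncomputable def Tr.upd (n : ℕ) : Tr → ℕ → (ℕ → ℕ) → (Tr → Bool) → Bool :=
  Nat.rec (motive := fun _ => Tr → ℕ → (ℕ → ℕ) → (Tr → Bool) → Bool)
    (fun t _ f c => frc (f (Tr.rec (motive := fun _ => ℕ) 0 (fun v => v) (fun _ _ _ _ => 0) t))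
      (fun v => c (Tr.L v)))
    (fun _ ih t k f c =>
      Nat.rec (motive := fun _ => Bool)
        (Tr.rec (motive := fun _ => Bool)
          (ih Tr.E (Nat.div k 2) f (fun l => c (Tr.N l Tr.E)))
          (fun _ => ih Tr.E (Nat.div k 2) f (fun l => c (Tr.N l Tr.E)))
          (fun l r _ _ => ih l (Nat.div k 2) f (fun l' => c (Tr.N l' r))) t)
        (fun _ _ => Tr.rec (motive := fun _ => Bool)
          (ih Tr.E (Nat.div k 2) f (fun r => c (Tr.N Tr.E r)))
          (fun _ => ih Tr.E (Nat.div k 2) f (fun r => c (Tr.N Tr.E r)))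
          (fun l r _ _ => ih r (Nat.div k 2) f (fun r' => c (Tr.N l r'))) t)
        (Nat.mod k 2)) n

/-- base two logarithm of `w`, if it lies in `[b, b + 2 ^ n)` -/
noncomputable def lg (w : ℕ) (n : ℕ) : ℕ → ℕ :=
  Nat.rec (motive := fun _ => ℕ → ℕ) (fun b => b)
    (fun n ih b => frc (Nat.add b (Nat.pow 2 n)) (fun b' =>
      bif Nat.beq (Nat.shiftRight w b') 0 then ih b else ih b')) n

/-- reduce `v` against the tree; `c0` if it becomes zero, `c1` with the new tree. -/
noncomputable def red (f : ℕ) : ℕ → Tr → Bool → (Tr → Bool) → Bool :=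
  Nat.rec (motive := fun _ => ℕ → Tr → Bool → (Tr → Bool) → Bool)
    (fun _ _ _ _ => false)
    (fun _ ih v t c0 c1 =>
      Nat.rec (motive := fun _ => Bool) c0
        (fun w _ => frc (lg (Nat.succ w) 16 0) (fun k =>
          Nat.rec (motive := fun _ => Bool) (bif Nat.ble 64 k then Tr.upd 16 t k (fun _ => Nat.succ w) c1 else false)
            (fun b _ => ih (Nat.xor (Nat.succ w) (Nat.succ b)) t c0 c1) (t.get 16 k))) v) f

/-- `tabC`: entry `10 a + m` is the index of `v_a * m` among the reduced monomials of degree 7. -/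
def tabC : ℕ := 3121748433485184940463021877978740521226655393979472437421489563778040164704106550447248352009455019071205633015076075232686829037369920160006143

/-- `tabR`: entry `6 a + n` is the index of `n / v_a` among the reduced monomials of degree 3. -/
def tabR : ℕ := 97019594369434505113536215019568674363069771680449872039185014585547904308859650439559

noncomputable def popc (n : ℕ) : ℕ → ℕ :=
  Nat.rec (motive := fun _ => ℕ → ℕ) (fun _ => 0)
    (fun _ ih A => Nat.add (ih (Nat.div A 2)) (Nat.mod A 2)) n

/-- table lookup, `15` means: no entry -/
def tb (tab k a m : ℕ) : ℕ :=
  Nat.mod (Nat.shiftRight tab (Nat.mul 4 (Nat.add (Nat.mul a k) m))) 16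

/-- target position -/
def tp (k' A a n : ℕ) : ℕ := Nat.add (Nat.mul (Nat.xor A (Nat.shiftLeft 1 a)) k') n

/-- the packed unit vector, with a checksum in the low 64 bits -/
def unitv (i : ℕ) : ℕ :=
  Nat.xor (Nat.shiftLeft 1 (Nat.add 64 i))
    (Nat.mod (Nat.mul (Nat.succ i) 11400714819323198485) 18446744073709551616)

/-- the packed vector (mod 2) attached to the basis element `(A, m)` -/
noncomputable def gen (want tab k k' A m a : ℕ) : ℕ :=
  Nat.rec (motive := fun _ => ℕ) 0
    (fun a ih =>
      bif Nat.beq (Nat.mod (Nat.shiftRight A a) 2) want then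
        frc (tb tab k a m) (fun n => bif Nat.beq n 15 then ih else
           frc (tp k' A a n) (fun i => Nat.xor ih (unitv i)))
      else ih) a

noncomputable def loopm (want tab k k' A m : ℕ) : ℕ → Tr → (ℕ → Tr → Bool) → Bool :=
  Nat.rec (motive := fun _ => ℕ → Tr → (ℕ → Tr → Bool) → Bool) (fun need t c => c need t)
    (fun j ih need t c =>
      Nat.rec (motive := fun _ => Bool) true
       (fun need' _ => red 200 (gen want tab k k' A (Nat.sub k (Nat.succ j)) 12) t
          (ih (Nat.succ need') t c) (fun t' => ih need' t' c)) need) m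

noncomputable def loopA (want tab k k' p N : ℕ) : ℕ → Tr → Bool :=
  Nat.rec (motive := fun _ => ℕ → Tr → Bool) (fun need _ => Nat.beq need 0)
    (fun j ih need t =>
      bif Nat.beq (popc 12 (Nat.sub 4095 j)) p then
        loopm want tab k k' (Nat.sub 4095 j) k need t ih
      else ih need t) N

noncomputable def chkR (p r : ℕ) : Bool := loopA 0 tabR 6 10 p 4096 r Tr.E

/-- all positions balanced -/
noncomputable def bal (n : ℕ) : Tr → Bool :=
  Nat.rec (motive := fun _ => Tr → Bool)
    (fun t => Nat.beq (Tr.get 1 t 0) (Tr.get 1 t 1))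
    (fun _ ih t => Tr.rec (motive := fun _ => Bool) true (fun _ => true)
      (fun l r _ _ => bif ih l then ih r else false) t) n

/-- add `± mag` times the integral vector of the basis element `(A, m)` -/
noncomputable def addT (want tab k k' A m sg mag a : ℕ) : Tr → (Tr → Bool) → Bool :=
  Nat.rec (motive := fun _ => Tr → (Tr → Bool) → Bool) (fun t c => c t)
    (fun a ih t c =>
      bif Nat.beq (Nat.mod (Nat.shiftRight A a) 2) want then
        frc (tb tab k a m) (fun n => bif Nat.beq n 15 then ih t c else
           frc (Nat.add (tp k' A a n)
              (Nat.mul 65536 (Nat.mod (Nat.add sg (popc 12 (Nat.mod A (Nat.pow 2 a)))) 2)))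
            (fun i => Tr.upd 17 t i (fun v => Nat.add v mag) (fun t' => ih t' c)))
      else ih t c) a

/-- process all the entries of the vector packed in `w` -/
noncomputable def proc (want tab k k' p f : ℕ) : ℕ → Tr → ℕ → (Tr → ℕ → Bool) → Bool :=
  Nat.rec (motive := fun _ => ℕ → Tr → ℕ → (Tr → ℕ → Bool) → Bool)
    (fun _ _ _ _ => false)
    (fun _ ih w t x c => Nat.rec (motive := fun _ => Bool) (c t x)
      (fun w' _ =>
        frc (Nat.mod (Nat.div (Nat.succ w') 32) 524288) (fun i =>
        frc (Nat.div i k) (fun A =>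
        frc (Nat.mod (Nat.div (Nat.succ w') 16) 2) (fun sg =>
        frc (Nat.mod (Nat.succ w') 16) (fun mag =>
        bif Nat.beq (popc 12 A) p then bif Nat.ble A 4095 then
          addT want tab k k' A (Nat.mod i k) sg mag 12 t (fun t' =>
            frc (bif Nat.beq (Nat.mod mag 2) 0 then x else Nat.xor x (unitv i)) (fun x' =>
              ih (Nat.div (Nat.succ w') 16777216) t' x' c))
          else false else false))))) w) f

noncomputable def loopV (want tab k k' p : ℕ) (L : List ℕ) : ℕ → Tr → Bool :=
  List.rec (motive := fun _ => ℕ → Tr → Bool) (fun need _ => Nat.beq need 0)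
    (fun w _ ih need t => Nat.rec (motive := fun _ => Bool) true (fun need' _ =>
      proc want tab k k' p 200 w Tr.E 0 (fun s x =>
        bif bal 16 s then red 200 x t false (fun t' => ih need' t') else false)) need) L


def datR : List ℕ := [
  780449,
  3685490859493576960119641265,
  3685339742032239069045142689,
  61827205610628394936551268999034017,
  1037245847422013821235143999719643843785905,
  4898355460491484533599391020374855456962159670658846326723930785,
  388072285455176181689265670802830626573792856804505098444766315838128371711286297775764605617,
  8620053140962166872218629787140772217028401005845594527467608805949483535309379026763680037913176025444385170116965802159213526133557937,
  680939640093853800121419402771282193119787261325699389941870097938111663920972625075661774361031087987001447822703336563121253841827548883517698368232878026072115873,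
  4897953723675689781522765119993852340433899775323518251389606561,
  2417585238541162626142480353354212008749358664641400146665868411263323736455782744404394272493808826295668819445921564355380796229992739446202061855393,
  675555002500985580846643582135589898274848631451858179112958346799584012704309216670409266318950429970002824810493737670268263461844554908239089695030594096194755249,
  81553948804155624339910334166963170836583842541974118634188832055458465,
  191525006986597738110121917884392813548239681832183745672237922562686980959008680246306538923755345345002913984461916894507331120733095777967628093697607499747545027957458207013553,
  507850328312390664874872059030959905457624331666925881145012058377737078981956116212964606197168961859576348256161742089057663649,
  61822134921184812630396777724767921,
  2419083677562300627866689922180688702298259657160746756550579936126534759374491779576983506198308548364464818733292594011022746836576234236376043068065,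
  8526347983762683705688761015704106695328528027561999687569707621361937669310128001220769661289917393584854815494399459489202932912831153,
  680405393940755383576673583583286214742840550701077187506545446161723600984170304519192589268937763644552912229840599570061655933559316298719419015188866701608549041,
  6484865370535364723386944685861981456645334148563655411580886510434504758657937819377302048057546161,
  3215717075835945523014624487523321963911403243790226968651929466610442757647033526178147254333535191856779725183455834078652188577008772992367556265588673492492311668488356316279342822817,
  254643851569132870570141137274674722806918126305412817270455102140215909036985354021470185423968214344248960762044706102401594923810709458197085630360856716948995200945101796468509524311201424670606718272887304271265,
  7546625437074602399847725201371306300180365794442943683998595493933794380600849007394707325803123229636473806955671462349299036032484161615853367711235247875553526643763427861735060478681992461983033619036597367048244308372609547963682478919188720142608025728335984385343726345870859442952975793,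
  3215580140607285484466571756284759553044696316016337398244398738209236197787193885294205109312368978634543936845458798497167896649378350087286199069799732795963778477654773893922047051185,
  3753814937780311901322356419629269836703068774757173014657905049797854964977965788400798637615895713914776727476766545412130733558057086451768060555646453096110909716010580979563088804439165353310417365291607238389765491067481569027472611369275180077457288561565820640570760463391069778017285228544820818565961446260677611709465363941879720865732661572762449866332689540794748011953,
  6579941924083232797987914272173374900555014897628229241741068120388072183296119749284030097627322067927916821606508356160031674037296133513297576929921883457604641392785267944727120730486590723325781734262483364383287871194233005020376435556253415198843311632397874579141041620631179857195438940153960023921062265889719927983704100091096963404165021391628182163473741804387972507064106022323153086991206856233724775222521459894468006877413344522403153313,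
  251608753063329710052331625033704295183954028589631917423583321728211861479994276261656986141787237811657575995058232866624866725093115732579413534033019956849235010097170197537173329182750332940017191846820243269041,
  389760986532207379986807441375103126282035921791791747046311258856214372571280377198593452287834500915250744973576002203048222321413676071348632751016880995273188002704165746272283625952029705849056394524700693092877993473103406981449309978333316274503605111925684699502003837087262834106085860683354718111500307006121158401517239906204150632726908863382958417177109978384934291658891927153960174409717817292622597638464569788860556562141702022561,
  220370420037514876447638783884953701793305218273853207643419548746323233002434897167600419618536519799280697509281553034985404113592068948333432183064890089943839398931851482247923846136219425445939308808983250585670020564534769787707927794746336330764541902597346497170098219857201175543850742622624600010365500436604665173235092361658806309987719020033493353330553586378161,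
  449795340716740840138804456471790050319379369106240485218454835109720177341889986988037731413603389436002396495432813977037279644089521837944139470936274035282294007764578296386303243492811822530682675475859929938109809294066095901643059267024462225882414353558241303418200349469212771761,
  3723107059849804951386112231724253425037467011407998905609091480192587641021731714073622897859450487529467049670900439527249744093903245122295816191822113341356665004658374589274491021104087644666398480622771733876745995805843083119030821445806376973312795761477174526348788155685781760933599134962586244410956536697256164463833916653396769877470065382399189647401743827743644394913,
  30878752755985742608648745197132848377125942347376948416160445716549268409761854932629162372160175071859485858190691687432112521982960155799007362727929962295107794278057436255380880625995088726315479947141968166643330391174047863635111977486082317620750453422857582289544151886690300821470972245459466364789566140617419010981810608740241653166625941687841337251000384848681642044877468204726632214030489844342229796441368141136881437427255979427407825350107336992966742042017,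
  6414377789175355073787368703624291566331179575587875884604738506285074365965163088847506872663190945,
  449795340717294805493824736382539558480790432197802657879874908530488939710323102902685448678401135987041160499858925767046600643985826120799670047656076868498757479832928336143245869148413458755817572515404932043762867669684631199972473843099943377114348074030320048913577078280409345441,
  7486282445550450450714000884593081741099187374353875267055068876400451200275517815433449752616162689487950178504410632125966779401450955808252049273599626829196145363999824765581332117470318329145857921616429643410598609221809058226315451148460714383784645792041867640061254146798541157683260849,
  5609537727338581314447979104423309910138066633215678486605358193442829244932236113327921242494254255580404077667885991664682593710373242645816010467651481327297816400304228682684060660711525580880397540990599128541596028320454248619530961105563306270222929313,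
  2444108802548268111497052849443923451380852208946712183531412373962479792368683807375005582870062228500911580921546710235592721101633809069205678619400257596554186890859145029454225855393780061752461224802272920154215157995415993220272439455277987492357482827152837939362640383775486282087857885134519645591198043140844477927412664423053376812345111841860575105725674750500996046156433305068027669823523084802192925227929079078804201639252413931558849235726900377172883506418171813066910099885168206826929,
  215702437931169359670440429883911133927154032888297092393554992058416929890530161077375315278143099255987429810092932714614135671270291200484757288322964966212519898199230575739580759086767492521901031970865550965002711679352559289660639655138998222080152936838716601339844459008846921199299780122747167892326126300283666611574598904696792293026563617935601318340589250596257,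
  248515792798912407463469713970953003014761127204987521037010531162450954757637090708041408417899499074047046423560397237887591765294287667798874025280522647560981047245035066650319743834824910797282008932896970444209,
  30847696088615857909481606449996722603593219052018286542621786832529065655160135838824862413781636229071168611135751868579340251886837292605032508038064038161256041142398164731001518671632074641242892904649347847955079301063674209570499142354725609361135912391797763733760706121396637101107209067986253976147281124384381185239984722761210640671912974443685985172623093782315096030860453062548076557533789122225578273080610463792131770619955601565760847879996864631616743591345,
  869037967742587911974398734914477566488669233359767942016076808326057084063655860957907109549003033762661772532009915636676474323258015604063096261821809216205384280631953745408479600936885243686780337,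
  190001451531665588994649486728612920425478393070243920991367750057813433201869403526814077061217194482618014724312731892376110911275140000237371027417628419496719588835581025777569,
  2443955017116450168235771620526184297420117773101443067163351755469918290907748397463834405812022646229720946550045297706950069025949774853766857211558950099100428937760245309276426760765643206738580348471968781459235940214160909845829945181284913743007736762877397171351942062197919163991980316374227577743785029816441642169149140916625177599977985980026095403563938755868881255129678206387893748595566371843998259905045395576915509242380279477978182345024524315260307165183688307584160839249029115334065,
  380336895567485825170226588633500509240673345296930671892165545463999802018687791802545111308001651886407277202356448635638015822963719622091696940386705872172221720928672872322899182970586107352028294473325018535908497834644394805799477036253144598179322144406444562491759848928249917556635336150362175842145158830855044471933564703879063377964081064937003698631694475758723548149567649745559880070443982250611294761801578714327487140240453442977,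
  11349526726926336254966342421796993271016073671549241616012431855742872072328716356346355127826697785565261072364426591205464703844125540446010775987390321076087933144427104320326002179575344719268162269817367669656427170444836009838338886867730845112996595864268810150089822424381595466522232483488747647918613084872205793655671660768718782579165961880785360827390010056601068311337410486129300652930779555691176303642282106591162004304202766576547987216103529672081617984681598372008246736593244945416200506825015819650563490,
  79606092425653157041694282940478093622316861795639717832674515292975521,
  5502665577850047761292880243791366410836258059599819512334519346045659719151633609789269763419982332155018118719532815367835232501412807965460628216140023064488333432047572631982203389106179803801580151080720142328554273378527084626210472453424081373176700337,
  244722905551248263647353575459950711361068823545552139352734806561687360426298054155100392282759865447956812979317296131283363887299079193266373195201373601671039497258637613000287830419293501265063821449940474936737,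
  385215163268019633220378137633792122354931295950366226567943306233244937415149935624983367985,
  254638262790723438946463798302469913129051938268417976585850603976068883570962179174886573042162344145071372395958439762041300817287389011609839010209437940379221402363394674002649372140569511991429861381616073109793,
  893876338940873735678838056607243890422881944865430523190707910026257663676212502754646916283697363998549238452929449368274044438422154386982330629161284905038628647924404001060326389781619283830812961,
  7456500769965145646554666497124039431895296095356582824866168645459283981643078952154477841117410975776863906152337773511086032890013674071248817252529776891698394732123696370286620458266645537846943813767152664440138701778821323127628304611065633853333277561111813331676605274790647518921601329,
  1597961041217024148479208439098336165734563067570028831463974625792571339442773143281119948482570924517566206937072269278946500609351268949226381921385360738584894167683933760743316749957872077971462491594547778761534522987487317461978829280799166719102370001590449471144241,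
  6551983237301943035113137168591299406941635647483221047076906805093392534829335462921194377990502629754280778691072542557094330828689300431997427354606002275181320584142332221963685482056436300346918879561193550538787796954447900194246288951883673457800920519466848062398541257711921793082164566726228482883091178304178254850624043551155399178937585771626496937908793453638621339730976331150575526366700592335649566727942750309822094498567637538773172529,
  454863509734659721083963874814323622399277481370789335033887408585263683478609123823095900700851695406143608718193070532616126006876678728647556904109078547488270596519610151405244812647089936783438736425671157006152239699050124692279237206967350019735112128541641808994725014957303202025746095890126438087551019705459728900063614365689922460932296425609793779073190074821788294897257610574700978657405547130261363216599854870762947504917292066496004769432444939415430893912108937097888907031038332902549824752475930156942351185229433320622837768212678861655614164280882447252273755099479221457809034529451333554099375973355521926135680434465,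
  250677379828565900651787376770513820925787268071351712347477550366510646435639564531937439914564980197012016280906214805438502484041926454572172853944217981773526453293822511944759844305929076281511962186503533584689,
  6529111052856884702014789142479876463490373037664141703095052148950014196106924658358483701781029334435335724922146254472077805546510783899577844814895170967082711749433960990560928442616270447230980757608068153067444376802335552179992809842973613318831462008617912617007472818421656909272050093246367389109691140118380891176392188915583465497861441873845248240969658593860050568460484519804889997649219167800055474906942504967559760633068686700645212449,
  382901162785102205728834846157576811538080604411195833862266171930286358761946551708363195860033048933522230361443629282394063410069394185230523588736303479345538432004118881441489538747559728664468562637921086649740561901699538200254783218127147966980615464515775162396129462580744297631907755996222715960751176406335069680889392211287606692586746780234502407549673735749496450265120322666901480335270507487278522843353772925169413495649823023409,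
  2094561148288927903348666554072369244749071451997046334538708488711914562943451292878901862605281673750713924078106179145830400825728606667973558894881279575403563122890167305980105729945880433931799536372303458275753120993691419988058534923387348959428872892142051915581255992161101597240798087016778907877681,
  3248641567791385296643220288879231218147738912821209971695511125658079454093168373986397913370166497083494245151941231608107836666797137424099613650452427877063236329997078515021742984558299271556620843631105983863457688773531524594250013360849597344420154121447375453174075971234062232569417782979791059416101123970676995744729590968588712746582911914450929427310343186194824282855188643513844971901556343868957669643169652495308873747625733213137327277851261644222314005439655004328920096883251677912359718447490764741028941591510467813665,
  3246942362726730636616595263844803063403888865908205804412811183310712933597332808253492675323452806116912914240214164984390990287985252870248462889004226780564429772137456953800749937037588028838146265068917978286623293128630378460592181823508978016188594248891066134919776915302604385485715810392116968525567164854816849825775010734532612397200810130604392979719410341490677089516832935492802943907072276434126296633734576871661559135820673459060638907470364421426666678823623355275169358005762015375683818869530687496405572139884925346081,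
  252555577374468060375735131599678772275219446845515197002859696419329308450887471531322877997259153704528750838596741106773071149967966946648704117345982738895866835764838470971524717716691867054015963513911539050785,
  3251844078148708840048973047056497775206090390078160529488225199584167675861238811471067056151224495699201916001059128752059686703593490061310858048108072477947612796881057446409468517162601721483384890659961910918116849575094960175958997070471363696943462661126963051575672609123261113968238776166132644450279107667734113124312589415204943264440323674771727546354043051422878945652325178520115887472967715245126469110773969402495719530614445752004664832056300862667446572900305461701642302446779635712895659026177148570481755220822731548961,
  454757991897096414063995775892638100418093182655318956833923388970614811144792001199407168916939148420119710287634273142522198717505676595020804520973302433698610007213739366450634460400535653820853334420271604161750038210712573165260606765570864626144645046920838696576862115074797123344498075869130427795434014344254926037735108559837190379922453364369403035006779175162731006742876143435247669249551486946202558685624421228065648445060139230097843751727789908013401114092761741418473196095617291584917857645958151239696629597648386681582547663610240505554237065039852007643775179084517617517128135325600310913383910636450610024093806061873,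
  389173511702685493198349991553610671241580363463650986778967788953141291673925273041305519054267325046235338966765246552197137126562562837134397916213895504515786423652750615880141019329201672054514015164962241989122144217459512725095367538090839070690837448090162643440848571599274835582703304611370540246232980314545496544121527946354174638722774347826990375831103155167693795626778888186437406365249240663967538434138665055752292354490150373665,
  8692017292299614748016236423724926037668036136220322022968974583659807684098915667396107837621927119477367686683520243328158666388516449014664152158441944750196382058539801111767534169119489543540662706944391800392631756517239015129817514596944840188555663638098980623691258793905524136099993024817752948877371077819480563093434999033793652584964027185218506687556697917566756757371892723539846601034391664864273190609685931882650365977047511587510844534702448815794559324165278934144390551971918129704023703143398119413830219490264491662682831041015963074079897715617440066072365119890283133862790345736059208650073953748595665870492545992987447399323904850128094481967148831934293215968809635224353360573832937835168058392392409586061937173974361859285585623363145068633663708258474293685337395258116258567967033297532998173225144373450393905,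
  220588263168945588695063617604363179172963264711696446166255432943572899784576375106480974404509283244966285446401052640032697008257390060197161863312726829587954503353848771521256378670353935494122914511574652259899738107921573788427069234271750536670318517555182734326804261444421877635460407897150432774868652232201667726255760104493123649055719740377609770568592851265915762558453548266407041181565479549815603703435235642454960059862874411055198456354544795752471571749414343104749643564481237860857149674069957116355681337619695112443397553143459990473187183406054499250857646028612276215180527085045663091904993604985774784398787801437521718648451884573945738207398988722166816505543921352679072453933108540492555405674785,
  6426901286987245036652358460035866791113181161757665481816704614762352619471798316072708109079265520949045417591643532069760692927482157955929719465602091053508470594536615923517153691520663185106960708857132743548736443270476671430058392781591886163885783535535625808004053012390922546428971839458037662492773829940003979017267039360963912892711701835003854227109472508270839702620096420217581239287010648636846900764640015639762345100311615214222379313,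
  15483244589882106736523537346280412486384039466607405783757415042874314800604053867228405047581067244297661234540252221274945588472907035570752611471854029593341627952616476893443254801074451961369339239233001120860671128462006895221421026926026855616586424416009425267852483670267556258725307452830539411190497845898593489362385106541676552248897013331697812494278072971321217707253860789838438595836337699346261361527415886385066981212206773503000536437134320950080263783830448053298153357002997686773207979057393647032399706162963683677578675945146989795717172197457429671338067862454859676205715699964633443515467358631497856981443444036683909001401302678988977990175837620816413047735462319874065780324177693702529008851822573619071139648414169846900345158498843921621201251830384764036020139961230726353553314649152333727325070919058078962225527197139490046561410846298761246732502185033407321836985061671618865,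
  12718551055139305573467582068614205651346736632133496162285062585270536943154570222691643940315115733617204285748482020513923611451136846669706997765434185570674251179507538129770198270105562171503862199669905980674727789082952553733011499875654817318140582509696544400397442397033308639216727813789321341157031349236003912444396535649697856597619222076414805986605361,
  35431124308316534065439759161220618839556613410464858634179857926453475993406819595559022470359114391756981505371551418181773271487958553877430217630390279237939455691332043854168343385036982526074805384345802225982863984684852057850493597022034820129271311170279054464622814567711109286031152648783030960523117975736010330815074574708078652290655406664216483947929631409556015057643646530125108593331333994755720812335115628221202098459337298347543211463744183195118190149815083824998125570817179764560635817434884305323736749591851054925320978081626670395004016186545405420088574035036776479269961884147764767612177596220063269168546236441952669348014222544043354802481,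
  8691269658658840985309180761460125961119571251876527249053559861542469253144918102031776794875928894877580066763896820786715985794904690959302228032646688268142505704559753255775402238849793270561425464912677999544251579018627417515241767836731115777550021027792531171954768499222880351979908344654235451104293018508376195460982870631255375641764768921858270011638087423390982013189097772339951282362876268139810745248449685490618538949626054413684515468016522394129334618404803261518544514093886707056572149529222790447633345391761891419539818761913598444560437742521827490560415767529732449782214198911253178311171243696814986320596078347880807896038669085416269984839234875261378584033553082223812586189663089945499413321195457799820332922984516381470699179990087829346027591815643188685927576684057668972806418106500576690721199493822454049,
  15261304096788700199309538923742161401319143772220428687534577665093586097101475584574781409112766377287516017482376210300953736137900061436491142313679880131014439997855999705105209208448025997759641009588957075283806405327197963878749405722608119224799367164490717341635945578859320650672869136250360900687401331372256009071294895087443072091111706143825465037175340953312384937652985559385676113640813195623314675221785399657717430851744580491498541892837638843147028758915286574100895148324461519346776213339203961778126739131990402287635099173933643276946032776990181959934951270461114663354781910368844908195364578002221887035320850766402345117141246407382034016527819336585426896876288702440885129211474567918330988035033717571525083959523999801108169048901046270732904650121745781882733173681108755983506847903425070140027099008384972627161250528769462875114513583710470954062862066825613637461724887242602786,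
  763585697945114157374056363496609368899148773982032955793800515306769307408900875438929854926466665434221892073529764695631125969192183737141177842978728160407643593394245409977443929386663505370617093956084658754605670468431380022642472978126022593369997680542992710744282534503351909470089861410790492714113321414678801149251352576195819566712491911814486321,
  367205743336046869647799637030141840630787043297061028510744547656775027525693440840263816398408292620020926316068577338532819413308163968338613642318585366385229105561084065364411199930055488053804414698008792800424400957082707305768782042284835927649821388240343432743727291742989983534180654015277628371018163605214594403284059411387213010042456183835606889336179781759375214267561797365629043816769975866356125745403175427778196283775858653473,
  375929143123817929353650114743881560812615707390147142975328596507630907575534160963605013297,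
  2092454474731608004390010733239967654351632022498111341047153648388254799113895589255259690728359567051611336627133180901842198812657204675918271782455124428184347377949514359062391582929965372298083849524206447234883609105799315807151355675609257816504850712394767836817011011064091871337368859231342165517105,
  7261750404036217984903564439370135143384219498860216492988235976133482009048749963414815102162004741647064182975182114348400936357955590007115324692775480302087213025807716676072485032986257385706384095206474488121597885563654967854653363993863123155157308208668954965278146180217677532117689121,
  782502484720542463398681483128081978920768198022792947638763089923486352551181787019364965375347816985365120835078057542261283563867649301620286032257068498865156854379670779726917700780073662084689624625846672467579608346537191694425731596736014396919282460402681649266463889639243429084849471719055376609696821816963966379450692267179118105034692055292920625,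
  35430368606599944405327193741991880232636133107929740755189833947169999701354066413431599217881463963256978910338701385625299100341215084640395980966281433460613461193577008118230085789559130809879514028533132916326076048943567579014579671873552830766087896107503248915334608845427725516291780154575896998549433520385299903130767020042494794833071957419621667324502001652240805187219581727012934007149722545876542466868964639899431446259120774386312418732402678177247919777202692630345540873076352717516408645097217446010183481483067307081399932434457784476853942745877624962639176268896484881197430327433221164425313736351910580323198619527188925941493595152840386691873,
  379748909960593080910814359259408041111611224699963778381270686303835227984891511687534200772241648041763190772061453901157439805470381628885454695978853246306513979520174521195216658849782654121788103307310739302508330310848778388717087306963019322932598743071952119314708056912752998084670511509945134954216057875493378397784183652987659457397953644318193357094363571675645887301804561534819768306271706708170213388054307198617021706505912763185,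
  869450269798221487701946926899715718488588578478804694490383221027689250759234663950787612043148804849333703382743873042802571402416823220819112811240165305992585310758570144886467482118205290836198177,
  3150454045378113577673761449726063143857067279541792772695019996865263053409098206249437168415022903371217641884454482105330525658886162524923283322124889918384488580126306262689172850058539162724275363225071395647174374036177690738241588831422248982545006633649619350759061848629945091893946631521336586300418425256881641029145780464706088220877277895224125498237965124525087821317630008727181954910010046883927894579760185579648223481482408599328372531536904599014358250135153874345634368576725461115008114409521164476977251129938065670945,
  12017965553921773168564468408972568746652203281718891276128302667242846595940697037782003332986886533251713641039189140545443432791287606713579028813750630443119524002031439439580629914992544153297698516339398447486218900991723058349652688176215995003981482572685864015568720015896500818234101816561647468223094062277498766078729448549573913249894807626813471698547489,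
  6055603092316081829699031400307379227338062212984870407344170240810165836959458303220174939538569318711732909903712591976041311321347847831529143178426753144738535668488094478704055839709850366217707790904807770838232009419945348289679123182552478273700206410689097751742325907678898107109503112554715260610443726048212771369998860497532213105004757876040844727999127771573936250019230177288387744372268748107599259575840989518492427440276075954722476849,
  15245452648918304331005904246941471926642064690914008233110887180188806822460276844842370230966358605649417054934197019480613498794414182173104542382949649023827551778863117644724567759735004399128497212760989685808993611675750846685111780525007527324472420421581551745647853701771019133880344497232576142738450723672392889859683429151794792448182896080325451963359361143880044760999542430019293062148375529055306067517051690449532348389031644556916625381053836901910814608213800066520240333716300316662704141118066398904193367315879390557621215335121547128047829964859668310666366062988944294475960786282409889563169413823313079641933444712663102998268420565308686363796951797054767767627488039299454281939168103116641603664221231782197294261022365867618041851471977794625447913616773305915558575610009248596621395669913283342366201654724275153343650898435993045722146718327448205052893079396864958972807218032898866,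
  232477308747298945884140246883928941412036932430655469565673120128130555364615158526354340519338351092924473194660102621336697743783386720266024256880085577175752109678602668717239543274587263837500864616626636600113,
  80301995710638077667570978140159291593956013449527837058039008465472545,
  5590175073095248012566530963129802189576421878705214348486888821919687413334712261514396108792888658861038481114525614328102696512808497797869973281157652354435869788229175412413308978671838670959312610787167905084172120203784075885165229623172169808463809585,
  769907714534072317039573789133566254230836103442827979132399582662382897544181434825767127953435737888188130014768235010172098732871454672041829412669152915131479734161694323757899771152589141230170851387590256122122370148403794212398337783681814288167146935505365857155869305457535882042689853309113197517587607294851148143027692229771446341762165522607295521,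
  5589940460509451835212892921551279848548052992385701262348829831684315932167526342621873909260523088553396986803721833721199364813989499659162070227361963165027796728563727799645827099697443388758180147040350534033964562391138527072346391626500160153331092529,
  8218115785825065922356789411021423110950764527403316851303852181010589305797572760330901065461019828807234731969622109614913721234569009,
  3591120385393052124094202158090672281111385955057017380543864452852573778744271067683100782435012844805806019597610526830680344756440884488527836064531350828839637817378662703673809770833028948174800443446380301045108446726053652959616502080391005889712475250829684744326243001152414719396559122882757387849172248112386652202560414377707008878253812675157629688415966787258745632545,
  3149023143395577708329388114185815291813646246688002578558003306053576138920877339307586077998834876193866732345000201372950218888051307192039972915958334068679270853069063155151818484786124154445989948997506146633013711781789149607062492053389177148445389999513543327920595117374683637820855247895854292270930562422643600126234214788833194940286827399336542106700982894556454705733493050578289774790748450237653208363466403995953359705271387102550946272850858313402038279646793600407436772777476228533971042850687851260965422942140005267249,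
  29961934829451093010884204510384608243235591771634346311757237928608377559365464812052393844977586848288536933821852097641843758889846921450763663811891883290131046932643851138515741823610551595060551266582857376375557485615336434937390994744158668095670018888728569317039205242992886979810033001776641185243860635266719648634066621952790089579314676646665142409155320887621565803579980489836854469179501145530025742576574071951323660095715987196231129110074390505906176702241,
  2369010444355844765670208767577362443700151390467131781541685681247997941501391626779649131782639156105968553341727497507478531104858593775642799553886032226508516121679196570042827069249700286966352334927975173358192453710814009020592243742302874097968382370543971666471581379431204569291390221383507596207553654682253902645429366569733908077772453044967902566793167483210865557711398096852820891657314745774014877616437549572504211817434467578893937877535108304140858663651326890581820371045422733735537,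
  34888530363331949777143213667829348209003277623905429516807169599412136641055459672449709493754665233648390948658815813452469787650736456276397380033616296419020813155193887780889158099984226458332453181760475853110947877345821218516216886841859534831549610714504826744446349875446153369938098633258970962333707849360526563084333114888407781127953833566678894742444345208006896734730552668002673711918381715021653499434945139804803764178153670747018975269551609482095638171936927801108828578638927645654784679663842363983027263564969174675233837812235936092168314415745214774441424794041165436541679422853463532266734002498075922550204377537815300914352536268183607359073,
  1790278744259364272412919217218453017012329685971751861846776635020175970459579290475912395620812742506715211320656615177417887610070342140491955697073286877683007076110096897939277361757929874704117565180911361617198967300566974477130342402448261598441411410170490153644914242499919935311125014084269925027617,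
  26887327348932346939582781680745497870875501415425107343194123956285193860139924126645402744452183802376893496457005885650866007728926582166177477710383844198616476876030145001968130070935837887802685298207005377969756765523451332869129120670138405398294558112810465993389776506555954291470045746463182659394613895661905038572386538444511617305647661565376198511041288695508955675846402086643180818762022092994942645185314181192685014333984242864459000636696409577024485674802,
  11186851347009279464397746619857036078991007533260778897919886102450921891998264377607925856611925802672761593838045663958399731515747795372402109571499178021528884643272908720056271490471231519121774397728125159062284188274588234277796067989245569805795718281405403109042062307284946347915152472755686322685359092067150648300707409215785646424246415192807423115285853037092787108201042490765168209358695254460963665588634144807954887788806341103278443677772361653579640451109375882670879050486766631818424655479375461037028977,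
  5454687844564849190758253883358048932224818875109772746322257044422794252208651960128720702747879601985538017062787302087942843422579377899221866025238189644801835168781901166195477719496488224597932394615828059762494898795302715006382978523538629750406921265,
  11175473753818654381634744744242827914642555349996724938292655885391110781774870641511666726923022310499487605117971276203100137933029275692268244180627901631628764262893193944063657706443529185102617433542994753062915914609028795891554977610586428994630919128686770641186745025819932135990649663810740934671512472546145530667923042686227342123858067666243012517479107548470310250399687868464932167758685913890407353917578018862115436507863765424636625211151710686102986349126909969534476890582427454306817267894710262497945377,
  28874952372383529597884662822883213026253768202676955989332255952005347838228269666917898135248216281336127952710487961044400089150423121038150545937665856084664390173594733749185960519718498822866245948705797044799630836369266736486247287423821938075991505085142135765178213946722962986505913551109076761805838888765414893814725102725180149617625071571478319871010226531562160299917482225592194693001092042944749797185475175602737980675351979716435054366290561343873133711154,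
  2018201174959059372360795339103865061718459568439179798609360633765005776423480680135720915086415597650878727990092019755364799470157046627255348961073,
  763585696702092262560074895380569923132377038288804147770419413301378791500151650602411026572614046222464713404432158050851289128696137412477370983573636986995947672758145438653797452382454173489797597888322317599467232009852050646218708039498240590908079979210785504248935152947968263863092980685261678539677449631863696809765179672484909609810383218422201377,
  2972271980428467169642349791025830401665419067069826268283829782243161319721549662637517274966012075271749535162437266291729706968186151895606064071512960060971425924488809238448488009386154114983015275549701542856219680833900644474799914694457139006806217975988833896587223817647186334243124650335948608738404894107709184556154417467403216623684204437693134285755545237096796844412156807136644363516745057508880487257244159918374799540223727423815831189202971424823367760119932902962680443262492430185711110395062722031163989286962906402593,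
  2779303863419875868416561302709043603044290073606218092409353455789996539052756493475554783226417697266423851730631471330959839793588188248924677152721227228090594510677747532466302892437193304253737412971595126699046262721002553736677177161028046700973031662806123295915354454567495447874639970813538701321707492552281363222087079349792500811147776675669719892000689178080001518707942301634529564992638025250247560411870233790909585548718342830300040916081394067233825585609640769995548578051920010734088066511697007192071064819608821243682,
  34886263286334263521672388111653511516292273519494995516479824562184964128038241536539738509685368200305471321491494106190521860652886472382895632106189558066569457916224764414818623366188741086577490489949869756384793625688449476112873190741491829102586460875283362242930437661750809102698788361001640839174308670313788210002045251040994973683554906002471493141744907433851518787157957409612119504595355416633736571089591024559469551580080328076089028631086051646486574941238709347287543111657990362611740304839032622539408405873630057515536216818751768386565429015145932533266612406416449220596908456696791423797090537115690115657279759869031190305778861471776804841265,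
  5274507432632827225631263114089364459921076887626353267890542344107347558640081797710413865523492695638682501635570937746625048396356756053336919632105308945608716444175189815868159919604456002458548037606079639484661214395363939561556877530316281246283610401,
  3375079619206905242643822436981526033365932636279941524058081742862172535158012582149102628995688390732885794406624818746878153811183829280967393034998603225211469009958312136540049485139292692607159241594011835454213210318448574535297337896528858049834033395060807639554517878693673059590332300661459571063212186154830476535646445302364337738508735373948652189042298436013862805282,
  1773293699752587008654748146594980327548463611157512713072581932978260850973388458350236390674404130195701544643444165122616812608041675399756989219052752257277024972530169511417152984955737269061262895271398651851871899717785385929954864989956124135875937696798572317383737449225133426280945919559470279606049,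
  2287760680683342693720376866033956030314806123209212852385826992269484012855437546980855907245022230931635265417254537146047829015608208766040923193351570106217900860851666831549562999690900115565004400180046414062032556403495541363964469253658637668785021570955516315105245940187795868210954537768422738556218490307195863285969056619157984319377653335211948406145239755249535034047272656797756898983992581435150060322373332811783148040395726827719601192156008614717850911179517116375353628003614228352817,
  26142614961754930861817067365006285688589220032783654925254051812558679233648707239922990679710490827600891931543846823732219320605191247366107074410060290224991876197775452757932158723127794941563491243924050971225429625423141052130229068516926749242284599422053847153039644330297289234019752188828459501988655492958055275639858833743739558381995642669488592477258191456208397608952426858164731850900587611730095488319907386779248431888485401152618591555096661737874376408882,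
  74471906505980837724168380079408484460420033749170186325779806460982049,
  173566840134539694432083036054944407599294537834869572883117588560744251894709032717393183403531225590534417074242491030673899815139454041994771937476315018635566691318132610555697,
  1017296792450667436621984627322705863724785,
  505787833991111653453658324075309599250982364315188107116028254845756255330191362049796799870834886689364856438027521830205189857,
  369173504157587722571995808126050278920187499482431509770822876340193083752830135078614511329,
  490694603236022483551195136053555579730875245433580239811215950406816865606876547843608554939729049876033479525584954459404218097,
  891874412942330977855700125110903625596675198322564424084674657053247451672151543945110712151136022339332032969260088985148713012692245252183538190704531725723441101777525421410262231633656069361417969,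
  7233683898252132113464691738018810990803722230541213648901565014062221215483578808606174192805082406065627092102325836604530822845011277394050967923089805914914817064417736693889696509048088736484609931649252073261345652898406144935896296791436818086129013479025242384990737143014186266099482353,
  82405400627175698708472744676543260572417723887415645990054633885257917709756391745126977141755032071576851538156352786145008833798178156465084685373234807447512417342472579011287687693117241440171570038258408173280495695683205148234719275089883405295603260460773561332816779725851916242451066909121540947134386372340632252253221064229874886085147424073172242048496675242891131142833055174144526176114288472841852800024805089,
  6182756650845160874893779609868675050973492868280994375782486064219461271848977713279581458822291185,
  243602824339061183254014205533082347466725339207616274152161821802995952360727113575357229321009130327556738803922410904842588419355800992613894768294259864090832085235953538542073882890672129219286903337179683249889,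
  865412541496804498915032510573398282812793978407721366739542813996683531751416937670878053574116967734474637819485548669349207710293674822854931849058346845906391240695536810339107026266315390097481457,
  2380174200028832925635032628329339377971370913029093305125566005961977463467343992924881743099885269038244998104933527101213490153514777693045790179057,
  12916357035412607758090181689341765738587312138249840390271815406909566204973487008454611655582777380826429662783079976967365716165689638776717821319251018883368592335200835256514867475714208459498938875577225860388382610460912421123886209638198007266168844974599129172563214846218662944279320866403834128280234165062266580426039222823619227549913817344819551608839905,
  2032458219971601203766219029329447039496819167843660385006158958830475682162927688703513468969683304900848242023989903823966519971822744095852973129022864535921722221143041400290701620469008226538580198546030730630120647365601129022578589305571949857955497406891298177759011044114385123412774911658163167223521,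
  890958712044139806789115406260300188015524932683444558296237697052867174252649934892132820255258255427545012190562995154397365495289793521979723069333820410393064054134643529497903457410509071102682849,
  389156668385861633241708415862539973782430317773409924527613055875366500344310982184171179548124109069641831027255190443573751164488532532536838734941017479862485927271596951446867203771422907920218855235329776694052767564587659194555930567155253645069421532741022620075872073956845511390393819228197473506114418455877901297480376718862445157025311115560323783683993230021323126698269376604025270691733411007578616586630703299189339321747634677473,
  71243653451820289657055988602106771477986639050429138616290158169738615188115518036242532652787233438176330805260918543464482121567515704744343386283668471777565375814914507145821734380670712921803522139922988909184910150384781266929505216820774451248275425261021339527534801978721762233311434450951336890143368483533467982835194644562538389455840016256422755200151166026101561530164921119714551848566550406546371042013766999264215652667579407428801638350490933695641338056382187123452880315231931488491086464494562623370037405913040488874185412304343587719780563758442395864490403569,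
  7220907790040405802377438492882427420345083800830476069968462044796856591109492293853071574169086568232285456525377937460185787581997509991995004522318248453398930227722445994438958393442937288678485286361949994484235264977262416011422575426927127865835749437600860938459207987334474988907874017,
  441701255677118278093256184873614677015575085974435862566812459827047152098460849104744765098347880088604889223693295928037602532916239137824810984351601729196226467575758306901457123754801377919953162333534729573247020401380539299369538438084517428007682635664750393825303805431076256233860529706443490502196490956367670134568265562778859095834349248405589497740859194519131116429161842450711250511451159961619072968353234921031546680614019374800347948311730027148730136947561923775608520549242555405728394760752870838788488931561725272541047165844480895888100166555544240690373246882557393912460789611401890259397610697859871066900180256497,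
  70152624709916800652470272388779471669182272318445879534881794947416458081814532113896781797200656322815891692081898202331916265150440808774735572803324574145995622035666249476157027286409553378380134844027459630772256342088315509316892131362740921867721274475531166696242497762604178512549956803979341405218142100452867687903316282210884689768416557093516154558185347339684870013035614664959855758096301036106229644327876671647762688560297892951487664957589707758662243069959320825847104023575016523712778604278399321559799747278657075292409716288061368600050729205533097310218798817,
  379748910578776689957697136578679946308395356436617704417928492437325433142550778670884722019300755179419108716813798581424982031454369019607987787530094321677099966166827307657713019277414501705736120488493657282885935169677172963953706906516033870070730050766774919297930656609147206828831241799983627544270581310957649190913547239394255334892551022371014898470422512578132376463700337805760474786564313110796654888537425211209608706309822416625,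
  34888577629237475391140628689039400728213578422561730690534391294526001381178176794723497668371520059958492608395104687557995812238004136055190556130102110431380694852717643964770115687711969637364037681085842286245156493956164679421769764035204633516663445902655123705207256017276306293424120241873619177617709226326859118454722195580783838852783711070395076099208860830922710080551320105473680459028344522793246092807241250384442340998377161985422188704788586024912100447317040735445342715115852335970262920013831533271874535744383165017971526658769599862926672936972531618757440545722763602356824073527403489821575075455706287271868657356784974777975795472687006140145,
  757771055992256652477979862030950956287345261948022652818989179927051271020166255085315804545980040725999973436279089988966857157119663199217485308588458982907834604075065226101058433258629430872471281,
  12731223938780150574541719644467109461852322640720459856168444219049808269442180493099387149463602406379328558971258639142863617953309352631584322074562953511150741169457455298511088817220458365244769597031782096866112506823852568611894029048368595903359937567820367949162911724461226581632196206253044114158827239328633590609612511418869367918035224900436981276919537,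
  218989960384431680337778597893546959297807323052314219033827856645033956472641879192530951297397996851530269790661207328411819010243633508399235493213559728550913007929287919217027230662795780882566011646261177847974639850604332875776892577490538862967227487217574877924258893855548887609543344636076763815615963372985404629656126823709976935326456780961135250407442641783568318712562278014168219573214135010311287310131808255752079622524163885057651488674073118104873948966615188499282937119759508693005779821910563789912183767887504793867537003214808058838650471334647775217261505967427120490471309929964236628825762508212986055576135605355415971503975805441575187060029456449565001923087170242024440780673716453828592664745697,
  2952784381335502917772731391909304626748606088450109643837483510045501420661954508816993045274821562513383799655976952268400153386722888083750585875213987622016973798035751818562800445463512772668793613211399315038239010863832819084588873019812721012318669342591717842501980895880599797216626200928997036837727641635660807942098952041851920625559702139069365383941572235499746335283695015222460202249538137387880635478742469085183915789671178839745319598843930031525624185239680809512560610750834839585904618189915737796314344526447632283362,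
  862702821269705553637413377633530643744125104763266301021949399241375887268988083431447361083830960702177664053741689248493157820267365281753535920214129070260984350033646441427697587868594799972095729,
  206273165534165680890148179623639559531809697306365231254995156818809835169419017229946539914962481277695145586624069244070843820668508393290078241498508902699591159071946883334859618558323108432513549973485511229044243177857170101128350871642288244009416060509841470275760287029966255704915287660045511926180681877614114255448592780567192522781983803399620838638138500986593,
  496152281456832438769914499068681713903334816317445351797486568169976458668135200548257843052339467491884063439566965556703305969,
  12916357035412607758151354016834849260667281449057688283855866698750650853026279711895570101492864514562620310408252971907929564730855578593556895025608834498317290666808730446852162956838474015584707493578492756830939436806151638374872832792048411090794132339593345145009309685283076122323502242703347286043363896495791662781951772855035003149145256686576250586161393,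
  80413230421578245461123137847469719938425043427524036952021691113756618430539525971369366326931778942260210072915200724065676161612058083614867044680619940010824265035940618075434007367615145192031189005430316269442340026341150000904013652380150057489910881659430091269908601875624778593544466167785015463185692963397927586935842856001470267540734069759835697019591915364956060605049605587180573404531393029256329944715583713,
  214043121744230331476692958551176440510744314348232729579734557839545340826606849876107763809183565859128185227968944111617972601063045594088238260293627922509252076449463745155478180831217443660785519954757754272588497035558602293486287151777471948822322308588023926090750195126441180174000374104432021666654778531126302552979793942225567169505217101743791147286025992618225,
  219217061461089139954316233154894415853927701412114657031684070279517940580021473724357720881632548796640528821260689356749529468928691800719160634269609015784283969390003056396758321081899560939994200750570300615452697784322613974052157992770144177108244086889893694018484940178054636488913026792146139942349361554583077702868806809248951983181009357590061404846469193024097307328452329025858256804531365525141392857455430420746459875031056757033025670442652332028138036780593605386413221724494662112677420307488126740802114375452745888965589416713007700581089667757912868507930547223889749002597034663929186320885893380918206775024031537204315015136882774263259170509795382219002467113729420212134034027980669701427404638273761,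
  70148066151374193397700017235558741057558501792804420599689085155229849485838801089625279791004166586033269676840486678868344876812470605501379518416526087280654940895915860158235031208021356052896112974827169571362129474040786889401587590053375261705178804102044139011375135909078261010499024440815412366281517477383205615949590008601559061346715119240008733229927736333804683743855176604983543830070784173208600798594780800729924444081720241642351673256322242480579154619695309547050201733128519572055741164051995116938478006916193777247923656049395457464383072666014100310169141489,
  6865233043367054730354610387303480560571492841722889272947565280850915985297520821582402117785818785810477315105250628155085504021597754091764524429761365670586183667519939626020723172694021937540745691198855733451392469833446201547498664720444577468068309578808594878054345228862464191407390945,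
  34886310517649323276930696903222296138463558448239809904447496509845307939490521933473916917894076049852820697542741179377392788835840088692048171571730375578000842457333213151692751736912389160845335453582035551261824471659315879178863847867438071810701189630287850747879352070652142355956558484938533540549613760974704495484815469478686369221981136327509065020945799179257013540366860723133930540613888523965973598422643225858039094125994351254190453762288714273959198533022435461560642547773301241479219557480267234074154458396166377720101421436480309363298846955720632241215594896171765504686784299443520495575783488434646645578076819868421749768244814708992288932065,
  74856942793567935376293013644058621860157647890789952029028578587758901288411373786998724019209879232261430859495659757578943708468661198394701743238942909918505161851361618283631538448225722155588648787636838642326632565018961290841602158775929055057748025585187199554420941941045728377553481372743073778974506996810945946482684280631231703378004258954777153683778730709638257168486693854752175684203662722819806362211545313,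
  418379522765178682904989901311169916991105996767362246620321162402637072446819872672543050834172208882642312294309229652672678470430176137124338693718292492432942627165940779314928988200937786331339712020458761662005952651499536534712598283859219856620921707130260454903499112676521194313118865261193731440799973526465417242385924137354479265645832570707252030066465575357220740921028959525914518911218521790003184712961366366808698072880862898346826103123973934840215894663698014793866586780411336118271621035214111857364660213231742245508693445995670627230652626445493125956347225722674120946376229817427089858879535273355187855886263685361,
  8099110007105021222944210325382583479977538681864730438299324415413339622770394777859393070791208778229167119856972901831244215495572240864201855597268980606085971087470888470075310672166652495673354611660181012946747904474357846925929275633795637250569944212177289989409058641396767333578190862933201560321775410409663499143988355329346061779510983942742596695309630395174256547471838580712439078018158803620555569872990983810038858209254634813462409331133974538127440729892580015002727266495628592033941315766120385698977074898739334316584906479215042891470719598457462711777549658360220745700283542968282415959754532684317202188723237116741912977204700888720817073424758128531940029055904157397605017257874771764333845682425961971475964817087632327540430415123425962520936991229415571328396555566118896920549432817272957206444009284966641906,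
  6839037635493930490505268671673955837556149943860529697591974555572730324404935988825130087695598620131884724534927408273585675147643676363890213463627994796345549399732894285707098578581357382472642886925789814248566231045823253837377997763899255460710971951118357040667856154295691258009628913,
  4111457938220824489045686430580165168676648749744796816149787889,
  2768569398091924502838619470524859508459607219327050173117549805594521482339039536332925643806151664659829856920352884525281648651433282172255495485913813288787684949839910041489712100577,
  1351544646143190061160155067289233447061157524456623572682569902983280566160653758580985543064236975956633293136439838523829450044700167657791820929653170058369096702922007322641929453041859230532855577160365711254466956322229450451870800941420392018262968784083562971444465,
  402768427430280958776077270479986757196459441647500207577639408638891425661767281201795510566991391398111148682479551674267065063866896379955970966805378840110296812013346938516072392274216784962537900486494078510048160370680548605396720972666781543358543911961398563593468980899791156449,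
  5937491548298290446254916120882610796830859839295991959641036360916640988877741876612732484458733508581269205008148538923917665871256042555070615443494477646109382554078122115809088156017370842899210811595589442602426159168306629103262154102734093185619116531595970564810185986132630342199570778752951876484552436808157154207536970588079868935354924657593759098812660334477307671199300414677535671418929949112205049842729262765622281799309870515123139058,
  413333167508983229245850140613439384149531027159636652406298878270217521203196148003359999026573660282903909779069210561561658133429470974015606347636684837881299203933807063925058119796169488089856869532842274247772801283324509778810280855354051016307046432431754422908309715680830205694464753053390338018806240807466461481430685629951526809972875389661279358248490025671251358968515671272000931648631409070782727907472959079402462997534616380042000189270830555828675786963408174964666259321581657976598201548898343523237028905202446793061196071190421690408304559973797373323646792804327202050654015478790986841373981317669899462552181715426,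
  211526513222625591858954360833402439551567208134873889413956969825307817487595459584418122978288296666740589414293976505740206170175253437727514990780531144132973493252806376661431194068716350897725459623060273450209,
  3118250107730134198214839666677876326005695786029024900490492198974407720148792207626119913598673855204648415804439166883576464902519727367160295490826415606199226713399937363342175140039687446145326588704705594440836226022810318960761020831130569986294665195780767287261363876314351684563286853772073913829297852595893623901157613124838549500928492045887662815023456855120624569586,
  2130236744627137116843487095209837282012290600593439765688211299908929648414436002524354775654269305443133657405937047680562875221428117631207074616909787297527438567822228047743354986535008977928538289879769947491837044647734455952298508257068899055812822672409288761140699100603039102890259681549444159046018372225722571222968317640534747350142291209426016580710193274077878307747181715376985350160467409855475721805427967577218185088903666768689759689529904507615895148124191537866622276801243258204658,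
  711564532058363602591101363371252831363811282814096783265055812140024604521101734591822252955981976166623256455309289777762025727820588492264869696115290085022601292180784548314527308536247198876818608045001899876413851106938668850449080699084889881538739332442607237000088207939835153305984543991681662347650970975177493882215979683709475227609947748811547873,
  2071231346737758032706693482604075239188992308615003029536974507184382292022941086449499272016302556031689378714963482594318946265594341979173810987892385513781724655756903945385581368471802118099119842607502649696284070105735122955415547219225557973672990746181996574377851248732442408658602605014768194115947803920506154462607799752694383935240664953828662635744901508040947099312172015430722340274605266828806334073981218862965192844575573314583307277119269465651631251071355072120139731368480291818738,
  360334355272761693479587154928649456866768018325207205813516205964941579013760890266004468336590378304732590872474034008827698417,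
  412865790917161861039170711935015200333705351591572076498313759281138885457454368071545361734962968965295014643761634378535887948639288150533220918843909364992326178263340111009948726516225022658821951001969725828768119039289552772743433690558829067012279525978361506439684134498563886426029307422335405477658688826232911528723959951976859785805987138400702947372444335723004463265014302288458020727626920457792912867493663671790367111482592418896375612763381440557605436317685081876867165899097647689690301428002111571670288211862597928609046271856359234743082954884154004828481740835768936438894852898217026101195325752738460515976349879521,
  5496326603170865103771342229345321012793557136885902317556014774825175506319485536033560718489976053410107254924519008473070385811430268691495601676090532099863372699723894850307665224435893360875482494426682354003848273277683586911372537631207885505256854505122444632582196023235159330820491985488376012424424546723925399282474528916104199150315556527931925739955277861287461115398018956024830755973317236050478537222419657683838356982180881246898429154,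
  353493751224184735830956853939783324300556863647931779386505111914282828361962104593544559235586895353088764203589548706847387402280463596236138391852728045147622224433454339977849077493295438967545202489972284657640636437279884320921864783032631653562406639337306268432384532462097802446744390736759644965727597957873880558543179358995006389911052697787307066867943828172342585384290753180565755328560816664824807719318734742435160649037275866353,
  5917213986913593557678483075499171797683043916608866088322972438144561324593204596206168459414814034667122748191777784850534812083372934374035058765712171528083514139495927108556470218834388668621449317921200941083657068416668446351062950399802422836514207250096475879294080599666812640608949745718064642561654219658294575559838665213382393556842948926876881388004738095388568122934742783491389100161573081916532607048946877099963081910923914411040169186,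
  5851408443547693483934614120166441024596615986956244743899010457265847327726903317543751432624536350241287993181434562491882965758016517180560568663019679600225519726465704251218691705882855392893319341616512514048802619855252170734752415299757166601811118728784528328711118499064931744076578017,
  200061129619865156571997917801240332512185877575051059913040707640826955584603838486452238351423019074583695085386551251556301002341777974849062491578998990609095949110211389094393355186798819241582778687041316809033737710460359490383599307217704042908308218369898401880775758640335984084853139712950831279572137833433987323002257143291461863755985065119588473110923153902833,
  315071084180053915591535259306224174901301519441290811277610558522122442436761796968722936953002744577436265911329209670968578381688806529694526326626050459219983496614150741420236125089659685460764042715587844358349490709230642010377522127300027711488910170306638975913759222008398414491745477042490734977300262681286387032485661436192610509535968867336939444925018054669199485129910678912725838960352703238309323708572289575957093296409562627314,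
  456806222432556320277104297505010266092368264955393295626627712825405647759687582250905987528959229413785110131831723906381765873,
  989457438674037675957939824479465170968033,
  2322634128814272864342142543827539503009042194417635630860741422593218844346354709172083158097711065578672863043512424214530272743097881100866546064865,
  461639869533695653722865907862625673581515113816398679599709368822154898015126360786406603058914663073007587733428246486897221105,
  863599833595768895365264278856725661080372914099208285925738068634616177026201179254189795678588298183442056201645378652156586248851510607216534807417866288558295703151609992297459916835399443667172833,
  12718275617022986407779153414503106153702623895523799257134223930004271365654823659756020479169809467691306139867313940433085947252152946227105816253961262532267648545996265100493212734120211982428286789501220375967814063699178087601080114554005498005385422318995760992599234014156465428463093072144820449938882057780178436660712477225756759509679348529514686458379761,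
  812544877420216617025238766837367256421150461505167883992555667183487295154031526827156514298099515673192125905691038438645642616258786827242983072640325411292377961607668920218617150771994424800099809,
  347283323256252444995812260968668197816347372418990632670896996361722662467184783125196897777,
  1914484600967102056345652270124624296360078996683586416091764628683442351486963655592744915164505483119916932679198441585218812230020809854034809529960530279905346765816628156525204062170684930174369359902490598993856882379635537108427851401248696194083321669741410425755335873862680267780805988564332848528881,
  755061335807485045182468186571244920176355124553688372760246524582306616295114301038300173166147040204598340326261653891507544823523999430790283158939130228805675990820628245915480593537303417813298673,
  228700858242951572429013523314972390578503586965754030296346903405034237968845207683727803009826815276634202288943177452932354771040567406351251474388900096863162159943971494917447654292041662042024841476965971168737,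
  2949309319737199202407109427264942947758822855396930871717238301237492219051878620323068470783999422435708830941899792425366106924221234788348510564376861121347316809031483541829399067101663179471934661501475293678592612670875607716863070195535445042190238622245588874138414343877902149197410802744067572876438407787064027305158997822775305010333282619034345763733214747706628562003945189454264716429547575461337008712727937162704999715515021112842514662075105118337521340803139050410827417656172224999600965312821086826600032795792890752482,
  5804019372672150844886868150239129042587847524714769793443812247777786470138132288809285783981796833,
  182890207243782509033395147231849748492936403088576925537739093247053670443672276720035793551872140072454987893369295083016945189456233223234591140911062163416880016080487517206113,
  586280554568703360531532119359784944557413761968775573579405151156985854768751551273699739879435818586194527757857265427978703627488805936866663630038439745479455202,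
  200296854216197834216550037880334938729509961711946738334342929947063919727007463033228143812678843540481368580227416776198626626500547931852440373658820018289941818487898272729339496790247058914772939525042046320625984670914798016861228895659842100721382495380279286487998735829167375696583802011982219740780310378791903692464158456688411026072881191437242564802773696916449,
  353493751388222425227767560824439897841825113148516923115294974206337794383944991063298876990248157786909941611615668398198601666548846318186856040774736641195390240679506934964656526745764559932374037070193028527354663163344537388923211747018017974011574133913099465726411677824218158300225654486039193243008382082844333045280560859661774962583217459209523570927175404491196951630848798271477665109972053344089310614997331699780129017901732768753,
  5911283686310205997959488659646852084475501056866534164059730549567291469009230005065829268689034695302420055254223108865866554032530282712752917533307363553736964575965785712817759163665127740332472901900150564172714128850604186876609920213478434408295533360777312105571069710641758401709820401,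
  327614761208140275893762605454874441948919862748068396127079515972268889320365295081435808470135923686069134868171337284619717788418093065603095547513310031182791400531340492350458580905871701640047324057985101540613019450496774813094290291522467068692144053420775551913348324620510893772871473652676450448062205707046314423373602442404427654340845163458038319174893740169401371399598669384916470694459743674978218108071585741936999022126121961954,
  711564532058363583047710360866557592238539848808794072003206835915278666481501166331931148492369794647864301972644928306721382909263371146942996603316575767933723825285899083381049148748576178467340896753155118360370494171543429712193645318882951330489408724002851646946771923266394109572283983507094387744891699514341813242882475113082533313558012447116405729,
  401392935274312639518169728734100390873952722103480503690807575432283118277262161697503676174049763615243466369074668450946312266345848780207878586749580523943930522248915254481337546061146605852256974691773473533142442796494162492618306023788445662808345809173533043375116466321019242978,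
  396909261398656208751584634790332590120497522563574141792922120635588502636466443747409521369284369472189312006760213021911488993,
  1258104608783368977924209056418655748342633244365642367266943933909458456704658087190690929494050851815039946608922197751323925378800510754111956036221397673836000609896483659872433645103641728589788698619336677965901067493337284869741068026913603345982745172733626566183409,
  5193936082677315324095716866600856710756876538061607042787614580717651001111978027590308868229008294093631908974726759493292287533501171941055920982244036359881747723034632048868768824721306313877452007510492913223012694438758325617327353889704178060010352545201747031302448854671443384572864018290992288844886767313688110048484768848080050677165565670861015749511927292923990517356635380228639702243206638316996460135874797246327543153522937759638034930,
  2529615362053020077733020572910400342330549366280908312592245686687846708969940795343071792063875026093338944298998212514598927427209429009799083651368606254307482673261793984265064667634,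
  197381680063901673149130303762235348080474238074460725868669791767519517404311628442208333601021194283132194003462262176892457835563971661987581087571349098336842967842715339384937056553579191373302614109891550296561,
  2932141765347738167194479359922643460596857162220656313162729835194172890036532535900807974320681277573589280555866128680036582902048221984158783220981366335030082229861171462320613190776252701808170886136462941152964358206289197846744795893344588155916191220484805284036102257416455487068346805179563993463463923315591605951771450809532520672022506089696993126930825620859555723746,
  7715042489104828426724508334968146045336762407681101485376245908794937266208157151651073929805685488193615821621052072123431623342546529,
  460085136534041834710657940580205931505487286447857838575173787357799335054930180858088527467022712736292781687131671951353333343758135532836415234121080676202699234,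
  458371607595914778449891799441526984593554036491009785693584068359504335119960362627265087967683385659710942866099155757143895025,
  52744488089376733786734368175633633,
  2082886948114435922437044843284235723776349899558511917758078789017458956791186275312622890091398182745474864809146979220023993689945683434640853185777,
  386234657806365189213720122143546328254825517406403420002697523815521403500408139288064861432707476231295853421500365263626605501423071407742543495096356733005194982047764423187548578335560132235828874827198225325668086100201315600071608662167178387679088418801362743841472064174984180961,
  584915942309682492701911121818791480217627704264503413373903818532127960004262832001515610558068414356296227091139759134003917329967597348390115465826740014879519985,
  566035440722590248558220959762211203676810232605559694183991408562207173064348603399492179699766073110350802326517821357250138375514520774428930557654827049842652337,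
  6270076922519042814567241552107278719329340732164536315409233487311088990497065584530118202218848319569638045607675652105707433334473862323002573261854950587141724268773667738508586483280525469366018931227307877732479505568519115307108208636543778570229821583069365058564422541483100042143380641,
  2672960407024047087915470881959087674087720399896629803258703785952513451596506825125584618877264196218587139129482764804323043609546678259366732893518308862893342220711825913688644302017,
  3932894702278362718324489157512202874386175563657969563239852416875568818089512675754799025426085873,
  5227891200224141831423250680139292428621428698879271142805013886222848883188161634148156568299061103006346320290582740431158142725863394,
  2010958735342587224166960524417336264533071904566174634414420660972109060755109786572161864203323014669482098667626516911779609555913917876710945240273,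
  153242215897639130533664097358183583586653197950794652742367670039842484327968661055639965108473188499835572628952756480755977678816647621679298507901205436180200486302300023993521,
  4745344766899129084515566268954757606532494509016771537850631798441462959361648518038433319507043095255909897902655355326572467461038366543682532979590166268489374003326958914984149618006733180374786606724458817744959409216822075096013622487756660883291514097,
  4705930294150763920030282236590029122670709603977072883552490832602273510302823270140800841796454752797136536184497279458758195218295035784253521153039856548471779898556377696987316266849911472948023749821925460642159188976035224959070280123995381213905954001,
  4525632582631095558999229402584742825989224247794046318897395479572728061686146431656212564021977344908403814323932508407397808882860948942785549644606856267535264122370397876431306454315182097934656338673616834316496865372150958069139529615448909621623912418,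
  228315640729445643238976190283864711711030154576727920602416577816815983159311462217759655905,
  154464228503242601559423957691720468875618824227175567257091760539887411744764378890467172165653425646228474711801274323775126000326225866031610191683845275913105448324852529031669873799635059014891981922860907169778,
  534396292106329663908957865243571287024408910315479503308286322941019268010573268442935971022205201223531355693948290206595078162240255385812929511863162296009724416155007106845986177892306876486428657,
  150424444010458487287048094527173931605081940382035714405105794346726190130406404696608465387382188307969022000723837943133904847138748507277381157890697177934819199613377109334196003393306266130273029290969784166370,
  536327668135604053473938570519085819901210934693458514122431169581517190810179310919717512044413665427276359474188094934127326724067339314058272073312948534930169073,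
  149633169229198444388715596253449988289615811298410832700525125425437548468448426807462312190363874639424544436520673028427368671991394888326040940162782012074736299547118559938530,
  602045927213244052934093898410593263611889,
  361243478320527393569376149159787676454477501390878013355392792282363810201572037851517027606830913287667663973189427698008898198655514741880318317075038130567274490510964278083638817639721360842145311551165259456754757588764062176507664832184226774770756695247955702659023918923537046753,
  2484999765342023146469276443463694483920878520298994285342967003580459129571300736829610953429955339948872622325966092710160677961534887082473877877039949663970653162030262922903157845987,
  224496197522551648728996563653407797697663057251793699020307395546473892371159475118229458913,
  5851096625628187709028329897319977733031124100136042451759331277640958745099600722398616244405440627728930192566442683798039592313751786552072105285071588356567617735377674914130123476448362734725117465968848228480711539759673677592533953061916990692963925892976190453504563710387348725032929265,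
  148399620055886104036729779549597796436827950844438392892268562338836192611213789122158788214841587752419909796420152395443407435279634425874422070076743575672917738775853880416381101519526644619374682148260328542194,
  1903021135445019345409395070676928619592041849492129753058129945187629300104623778872587070170870111927919923947418261434332812507390474545683719379425,
  526205109926654878597481224712970389419400122747672102135733159150878875823070336828171268735219358900247418953296938415004369201171632611757371834119695833927626738,
  3209463408340616605783796363996159279878281533283816028263011313,
  1869506039867953082890486233876953441465311756587551120327833503801114820589023820993917142500367374779897812709549364841181186680708244897656893190130,
  3561232936257296310300786841920468693092148368799694739767840787817151813752430146434599730320269297,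
  4733867969255523960584849540876668395383376640470667895993669210258655562061709161375912392782353453177196663451857874429548962944933858,
  40510390949359652230743777683297249,
  3042342241231867261288395969,
  320372166706381624210932703821441522003214514013089748318552163992338189405072813582398534865,
  248933165747040961802285456386971035802489198858538131294782309375014363478236663772874920914,
  665359719365241924577757036038259027858369,
  823654841613714967668761177757190302676129,
  1435377499722055076188115873,
  472209,
  2229717413612563165490721921,
  2963702375229201135355312847803131154754218993352429709849441425,
  37405915358760857298937156951258241,
  49478350281182708817973172724486754452402030940127480091586133475075201,
  47538918987552131500623085589041311284558896517631187816042647429176449,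
  2602141225033275372009871845985982226138178186759980804714124177,
  32842371717836150066083838193423233,
  1029102863441394790243095393,
  119633]

def datC : List ℕ := [
  163521,
  3480200052318180343749443313,
  6425750110955564714016512876986103992899723706051413595062959905,
  3673703747080351021499842321,
  163367130318820622972094782738238862662727931278184916005723846980655655479878357052328731207739979663048593,
  8712299423825991083049147639382926234481807029276013144702676846554042662791577240844966544661446466,
  6811415260733918409687142782873829498015794014712791794773557089,
  387046410094837976706045726871084888511069985413902782140150669491834965784492973457854475058847199778869572405149440694157443713508428665426591476383171331920825419081285879366140781804237497267523624698104437178291,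
  393774124314568039116785586361414312633499050969878293576434633168518403101484648289998871521526286836864096509954326416977934909146115837202136240177615296271230485925176993548270117647479438170275692028544415858643,
  173403427042516162708067184255361997619110949061292090561872939878680503284070739366355483096538613444411377,
  13340945011520971147881450997008716074070505158133980133969463447061581967362174528647641500941010343504836147051408130755078572413857681,
  76089632181497557412821596399801015705363013947791220263907847088250259606079608942229670131423670693460776538489453206486837279819913429241824643213945111951437724660266624250075452868483421565601281366599264221783190024060578781335009021179926064643338142989783566391179220457035385283689779485428453281399073865173991114329268792420324483573416706020,
  77968907413085980502313501345471831845953603515199931421686771678749587614346732421130304151450609974020519665785365708632510151354180271001777800005762094769384746214935851017700209169004775655810898703405979375475464263363833156810886552957093208287820912519683806220712106639315773898677598695953085537636175412934231184192777863696754712132221972465,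
  481548224123789122045530478730526427030013444185986309464230826233122063813874034004049936812400466624746879965747587816267678200776736819272453368255509819900986397975604919783823822537611775205413884372733090285515987498506333922781488579398288313707848791611752740929865331583314483966491256811411484199735551057336335066392606079393187530153060606657355696057816325260821645153768052290939699941661244436435,
  13539512536202404957062794894988586267063813616011966789321089800592326387287433897741262104464780512282731472110691414594879824333174161,
  25993348437898861242493412202992196219436864471523117003503566004899763997115258822458564369944711444714653895896615309651899852536484206898061531216092513833869724425941703760924845071102456227565444697125597345047816570782770578821888350296799358724306557914643139353026647341724656082888347410121103921018808145070411077965405420278937414077555683827995121475130436330984629169269724934518013948042754657791515088597492532139946717314178183911659457032126084764084943565733055638514582837173911651629357020174549077846561542811592792418707390751235423993132529,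
  484497228977762180111409986159103958542014462677082930258982192591610012355474321076591456195027889733405911107076005816365332871509510779013165690801622301262030683645359831160535162510281093967412006541553086927257022503490219108436862641513524881742439445851423444303755683090927971955804300933734649705484129932209007412023217472202795573986888130417505902482860646130582874600901220007098843317350716206036,
  14164139601267887799834457154464733120475051079901643755366400645045711438319980494494575413996469999676892922455288943992956358949656545,
  25787050572911148047955715199982147052443561581433034402262043691831142411782850764925911904448608307404394717181670032516997392834514874039319950365864307741229895671318330357842457828397479878843839294223848648416285683047527444453367775717314290001075069637610883397340618875193208820147496763190803829034312904928085046290875495417027950126548172674147775088542823539388974581273403363258911348642041949500687927018563171157480863457688056473365933239777485183413406798426116170977411167054442139197700339708654236524981769213440943753510880316802713424030708,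
  17302189665708415947253000516666814898607585607772126258350901507140344021899563550573328866170949298546085616284977603231895381802662077267644044935284131615960953913601811261449991225608721096659161182239597514372898176771775817518208608432006766260484167275178454819171229698882768684859107513991777603389582068481856581571006496218103092329254952916440842447902088762109012099735949938504362603878506862436580373099360575849819801989441471441300345297622689212085514736484120828701543489950319874566136588231556171730888923947338972449109195157519023080852821809950935975464550699138885054820449902858397676257623603653115787264596602944758903302703518675917293646495015053201571187,
  496785131467093806513576921090356277107922754524207569891067933156982910708316789474619656059167094187332633297625602916553282436245869447411659379214953099026926926960561579931685832759925446494764772482940832891066574262794346952833190590467158429245961187282232531343491554587525157343063841242574874935864242499356037587714423117225015823492360899349967084816416869641222594109189727527482401003722166827746,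
  14377258098799254702231119109378952162825154266933067028988915288946585112225159229349487710513216162341594675426445767618359091597376225,
  171163683112413978780614970195556930413756858858443854207482776742615002132140645061393933421237038683061505,
  77303291336479638992037610480738091979089478081373784759737454217952963877197023120079847448440310671140482813490744494637208937478100126423588958227207652885425758570744619832926610787513484715914555095464358153291733006209602808561289358418227973168435548196274761112862926115487659697359692274961198680359485842290179620453520185409229258153221487921,
  25825985341442627123362855680612100296446219282707483772598860612966172323703467538471667471422494856295627140116814660327941504466180049981104829561693456316207805447091092063589488905627638213274840739453992588866868850460380262378856707959321194815005452353125821033970130525258243917903166191737334914114590404535702571253471697711033659202712395402308963856263949353936322859937065199053916100690546829575333232470515698635713594175479196115617529219534784728204180585979626305831616273155956403686011480658793327088252689625910072055970451377075763261275477,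
  26212175405553002500777994833047744678212041080260643294032792948832969992112848631391458711251519586082282194632893542868387000532507152266943013170861028024339148343461875487181526456656074202750287789822712439580707127916409755721061827855188886017841777321437071258116125280649614803614839611548940185024635435124192589219575347988768634316860657392629508687544986023838896497758729257246270849584891048972320837913754554917491329473352049397330251830534667479990379033827156530678150347821137805274582892331594571008405408306528909792541855483122849644330678,
  26083123608278492473470472444987845802446659202171861538956629433918186207726186821441721177807348946255864118321216078704401443133656643255144330984526602661961221612354547512284998639618114889819843697589540143324482252604559818987538340600788484150900710791061071760270428122083208946211881219940391397011594840286661948224508140408119287414461364882660013050228307328022601993984652324914707195975651540704581349887457095349353214718306480444525584268639345681214953271079989609950043783120496488222709827034068916187818341830699876993856559959608747794693811,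
  79417529448623835644770392843210982026557058591438338291661131383579907670161952018054292488012743297663216815922697151594659340525150789219780773285240557929024809702569704755620829739050160015704216503390988801682291391542624230257620410139737154229777101759634797441761310375681058513459238601674204551952358060433293038786362714695480811775261638323,
  26263659368051568021452606957124663388292020383153836119395659848028976710469400219027610510666954524666519556638264713382446977687581166388788618476601833915038445141661100851620433518696493116161253343346460015293630371122934173742989144936315930023925043533260502772765416797974186615487748437887052164203594254118126241028753075118031636951210551635797195024387474992756397808814892898604093602549332282523465632759710368579664939395669777803015795531166866958596082795139801621274734299795311248220841812858452673808435283020011501411075362170685914446651059,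
  493110779652247820535860569010022022902306394325121790717871284301719901517726657390391361209807429866324617859761608153401114421818305991155956549880257590610412568108129876757989927468869310944891405914291412601959522034991478578735193340810843409194160465362035818779842551635540394356054976613483574693708333223822049110824064459344775597404108925546202619803806104302907182490491777122129856847559025802614,
  79789518394404076846675465234746885023481516876848798770215853160282962172634156882238063923109735339764837073210334624804282318463656703439226776205999747802901875001391112647328338664589428242867965355257111539725252336524356220218785219394167085785392091241174797438125637976051644596691507383970013827610084448827294800819743670408265348433557711203,
  498881689425739127572322532846469646093530591215585104712833246279133023170384976413851514115464792286076059393371165183379610642513273128247947706155653778103063675351723910644407563983453155293517445325796467552173259912838029279144993131449522275843007954058646932689191928699168685643555499722813044698660874748463318915440863346950796258149814298157263434347807857194574431280566940858715687930090431829347,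
  501829925840814029860998417360273768003085299123785309944626092207619888548429775655513595658126702169674324391296563178243416213070502773178568917938977368284632472689347962121322959986795488961287873628511090199799163465281078360235461263301191227964813296420621855535397731123454854545891338634517871179587481749228163604676851943002867669192504573385729429747146904026979264045699580013609327352281446345379,
  181777834075844305740229676163627320670486235329209089513632671059078617460076403765280366571861682198008561,
  80024420142477535910022175550409343712085733402503863624329923515062039860162197766722127637941955551410831186312111131234285018817894046928887813621396689283321897597865012431577163980236207534210996237585419296148895182389115140001324466445610630808426197309302876917548794727713609047839415677205680714824008784332193490219731625477756086692503745699,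
  7675345435041095808619678353135913490582877487955492845101079809,
  415456407261349727078538339113835315834423061064831794755590440893649885488485816472648626370326284720143911867939031149429945564402276567870216396884841380271458553127520973468098498725234285559574510339731896229169,
  426924161758244461316547706711675604841296948704741733032904835426591237757025339866256215097222212409688232544810278016428148539754966123010891197737776800200324046864541607591338348859174178238589900433525062620835,
  8151702159821440031520500600652111229806643237081984742531716769,
  5774665917030436619881670913,
  10544709471698710511311478549578419480868780785367600335431985464029485916644662108191350540684880177,
  422215682298350633636990387955816551352931824583295264772752189085964948897756962052409737905196599376325117559395690583997171871617568429702607895838962061575356229667263702747484460748560207525886709219977589287233,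
  426945202303124364547266638295278757982811839730203404818364828331853389847723981712819868746788935467771817179048933804788206996883809828900208240764919557775943839778948749353111976309329284352347787073487146449315,
  10836013065540265974437227709331908956548338606357043004011497942675481802566873933781991216886249890,
  6133036885961958048620706209,
  1222913,
  5968471838743911762152827185,
  8062014918977956977413610563182432610830496749634803594721143105,
  181222377300752692568933141382008139763470977687224696898799971793183722499262445236438037388715144149903729,
  14386308102961608155729788274077006222710224467790783096122124366256596602869291291592173112309438086620720829978040673414668738339449521,
  14400504173487810108783017925723828238146661824259300724264784138239746096729008963911612474005506872169208103332347063512655204971623601,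
  181804711030238842238963522017970338710744473483499685865079227926605476538504212723158283152672255091325361,
  8152706496847391140526388489694170846130876776630246449718974897,
  6133490233689249390120905137,
  1298865]

/-! ### Soundness of the elimination procedure -/

theorem frc_eq {α : Type} (k : ℕ) (c : ℕ → α) : frc k c = c k := by
  cases k <;> rfl

theorem Tr.get_E (n k : ℕ) : Tr.get n Tr.E k = 0 := by
  cases n <;> rfl

theorem Tr.get_N (n k : ℕ) (l r : Tr) : Tr.get (n + 1) (Tr.N l r) k =
    if k % 2 = 0 then Tr.get n l (k / 2) else Tr.get n r (k / 2) := by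
  have e : Tr.get (n + 1) (Tr.N l r) k = Nat.rec (motive := fun _ => ℕ) (Tr.get n l (k / 2))
        (fun _ _ => Tr.get n r (k / 2)) (k % 2) := rfl
  rw [e]
  rcases Nat.mod_two_eq_zero_or_one k with h | h <;> rw [h] <;> simp

theorem Tr.get_L_succ (n k v : ℕ) : Tr.get (n + 1) (Tr.L v) k = 0 := rfl

/-- the update without continuation -/
noncomputable def Tr.updp : ℕ → Tr → ℕ → (ℕ → ℕ) → Tr
  | 0, t, _, f => .L (f (Tr.get 0 t 0))
  | n + 1, .N l r, k, f =>
      if k % 2 = 0 then .N (Tr.updp n l (k / 2) f) r else .N l (Tr.updp n r (k / 2) f)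
  | n + 1, .E, k, f =>
      if k % 2 = 0 then .N (Tr.updp n .E (k / 2) f) .E else .N .E (Tr.updp n .E (k / 2) f)
  | n + 1, .L _, k, f =>
      if k % 2 = 0 then .N (Tr.updp n .E (k / 2) f) .E else .N .E (Tr.updp n .E (k / 2) f)

theorem Tr.upd_eq (n : ℕ) : ∀ (t : Tr) (k : ℕ) (f : ℕ → ℕ) (c : Tr → Bool),
    Tr.upd n t k f c = c (Tr.updp n t k f) := by
  induction n with
  | zero =>
    intro t k f c
    rw [Tr.updp]
    exact frc_eq _ (fun v => c (Tr.L v))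
  | succ n ih =>
    intro t k f c
    have e : Tr.upd (n + 1) t k f c = Nat.rec (motive := fun _ => Bool)
        (Tr.rec (motive := fun _ => Bool)
          (Tr.upd n Tr.E (k / 2) f (fun l => c (Tr.N l Tr.E)))
          (fun _ => Tr.upd n Tr.E (k / 2) f (fun l => c (Tr.N l Tr.E)))
          (fun l r _ _ => Tr.upd n l (k / 2) f (fun l' => c (Tr.N l' r))) t)
        (fun _ _ => Tr.rec (motive := fun _ => Bool)
          (Tr.upd n Tr.E (k / 2) f (fun r => c (Tr.N Tr.E r)))
          (fun _ => Tr.upd n Tr.E (k / 2) f (fun r => c (Tr.N Tr.E r)))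
          (fun l r _ _ => Tr.upd n r (k / 2) f (fun r' => c (Tr.N l r'))) t)
        (k % 2) := rfl
    rw [e]
    rcases Nat.mod_two_eq_zero_or_one k with h | h <;> rw [h] <;> cases t <;>
      simp [Tr.updp, h, ih]

theorem Tr.get_updp (n : ℕ) : ∀ (t : Tr) (k j : ℕ) (f : ℕ → ℕ), k < 2 ^ n → j < 2 ^ n →
    Tr.get n (Tr.updp n t k f) j = if j = k then f (Tr.get n t k) else Tr.get n t j := by
  induction n with
  | zero =>
    intro t k j f hk hj
    have hk : k = 0 := by simpa using hk
    have hj : j = 0 := by simpa using hj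
    subst hk; subst hj
    rfl
  | succ n ih =>
    intro t k j f hk hj
    have hk2 : k / 2 < 2 ^ n := by rw [pow_succ] at hk; omega
    have hj2 : j / 2 < 2 ^ n := by rw [pow_succ] at hj; omega
    have key : j = k ↔ (j % 2 = k % 2 ∧ j / 2 = k / 2) := by omega
    rcases Nat.mod_two_eq_zero_or_one k with h | h <;>
    rcases Nat.mod_two_eq_zero_or_one j with h' | h' <;> cases t <;>
      simp [Tr.updp, h, h', Tr.get_N, ih, hk2, hj2, key, Tr.get_E, Tr.get_L_succ]

theorem lg_spec (w n : ℕ) : ∀ b, 2 ^ b ≤ w → w < 2 ^ (b + 2 ^ n) →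
    2 ^ (lg w n b) ≤ w ∧ w < 2 ^ (lg w n b + 1) := by
  induction n with
  | zero => intro b h1 h2; exact ⟨h1, h2⟩
  | succ n ih =>
    intro b h1 h2
    have e : lg w (n + 1) b = frc (b + 2 ^ n) (fun b' =>
      bif Nat.beq (Nat.shiftRight w b') 0 then lg w n b else lg w n b') := rfl
    rw [e, frc_eq]
    have e2 : Nat.shiftRight w (b + 2 ^ n) = w / 2 ^ (b + 2 ^ n) := Nat.shiftRight_eq_div_pow _ _
    rw [e2]
    by_cases hw : w < 2 ^ (b + 2 ^ n)
    · rw [Nat.div_eq_of_lt hw]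
      exact ih b h1 hw
    · have h3 : w / 2 ^ (b + 2 ^ n) ≠ 0 := by
        have := Nat.div_pos (not_lt.mp hw) (by positivity)
        omega
      have h4 : Nat.beq (w / 2 ^ (b + 2 ^ n)) 0 = false := by
        rw [← Bool.not_eq_true, Nat.beq_eq]; exact h3
      rw [h4]
      apply ih _ (not_lt.mp hw)
      rw [pow_succ] at h2
      rwa [add_assoc, ← mul_two]

/-- The state of the elimination: `r` vectors with property `P` and with distinct leading bits. -/
def GoodT (P : ℕ → Prop) (r : ℕ) (t : Tr) : Prop :=
  ∃ J : Finset ℕ, J.card = r ∧ ∀ k, k < 2 ^ 16 →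
    ((Tr.get 16 t k ≠ 0 ↔ k ∈ J) ∧ (k ∈ J → 64 ≤ k ∧ 2 ^ k ≤ Tr.get 16 t k ∧
      Tr.get 16 t k < 2 ^ (k + 1) ∧ P (Tr.get 16 t k))) ∧ (∀ k ∈ J, k < 2 ^ 16)

theorem GoodT_E (P : ℕ → Prop) : GoodT P 0 Tr.E :=
  ⟨∅, rfl, fun k _ => ⟨by simp [Tr.get_E], by simp⟩⟩

theorem red_sound (P : ℕ → Prop) (hx : ∀ a b, P a → P b → P (a ^^^ b))
    (hb : ∀ a, P a → a < 2 ^ 2 ^ 16) (r : ℕ) (t : Tr) (ht : GoodT P r t) (c0 : Bool)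
    (c1 : Tr → Bool) (f : ℕ) : ∀ v, P v → red f v t c0 c1 = true →
      c0 = true ∨ ∃ t', GoodT P (r + 1) t' ∧ c1 t' = true := by
  induction f with
  | zero => intro v _ h; exact absurd h (by simp [red])
  | succ f ih =>
    intro v hv h
    cases v with
    | zero => left; exact h
    | succ w =>
      have e : red (f + 1) (w + 1) t c0 c1 = frc (lg (w + 1) 16 0) (fun k =>
          Nat.rec (motive := fun _ => Bool)
            (bif Nat.ble 64 k then Tr.upd 16 t k (fun _ => w + 1) c1 else false)
            (fun b _ => red f ((w + 1) ^^^ (b + 1)) t c0 c1) (t.get 16 k)) := rfl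
      rw [e, frc_eq] at h
      obtain ⟨hl1, hl2⟩ := lg_spec (w + 1) 16 0 (by simp) (by rw [zero_add]; exact hb _ hv)
      generalize hk : lg (w + 1) 16 0 = k at *
      have hk16 : k < 2 ^ 16 := by
        have := lt_of_le_of_lt hl1 (hb _ hv)
        exact (Nat.pow_lt_pow_iff_right (by norm_num)).1 this
      obtain ⟨J, hJ, hJ2⟩ := ht
      generalize hg : t.get 16 k = g at *
      cases g with
      | succ b =>
        have hkJ : k ∈ J := ((hJ2 k hk16).1.1).1 (by rw [hg]; omega)
        have hP := ((hJ2 k hk16).1.2 hkJ).2.2.2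
        rw [hg] at hP
        exact ih _ (hx _ _ hv hP) h
      | zero =>
        have hkJ : k ∉ J := fun hh => ((hJ2 k hk16).1.1).2 hh hg
        right
        simp only [cond_eq_ite] at h
        split_ifs at h with h64
        have h64' : 64 ≤ k := Nat.le_of_ble_eq_true h64
        rw [Tr.upd_eq] at h
        refine ⟨_, ⟨insert k J, by rw [Finset.card_insert_of_notMem hkJ, hJ], ?_⟩, h⟩
        intro j hj
        rw [Tr.get_updp 16 t k j _ hk16 hj]
        refine ⟨?_, ?_⟩
        · by_cases hjk : j = k
          · subst hjk
            simp only [if_true, Finset.mem_insert_self, forall_true_left]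
            exact ⟨by simp, h64', hl1, hl2, hv⟩
          · have := (hJ2 j hj).1
            simpa [hjk] using this
        · intro i hi
          rcases Finset.mem_insert.1 hi with rfl | hi
          · exact hk16
          · exact (hJ2 j hj).2 i hi

theorem loopm_sound (P : ℕ → Prop) (hx : ∀ a b, P a → P b → P (a ^^^ b))
    (hb : ∀ a, P a → a < 2 ^ 2 ^ 16) (R want tab k k' A : ℕ)
    (hgen : ∀ m, m < k → P (gen want tab k k' A m 12)) (c : ℕ → Tr → Bool)
    (hc : ∀ need t, need ≤ R → GoodT P (R - need) t → c need t = true → ∃ t', GoodT P R t')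
    (j : ℕ) : j ≤ k → ∀ need t, need ≤ R → GoodT P (R - need) t →
      loopm want tab k k' A j need t c = true → ∃ t', GoodT P R t' := by
  induction j with
  | zero => intro _ need t hn ht h; exact hc need t hn ht h
  | succ j ih =>
    intro hj need t hn ht h
    cases need with
    | zero => exact ⟨t, by simpa using ht⟩
    | succ n =>
      have e : loopm want tab k k' A (j + 1) (n + 1) t c =
        red 200 (gen want tab k k' A (k - (j + 1)) 12) t
          (loopm want tab k k' A j (n + 1) t c)
          (fun t' => loopm want tab k k' A j n t' c) := rfl
      rw [e] at h
      rcases red_sound P hx hb _ t ht _ _ _ _ (hgen _ (by omega)) h with h | ⟨t', ht', h⟩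
      · exact ih (by omega) _ _ hn ht h
      · refine ih (by omega) n t' (by omega) ?_ h
        have : R - (n + 1) + 1 = R - n := by omega
        rwa [this] at ht'

theorem loopA_sound (P : ℕ → Prop) (hx : ∀ a b, P a → P b → P (a ^^^ b))
    (hb : ∀ a, P a → a < 2 ^ 2 ^ 16) (R want tab k k' p : ℕ)
    (hgen : ∀ A m, A < 4096 → popc 12 A = p → m < k → P (gen want tab k k' A m 12))
    (N : ℕ) : ∀ need t, need ≤ R → GoodT P (R - need) t →
      loopA want tab k k' p N need t = true → ∃ t', GoodT P R t' := by
  induction N with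
  | zero =>
    intro need t hn ht h
    have : need = 0 := Nat.eq_of_beq_eq_true h
    subst this
    exact ⟨t, by simpa using ht⟩
  | succ j ih =>
    intro need t hn ht h
    have e : loopA want tab k k' p (j + 1) need t =
      bif Nat.beq (popc 12 (4095 - j)) p then
        loopm want tab k k' (4095 - j) k need t (loopA want tab k k' p j)
      else loopA want tab k k' p j need t := rfl
    rw [e, cond_eq_ite] at h
    split_ifs at h with h1
    · exact loopm_sound P hx hb R want tab k k' _
        (fun m hm => hgen _ m (by omega) (Nat.eq_of_beq_eq_true h1) hm) _ ih k le_rfl need t hn ht h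
    · exact ih need t hn ht h

/-! ### Vectors modulo two -/

/-- The coefficient at position `i` of the integral vector attached to `(A, m)`. -/
noncomputable def cf (want tab k k' A m i N : ℕ) : ℤ :=
  ∑ a ∈ Finset.range N, if ((A >>> a) % 2 = want ∧ tb tab k a m ≠ 15) ∧
    tp k' A a (tb tab k a m) = i then (-1) ^ popc 12 (A % 2 ^ a) else 0

theorem unitv_testBit (i j : ℕ) : (unitv i).testBit (64 + j) = decide (i = j) := by
  have e : unitv i = (1 <<< (64 + i)) ^^^
    (((i + 1) * 11400714819323198485) % 18446744073709551616) := rfl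
  rw [e, Nat.testBit_xor]
  have h : ((i + 1) * 11400714819323198485 % 18446744073709551616).testBit (64 + j) = false := by
    apply Nat.testBit_lt_two_pow
    have h1 : (i + 1) * 11400714819323198485 % 18446744073709551616 < 2 ^ 64 :=
      Nat.mod_lt _ (by norm_num)
    exact lt_of_lt_of_le h1 (Nat.pow_le_pow_right (by norm_num) (by omega))
  rw [h, Bool.xor_false, Nat.one_shiftLeft, Nat.testBit_two_pow]
  simp

theorem unitv_lt (i : ℕ) (hi : i < 65000) : unitv i < 2 ^ 2 ^ 16 := by
  have e : unitv i = (1 <<< (64 + i)) ^^^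
    (((i + 1) * 11400714819323198485) % 18446744073709551616) := rfl
  rw [e]
  apply Nat.xor_lt_two_pow
  · rw [Nat.one_shiftLeft]
    exact Nat.pow_lt_pow_right (by norm_num) (by norm_num; omega)
  · have h1 : (i + 1) * 11400714819323198485 % 18446744073709551616 < 2 ^ 64 :=
      Nat.mod_lt _ (by norm_num)
    exact lt_of_lt_of_le h1 (Nat.pow_le_pow_right (by norm_num) (by norm_num))

theorem tb_lt (tab k a m : ℕ) : tb tab k a m < 16 := Nat.mod_lt _ (by norm_num)

theorem tp_lt (k' A a n : ℕ) (hA : A < 4096) (ha : a < 12) (hn : n < 16) (hk : k' ≤ 10) :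
    tp k' A a n < 65000 := by
  have e : tp k' A a n = (A ^^^ (1 <<< a)) * k' + n := rfl
  have h1 : A ^^^ (1 <<< a) < 2 ^ 12 := by
    apply Nat.xor_lt_two_pow hA
    rw [Nat.one_shiftLeft]
    exact Nat.pow_lt_pow_right (by norm_num) ha
  rw [e]
  nlinarith

theorem gen_succ (want tab k k' A m a : ℕ) : gen want tab k k' A m (a + 1) =
    if ((A >>> a) % 2 = want ∧ tb tab k a m ≠ 15) then
      gen want tab k k' A m a ^^^ unitv (tp k' A a (tb tab k a m))
    else gen want tab k k' A m a := by
  have e : gen want tab k k' A m (a + 1) =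
      bif Nat.beq ((A >>> a) % 2) want then
        frc (tb tab k a m) (fun n => bif Nat.beq n 15 then gen want tab k k' A m a else
           frc (tp k' A a n) (fun i => gen want tab k k' A m a ^^^ (unitv i)))
      else gen want tab k k' A m a := rfl
  rw [e, frc_eq, frc_eq]
  by_cases h1 : (A >>> a) % 2 = want <;> by_cases h2 : tb tab k a m = 15 <;>
    simp [h1, h2, cond_eq_ite]

theorem gen_lt (want tab k k' A m : ℕ) (hA : A < 4096) (hk : k' ≤ 10) (a : ℕ) : a ≤ 12 →
    gen want tab k k' A m a < 2 ^ 2 ^ 16 := by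
  induction a with
  | zero => intro _; exact Nat.pow_pos (by norm_num)
  | succ a ih =>
    intro ha
    rw [gen_succ]
    split_ifs
    · exact Nat.xor_lt_two_pow (ih (by omega))
        (unitv_lt _ (tp_lt _ _ _ _ hA (by omega) (tb_lt _ _ _ _) hk))
    · exact ih (by omega)

/-- the residue modulo 2 of a bit -/
def bz (b : Bool) : ZMod 2 := if b then 1 else 0

theorem bz_xor (a b : Bool) : bz (a ^^ b) = bz a + bz b := by
  cases a <;> cases b <;> decide

theorem neg_one_pow_zmod2 (n : ℕ) : ((((-1 : ℤ) ^ n : ℤ)) : ZMod 2) = 1 := by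
  have : ((-1 : ℤ) : ZMod 2) = 1 := by decide
  rw [Int.cast_pow, this, one_pow]

theorem gen_bit (want tab k k' A m i : ℕ) (N : ℕ) :
    ((cf want tab k k' A m i N : ℤ) : ZMod 2) = bz ((gen want tab k k' A m N).testBit (64 + i)) := by
  induction N with
  | zero => simp [cf, gen, bz]
  | succ a ih =>
    rw [gen_succ]
    have e : cf want tab k k' A m i (a + 1) = cf want tab k k' A m i a +
      if ((A >>> a) % 2 = want ∧ tb tab k a m ≠ 15) ∧
        tp k' A a (tb tab k a m) = i then (-1) ^ popc 12 (A % 2 ^ a) else 0 :=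
      Finset.sum_range_succ _ _
    rw [e]
    by_cases h : ((A >>> a) % 2 = want ∧ tb tab k a m ≠ 15)
    · rw [if_pos h, Nat.testBit_xor, bz_xor, ← ih, unitv_testBit, Int.cast_add]
      congr 1
      by_cases h2 : tp k' A a (tb tab k a m) = i
      · rw [if_pos ⟨h, h2⟩, neg_one_pow_zmod2]; simp [h2, bz]
      · rw [if_neg (fun hh => h2 hh.2)]; simp [h2, bz]
    · rw [if_neg h, if_neg (fun hh => h hh.1), add_zero, ih]

/-- `v` is the packed reduction of an element of `Λ`. -/
def RepP (Λ : AddSubgroup (ℕ → ℤ)) (v : ℕ) : Prop :=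
  v < 2 ^ 2 ^ 16 ∧ ∃ u ∈ Λ, ∀ i, ((u i : ℤ) : ZMod 2) = bz (v.testBit (64 + i))

theorem RepP_xor (Λ : AddSubgroup (ℕ → ℤ)) (a b : ℕ) (ha : RepP Λ a) (hb : RepP Λ b) :
    RepP Λ (a ^^^ b) := by
  obtain ⟨ha, u, hu, hu'⟩ := ha
  obtain ⟨hb, w, hw, hw'⟩ := hb
  refine ⟨Nat.xor_lt_two_pow ha hb, u + w, Λ.add_mem hu hw, fun i => ?_⟩
  rw [Nat.testBit_xor, bz_xor, ← hu', ← hw', Pi.add_apply, Int.cast_add]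

theorem GoodT_indep (Λ : AddSubgroup (ℕ → ℤ)) (R : ℕ) (t : Tr) (h : GoodT (RepP Λ) R t) :
    ∃ (J : Finset ℕ) (u : J → ℕ → ℤ), J.card = R ∧ (∀ j, u j ∈ Λ) ∧
      LinearIndependent ℂ (fun (j : J) (i : ℕ) => ((u j i : ℤ) : ℂ)) := by
  obtain ⟨J, hJ, hJ2⟩ := h
  have hlt : ∀ j : J, (j : ℕ) < 2 ^ 16 := fun j => (hJ2 0 (by norm_num)).2 j j.2
  have hj := fun j : J => (hJ2 j (hlt j)).1.2 j.2
  choose h64 hlo hhi hP using hj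
  choose u hu hu' using fun j => (hP j).2
  refine ⟨J, u, hJ, hu, ?_⟩
  let M : Matrix J J ℤ := fun j i => u j (i - 64)
  have hM : ∀ j i : J, ((M j i : ℤ) : ZMod 2) = bz ((Tr.get 16 t j).testBit i) := by
    intro j i
    have := hu' j (i - 64)
    rwa [Nat.add_sub_cancel' (h64 i)] at this
  have hdet2 : ((M.det : ℤ) : ZMod 2) = 1 := by
    have e := (Int.castRingHom (ZMod 2)).map_det M
    rw [eq_intCast] at e
    rw [e, Matrix.det_of_lowerTriangular]
    · apply Finset.prod_eq_one
      intro j _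
      have hb : (Tr.get 16 t j).testBit j = true := by
        by_contra hc
        rw [Bool.not_eq_true] at hc
        have : Tr.get 16 t j < 2 ^ (j : ℕ) := by
          apply Nat.lt_pow_two_of_testBit
          intro i hi
          rcases eq_or_lt_of_le hi with rfl | hi
          · exact hc
          · exact Nat.testBit_lt_two_pow
              (lt_of_lt_of_le (hhi j) (Nat.pow_le_pow_right (by norm_num) hi))
        exact absurd (hlo j) (not_le.2 this)
      have := hM j j
      rw [hb] at this
      simpa [bz] using this
    · intro j i hij
      have hij' : (j : ℕ) < i := hij
      have := hM j i
      rw [Nat.testBit_lt_two_pow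
              (lt_of_lt_of_le (hhi j) (Nat.pow_le_pow_right (by norm_num) hij'))] at this
      simpa [bz] using this
  have hdet : M.det ≠ 0 := by
    intro h0
    rw [h0] at hdet2
    exact absurd hdet2 (by decide)
  have hdetC : (M.map (Int.cast : ℤ → ℂ)).det ≠ 0 := by
    have e := (Int.castRingHom ℂ).map_det M
    rw [eq_intCast] at e
    have e' : ((M.det : ℤ) : ℂ) = (M.map (Int.cast : ℤ → ℂ)).det := e
    rw [← e']
    exact_mod_cast hdet
  have hrow : LinearIndependent ℂ (M.map (Int.cast : ℤ → ℂ)).row :=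
    Matrix.linearIndependent_rows_of_det_ne_zero hdetC
  exact LinearIndependent.of_comp (LinearMap.funLeft ℂ ℂ (fun i : J => (i : ℕ) - 64)) hrow

/-! ### Soundness of the check of integral relations -/

theorem bal_sound (n : ℕ) : ∀ t, bal n t = true → ∀ i, i < 2 ^ n →
    Tr.get (n + 1) t i = Tr.get (n + 1) t (i + 2 ^ n) := by
  induction n with
  | zero =>
    intro t h i hi
    have hi : i = 0 := by simpa using hi
    subst hi
    exact Nat.eq_of_beq_eq_true h
  | succ n ih =>
    intro t h i hi
    cases t with
    | E => simp [Tr.get_E]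
    | L v => rfl
    | N l r =>
      have e : bal (n + 1) (Tr.N l r) = bif bal n l then bal n r else false := rfl
      rw [e] at h
      have h1 : bal n l = true := by
        by_contra hc
        rw [Bool.not_eq_true] at hc
        rw [hc] at h
        exact absurd h (by simp)
      rw [h1] at h
      rw [Tr.get_N, Tr.get_N]
      have e1 : (i + 2 ^ (n + 1)) % 2 = i % 2 := by rw [pow_succ]; omega
      have e2 : (i + 2 ^ (n + 1)) / 2 = i / 2 + 2 ^ n := by rw [pow_succ]; omega
      have e3 : i / 2 < 2 ^ n := by rw [pow_succ] at hi; omega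
      rw [e1, e2, ih l h1 _ e3, ih r h _ e3]

/-- difference of the positive and the negative part -/
noncomputable def dif (t : Tr) (i : ℕ) : ℤ := (Tr.get 17 t i : ℤ) - Tr.get 17 t (i + 65536)

theorem cf_succ (want tab k k' A m i a : ℕ) : cf want tab k k' A m i (a + 1) =
    cf want tab k k' A m i a +
      if ((A >>> a) % 2 = want ∧ tb tab k a m ≠ 15) ∧
        tp k' A a (tb tab k a m) = i then (-1) ^ popc 12 (A % 2 ^ a) else 0 :=
  Finset.sum_range_succ _ _

theorem dif_upd (t : Tr) (q s mag i : ℕ) (hq : q < 65536) (hi : i < 65536) :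
    dif (Tr.updp 17 t (q + 65536 * (s % 2)) (fun v => v + mag)) i =
      dif t i + if q = i then (-1) ^ s * (mag : ℤ) else 0 := by
  unfold dif
  have hp : (2 : ℕ) ^ 17 = 131072 := by norm_num
  rw [Tr.get_updp 17 t _ _ _ (by rw [hp]; omega) (by rw [hp]; omega),
    Tr.get_updp 17 t _ _ _ (by rw [hp]; omega) (by rw [hp]; omega)]
  rcases Nat.even_or_odd s with hs | hs
  · have hs2 : s % 2 = 0 := Nat.even_iff.1 hs
    rw [hs.neg_one_pow, hs2]
    by_cases hqi : q = i
    · subst hqi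
      simp
      ring
    · have h1 : ¬ (i = q + 65536 * 0) := by omega
      have h2 : ¬ (i + 65536 = q + 65536 * 0) := by omega
      rw [if_neg h1, if_neg h2, if_neg hqi, add_zero]
  · have hs2 : s % 2 = 1 := Nat.odd_iff.1 hs
    rw [hs.neg_one_pow, hs2]
    by_cases hqi : q = i
    · subst hqi
      have h1 : ¬ (q = q + 65536 * 1) := by omega
      simp [h1]
      ring
    · have h1 : ¬ (i = q + 65536 * 1) := by omega
      have h2 : ¬ (i + 65536 = q + 65536 * 1) := by omega
      rw [if_neg h1, if_neg h2, if_neg hqi, add_zero]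

theorem addT_sound (want tab k k' A m sg mag : ℕ) (hA : A < 4096) (hk : k' ≤ 10)
    (c : Tr → Bool) (a : ℕ) : a ≤ 12 → ∀ t, addT want tab k k' A m sg mag a t c = true →
      ∃ t', c t' = true ∧ ∀ i, i < 65536 →
        dif t' i = dif t i + (-1) ^ sg * (mag : ℤ) * cf want tab k k' A m i a := by
  induction a with
  | zero =>
    intro _ t h
    exact ⟨t, h, fun i _ => by simp [cf]⟩
  | succ a ih =>
    intro ha t h
    have e : addT want tab k k' A m sg mag (a + 1) t c =
      bif Nat.beq ((A >>> a) % 2) want then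
        frc (tb tab k a m) (fun n => bif Nat.beq n 15 then addT want tab k k' A m sg mag a t c else
           frc (tp k' A a n + 65536 * ((sg + popc 12 (A % 2 ^ a)) % 2))
            (fun i => Tr.upd 17 t i (fun v => v + mag)
              (fun t' => addT want tab k k' A m sg mag a t' c)))
      else addT want tab k k' A m sg mag a t c := rfl
    rw [e, frc_eq, frc_eq, Tr.upd_eq] at h
    by_cases h1 : ((A >>> a) % 2 = want ∧ tb tab k a m ≠ 15)
    · have h1' : Nat.beq ((A >>> a) % 2) want = true := by rw [Nat.beq_eq]; exact h1.1
      have h2' : Nat.beq (tb tab k a m) 15 = false := by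
        rw [← Bool.not_eq_true, Nat.beq_eq]; exact h1.2
      rw [h1', h2'] at h
      obtain ⟨t', ht', hd⟩ := ih (by omega) _ h
      refine ⟨t', ht', fun i hi => ?_⟩
      have hq := tp_lt k' A a (tb tab k a m) hA (by omega) (tb_lt _ _ _ _) hk
      rw [hd i hi, dif_upd _ _ _ _ _ (by omega) hi, cf_succ]
      by_cases h3 : tp k' A a (tb tab k a m) = i
      · rw [if_pos h3, if_pos ⟨h1, h3⟩, pow_add]; ring
      · rw [if_neg h3, if_neg (fun hh => h3 hh.2)]; ring
    · have h' : addT want tab k k' A m sg mag a t c = true := by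
        by_cases h2 : (A >>> a) % 2 = want
        · have h3 : tb tab k a m = 15 := by
            by_contra h3; exact h1 ⟨h2, h3⟩
          simpa [h2, h3] using h
        · simpa [h2, cond_eq_ite] using h
      obtain ⟨t', ht', hd⟩ := ih (by omega) _ h'
      refine ⟨t', ht', fun i hi => ?_⟩
      rw [hd i hi, cf_succ, if_neg (fun hh => h1 hh.1), add_zero]

/-- codes of the basis elements `(A, m)` with `|A| = p` -/
noncomputable def Xs (k p : ℕ) : Finset ℕ :=
  (Finset.range (4096 * k)).filter (fun j => popc 12 (j / k) = p)

/-- invariant of `proc` -/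
def InvP (want tab k k' p : ℕ) (t : Tr) (x : ℕ) (u : ℕ → ℤ) : Prop :=
  (∀ j, j ∉ Xs k p → u j = 0) ∧
  (∀ i, i < 65536 → dif t i = ∑ j ∈ Xs k p, u j * cf want tab k k' (j / k) (j % k) i 12) ∧
  x < 2 ^ 2 ^ 16 ∧ ∀ j, ((u j : ℤ) : ZMod 2) = bz (x.testBit (64 + j))

theorem proc_sound (want tab k k' p : ℕ) (hk : 0 < k) (hk10 : k ≤ 10) (hk' : k' ≤ 10)
    (c : Tr → ℕ → Bool) (f : ℕ) :
    ∀ w t x u, InvP want tab k k' p t x u → proc want tab k k' p f w t x c = true →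
      ∃ t' x' u', InvP want tab k k' p t' x' u' ∧ c t' x' = true := by
  induction f with
  | zero => intro w t x u _ h; exact absurd h (by simp [proc])
  | succ f ih =>
    intro w t x u hI h
    cases w with
    | zero => exact ⟨t, x, u, hI, h⟩
    | succ w =>
      have e : proc want tab k k' p (f + 1) (w + 1) t x c =
        frc ((w + 1) / 32 % 524288) (fun i =>
        frc (i / k) (fun A =>
        frc ((w + 1) / 16 % 2) (fun sg =>
        frc ((w + 1) % 16) (fun mag =>
        bif Nat.beq (popc 12 A) p then bif Nat.ble A 4095 then
          addT want tab k k' A (i % k) sg mag 12 t (fun t' =>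
            frc (bif Nat.beq (mag % 2) 0 then x else x ^^^ (unitv i)) (fun x' =>
              proc want tab k k' p f ((w + 1) / 16777216) t' x' c))
          else false else false)))) := rfl
      rw [e] at h
      simp only [frc_eq] at h
      generalize (w + 1) / 32 % 524288 = i at h
      generalize (w + 1) / 16 % 2 = sg at h
      generalize (w + 1) % 16 = mag at h
      rw [cond_eq_ite, cond_eq_ite] at h
      split_ifs at h with h1 h2
      have h1 : popc 12 (i / k) = p := Nat.eq_of_beq_eq_true h1
      have h2 : i / k < 4096 := Nat.lt_succ_of_le (Nat.le_of_ble_eq_true h2)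
      have hi1 : i < 4096 * k := (Nat.div_lt_iff_lt_mul hk).1 h2
      have hiX : i ∈ Xs k p := Finset.mem_filter.2 ⟨Finset.mem_range.2 hi1, h1⟩
      obtain ⟨t', h, hd⟩ := addT_sound want tab k k' (i / k) (i % k) sg mag h2 hk' _ 12 le_rfl t h
      refine ih _ _ _ (u + Pi.single i ((-1) ^ sg * (mag : ℤ))) ?_ h
      obtain ⟨hs, hdif, hx, hb⟩ := hI
      refine ⟨?_, ?_, ?_, ?_⟩
      · intro j hj
        have : j ≠ i := fun hh => hj (hh ▸ hiX)
        simp [hs j hj, this]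
      · intro l hl
        rw [hd l hl, hdif l hl]
        simp only [Pi.add_apply, add_mul, Finset.sum_add_distrib]
        congr 1
        rw [Finset.sum_eq_single i]
        · simp
        · intro j _ hji; simp [hji]
        · intro hh; exact absurd hiX hh
      · rw [cond_eq_ite]
        split_ifs
        · exact hx
        · exact Nat.xor_lt_two_pow hx (unitv_lt _
            (lt_of_lt_of_le hi1 (le_trans (Nat.mul_le_mul_left 4096 hk10) (by norm_num))))
      · intro j
        rw [Pi.add_apply, Int.cast_add, hb j, cond_eq_ite]
        have hm : ((((-1 : ℤ) ^ sg * (mag : ℤ) : ℤ)) : ZMod 2) = (mag : ZMod 2) := by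
          rw [Int.cast_mul, neg_one_pow_zmod2, one_mul, Int.cast_natCast]
        split_ifs with h3
        · have h3 : mag % 2 = 0 := Nat.eq_of_beq_eq_true h3
          have h4 : (mag : ZMod 2) = 0 := by
            rw [ZMod.natCast_eq_zero_iff]; exact Nat.dvd_of_mod_eq_zero h3
          by_cases hji : j = i
          · subst hji; rw [Pi.single_eq_same, hm, h4, add_zero]
          · simp [hji]
        · have h3 : mag % 2 = 1 := by
            rw [Nat.beq_eq] at h3; omega
          have h4 : (mag : ZMod 2) = 1 := by
            rw [← Nat.cast_one, ZMod.natCast_eq_natCast_iff]; exact h3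
          rw [Nat.testBit_xor, bz_xor, unitv_testBit]
          by_cases hji : j = i
          · subst hji; rw [Pi.single_eq_same, hm, h4]; simp [bz]
          · have hij : i ≠ j := fun hh => hji hh.symm
            simp [hji, hij, bz]

theorem loopV_sound (want tab k k' p : ℕ) (hk : 0 < k) (hk10 : k ≤ 10) (hk' : k' ≤ 10)
    (Λ : AddSubgroup (ℕ → ℤ))
    (hΛ : ∀ u : ℕ → ℤ, (∀ j, j ∉ Xs k p → u j = 0) → (∀ i, i < 65536 →
      ∑ j ∈ Xs k p, u j * cf want tab k k' (j / k) (j % k) i 12 = 0) → u ∈ Λ)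
    (R : ℕ) (L : List ℕ) : ∀ need t, need ≤ R → GoodT (RepP Λ) (R - need) t →
      loopV want tab k k' p L need t = true → ∃ t', GoodT (RepP Λ) R t' := by
  induction L with
  | nil =>
    intro need t hn ht h
    have : need = 0 := Nat.eq_of_beq_eq_true h
    subst this
    exact ⟨t, by simpa using ht⟩
  | cons w L ih =>
    intro need t hn ht h
    cases need with
    | zero => exact ⟨t, by simpa using ht⟩
    | succ n =>
      have e : loopV want tab k k' p (w :: L) (n + 1) t =
        proc want tab k k' p 200 w Tr.E 0 (fun s x =>
          bif bal 16 s then red 200 x t false (fun t' => loopV want tab k k' p L n t')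
          else false) := rfl
      rw [e] at h
      have h0 : InvP want tab k k' p Tr.E 0 0 := by
        refine ⟨fun _ _ => rfl, fun i _ => by simp [dif, Tr.get_E], Nat.pow_pos (by norm_num), ?_⟩
        intro j
        simp [bz]
      obtain ⟨s, x, u, ⟨hs, hd, hx, hb⟩, h⟩ := proc_sound want tab k k' p hk hk10 hk' _ _ _ _ _ _ h0 h
      rw [cond_eq_ite] at h
      split_ifs at h with h1
      have hu : u ∈ Λ := by
        apply hΛ u hs
        intro i hi
        rw [← hd i hi]
        have := bal_sound 16 s h1 i (by norm_num; exact hi)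
        unfold dif
        have e2 : i + 65536 = i + 2 ^ 16 := by norm_num
        rw [e2, this]
        simp
      rcases red_sound (RepP Λ) (RepP_xor Λ) (fun _ h => h.1) _ t ht _ _ _ _ ⟨hx, u, hu, hb⟩ h with
        h | ⟨t', ht', h⟩
      · exact absurd h (by simp)
      · refine ih n t' (by omega) ?_ h
        have : R - (n + 1) + 1 = R - n := by omega
        rwa [this] at ht'

set_option linter.constructorNameAsVariable false

/-! ### Bit manipulations -/

theorem shr_mod_two (A a : ℕ) : (A >>> a) % 2 = (A.testBit a).toNat := by
  rw [Nat.shiftRight_eq_div_pow, Nat.testBit_eq_decide_div_mod_eq]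
  rcases Nat.mod_two_eq_zero_or_one (A / 2 ^ a) with h | h <;> simp [h]

theorem popc_eq (n : ℕ) : ∀ A, popc n A = ∑ i ∈ Finset.range n, (A.testBit i).toNat := by
  induction n with
  | zero => intro A; rfl
  | succ n ih =>
    intro A
    have e : popc (n + 1) A = popc n (A / 2) + A % 2 := rfl
    rw [e, ih, Finset.sum_range_succ']
    congr 1
    · apply Finset.sum_congr rfl
      intro i _
      rw [Nat.testBit_succ]
    · have := shr_mod_two A 0
      simpa using this

theorem testBit_flip (A a i : ℕ) : (A ^^^ (1 <<< a)).testBit i = (A.testBit i ^^ decide (a = i)) := by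
  rw [Nat.testBit_xor, Nat.one_shiftLeft, Nat.testBit_two_pow]

theorem flip_lt (A a : ℕ) (hA : A < 4096) (ha : a < 12) : A ^^^ (1 <<< a) < 4096 := by
  apply Nat.xor_lt_two_pow (n := 12) hA
  rw [Nat.one_shiftLeft]
  exact Nat.pow_lt_pow_right (by norm_num) ha

theorem xflip_flip (A a : ℕ) : (A ^^^ (1 <<< a)) ^^^ (1 <<< a) = A := by
  rw [Nat.xor_assoc, Nat.xor_self, Nat.xor_zero]

theorem flip_mod (A a : ℕ) : (A ^^^ (1 <<< a)) % 2 ^ a = A % 2 ^ a := by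
  apply Nat.eq_of_testBit_eq
  intro i
  rw [Nat.testBit_mod_two_pow, Nat.testBit_mod_two_pow, testBit_flip]
  by_cases h : i < a
  · have : a ≠ i := by omega
    simp [this]
  · simp [h]

theorem popc_flip (A a : ℕ) (ha : a < 12) (h : A.testBit a = false) :
    popc 12 (A ^^^ (1 <<< a)) = popc 12 A + 1 := by
  rw [popc_eq, popc_eq, ← Finset.add_sum_erase _ _ (Finset.mem_range.2 ha),
    ← Finset.add_sum_erase (Finset.range 12) (fun i => (A.testBit i).toNat) (Finset.mem_range.2 ha)]
  have : ∑ x ∈ (Finset.range 12).erase a, ((A ^^^ 1 <<< a).testBit x).toNat =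
      ∑ x ∈ (Finset.range 12).erase a, (A.testBit x).toNat := by
    apply Finset.sum_congr rfl
    intro i hi
    have hi' : a ≠ i := (Finset.ne_of_mem_erase hi).symm
    rw [testBit_flip]
    simp [hi']
  rw [this, testBit_flip, h]
  simp
  ring

theorem tabR_ok : ∀ a < 12, ∀ n < 6, tb tabR 6 a n ≠ 15 →
    tb tabR 6 a n < 10 ∧ tb tabC 10 a (tb tabR 6 a n) = n := by decide +kernel

theorem tabC_ok : ∀ a < 12, ∀ m < 10, tb tabC 10 a m ≠ 15 →
    tb tabC 10 a m < 6 ∧ tb tabR 6 a (tb tabC 10 a m) = m := by decide +kernel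

/-- the entries of the matrix -/
noncomputable def cfR (y j : ℕ) : ℤ := cf 0 tabR 6 10 (y / 6) (y % 6) j 12

noncomputable def cfC (j y : ℕ) : ℤ := cf 1 tabC 10 6 (j / 10) (j % 10) y 12

theorem divmod_iff (k q r j : ℕ) (hr : r < k) : q * k + r = j ↔ j / k = q ∧ j % k = r := by
  constructor
  · rintro rfl
    have hk : 0 < k := by omega
    constructor
    · rw [Nat.add_comm, Nat.add_mul_div_right _ _ hk, Nat.div_eq_of_lt hr, zero_add]
    · rw [Nat.add_comm, Nat.add_mul_mod_self_right, Nat.mod_eq_of_lt hr]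
  · rintro ⟨rfl, rfl⟩
    exact Nat.div_add_mod' j k

theorem tp_eq_iff (k' A a n j : ℕ) (hn : n < k') :
    tp k' A a n = j ↔ j / k' = A ^^^ (1 <<< a) ∧ j % k' = n :=
  divmod_iff k' _ n j hn

theorem cfC_eq_cfR (j y : ℕ) : cfC j y = cfR y j := by
  unfold cfC cfR cf
  apply Finset.sum_congr rfl
  intro a ha
  have ha : a < 12 := Finset.mem_range.1 ha
  have hj : j % 10 < 10 := Nat.mod_lt _ (by norm_num)
  have hy : y % 6 < 6 := Nat.mod_lt _ (by norm_num)
  have key : (((j / 10) >>> a % 2 = 1 ∧ tb tabC 10 a (j % 10) ≠ 15) ∧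
      tp 6 (j / 10) a (tb tabC 10 a (j % 10)) = y) ↔
     (((y / 6) >>> a % 2 = 0 ∧ tb tabR 6 a (y % 6) ≠ 15) ∧
      tp 10 (y / 6) a (tb tabR 6 a (y % 6)) = j) := by
    constructor
    · rintro ⟨⟨h1, h2⟩, h3⟩
      obtain ⟨h4, h5⟩ := tabC_ok a ha _ hj h2
      rw [tp_eq_iff _ _ _ _ _ h4] at h3
      rw [h3.1, h3.2, h5]
      refine ⟨⟨?_, by omega⟩, ?_⟩
      · rw [shr_mod_two] at h1 ⊢
        rw [testBit_flip]
        cases hh : (j / 10).testBit a <;> simp [hh] at h1 ⊢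
      · rw [tp_eq_iff _ _ _ _ _ hj, xflip_flip]; simp
    · rintro ⟨⟨h1, h2⟩, h3⟩
      obtain ⟨h4, h5⟩ := tabR_ok a ha _ hy h2
      rw [tp_eq_iff _ _ _ _ _ h4] at h3
      rw [h3.1, h3.2, h5]
      refine ⟨⟨?_, by omega⟩, ?_⟩
      · rw [shr_mod_two] at h1 ⊢
        rw [testBit_flip]
        cases hh : (y / 6).testBit a <;> simp [hh] at h1 ⊢
      · rw [tp_eq_iff _ _ _ _ _ hy, xflip_flip]; simp
  by_cases h : (((j / 10) >>> a % 2 = 1 ∧ tb tabC 10 a (j % 10) ≠ 15) ∧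
      tp 6 (j / 10) a (tb tabC 10 a (j % 10)) = y)
  · rw [if_pos h, if_pos (key.1 h)]
    obtain ⟨⟨h1, h2⟩, h3⟩ := h
    obtain ⟨h4, h5⟩ := tabC_ok a ha _ hj h2
    rw [tp_eq_iff _ _ _ _ _ h4] at h3
    rw [h3.1, flip_mod]
  · rw [if_neg h, if_neg (fun hh => h (key.2 hh))]

theorem mem_Xs (k p j : ℕ) (hk : 0 < k) : j ∈ Xs k p ↔ j / k < 4096 ∧ popc 12 (j / k) = p := by
  unfold Xs
  rw [Finset.mem_filter, Finset.mem_range, Nat.div_lt_iff_lt_mul hk]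

theorem cfR_support (p y j : ℕ) (hy : y ∈ Xs 6 p) (h : cfR y j ≠ 0) : j ∈ Xs 10 (p + 1) := by
  rw [mem_Xs _ _ _ (by norm_num)] at hy ⊢
  unfold cfR cf at h
  obtain ⟨a, ha, h⟩ := Finset.exists_ne_zero_of_sum_ne_zero h
  have ha : a < 12 := Finset.mem_range.1 ha
  split_ifs at h with hc
  · obtain ⟨⟨h1, h2⟩, h3⟩ := hc
    obtain ⟨h4, h5⟩ := tabR_ok a ha _ (Nat.mod_lt _ (by norm_num)) h2
    rw [tp_eq_iff _ _ _ _ _ h4] at h3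
    rw [h3.1]
    refine ⟨flip_lt _ _ hy.1 ha, ?_⟩
    rw [popc_flip _ _ ha, hy.2]
    rw [shr_mod_two] at h1
    simpa using h1
  · exact absurd rfl h

/-! ### Cardinalities -/

noncomputable def cntP (p N : ℕ) : ℕ :=
  Nat.rec (motive := fun _ => ℕ) 0
    (fun A ih => bif Nat.beq (popc 12 A) p then Nat.succ ih else ih) N

theorem cntP_eq (p N : ℕ) :
    ((Finset.range N).filter (fun A => popc 12 A = p)).card = cntP p N := by
  induction N with
  | zero => rfl
  | succ N ih =>
    have e : cntP p (N + 1) = bif Nat.beq (popc 12 N) p then cntP p N + 1 else cntP p N := rfl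
    rw [e, Finset.range_add_one, Finset.filter_insert, ← ih, cond_eq_ite]
    by_cases h : popc 12 N = p
    · rw [if_pos h, if_pos (by rw [Nat.beq_eq]; exact h), Finset.card_insert_of_notMem (by simp)]
    · rw [if_neg h, if_neg (by rw [Nat.beq_eq]; exact h)]

theorem card_Xs (k p : ℕ) (hk : 0 < k) : (Xs k p).card = cntP p 4096 * k := by
  rw [← cntP_eq]
  conv_rhs => rw [← Finset.card_range k]
  rw [← Finset.card_product]
  refine Finset.card_nbij' (fun j => (j / k, j % k)) (fun x => x.1 * k + x.2) ?_ ?_ ?_ ?_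
  · intro j hj
    have hj := (mem_Xs k p j hk).1 hj
    simp [hj.1, hj.2, Nat.mod_lt _ hk]
  · rintro ⟨A, m⟩ hx
    simp only [Finset.coe_product, Set.mem_prod, Finset.mem_coe, Finset.mem_filter,
      Finset.mem_range] at hx
    simp only [Finset.mem_coe]
    obtain ⟨h1, h2⟩ := (divmod_iff k A m _ hx.2).1 rfl
    rw [mem_Xs k p _ hk, h1]
    exact hx.1
  · intro j _
    exact Nat.div_add_mod' j k
  · rintro ⟨A, m⟩ hx
    simp only [Finset.coe_product, Set.mem_prod, Finset.mem_coe, Finset.mem_filter,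
      Finset.mem_range] at hx
    obtain ⟨h1, h2⟩ := (divmod_iff k A m _ hx.2).1 rfl
    simp only [h1, h2]

theorem popc_le (A : ℕ) : popc 12 A ≤ 12 := by
  rw [popc_eq]
  calc _ ≤ ∑ i ∈ Finset.range 12, 1 := Finset.sum_le_sum (fun i _ => Bool.toNat_le _)
    _ = 12 := by simp

theorem cntP_zero (p : ℕ) (hp : 12 < p) (N : ℕ) : cntP p N = 0 := by
  rw [← cntP_eq, Finset.card_eq_zero, Finset.filter_eq_empty_iff]
  intro A _ h
  have := popc_le A
  omega

set_option maxRecDepth 100000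

theorem cntP_val : cntP 0 4096 = 1 ∧ cntP 1 4096 = 12 ∧ cntP 2 4096 = 66 ∧ cntP 3 4096 = 220 ∧
    cntP 4 4096 = 495 ∧ cntP 5 4096 = 792 ∧ cntP 6 4096 = 924 ∧ cntP 7 4096 = 792 ∧
    cntP 8 4096 = 495 ∧ cntP 9 4096 = 220 ∧ cntP 10 4096 = 66 ∧ cntP 11 4096 = 12 ∧
    cntP 12 4096 = 1 := by decide +kernel

/-! ### Ranks -/

/-- integral vectors on `X` lying in `W` -/
def LamW (X : Finset ℕ) (W : Submodule ℂ (X → ℂ)) : AddSubgroup (ℕ → ℤ) where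
  carrier := {u | (∀ j, j ∉ X → u j = 0) ∧ (fun j : X => ((u j : ℤ) : ℂ)) ∈ W}
  add_mem' := by
    rintro u v ⟨hu, hu'⟩ ⟨hv, hv'⟩
    refine ⟨fun j hj => by simp [hu j hj, hv j hj], ?_⟩
    have := W.add_mem hu' hv'
    convert this using 1
    ext j
    simp
  zero_mem' := by
    refine ⟨fun _ _ => rfl, ?_⟩
    convert W.zero_mem using 1
    ext j
    simp
  neg_mem' := by
    rintro u ⟨hu, hu'⟩
    refine ⟨fun j hj => by simp [hu j hj], ?_⟩
    have := W.neg_mem hu'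
    convert this using 1
    ext j
    simp

theorem finrank_ge (X : Finset ℕ) (W : Submodule ℂ (X → ℂ)) (R : ℕ) (t : Tr)
    (h : GoodT (RepP (LamW X W)) R t) : R ≤ Module.finrank ℂ W := by
  obtain ⟨J, u, hJ, hu, hli⟩ := GoodT_indep _ _ _ h
  let w : J → W := fun j => ⟨_, (hu j).2⟩
  have hw : LinearIndependent ℂ w := by
    let ext : (X → ℂ) →ₗ[ℂ] (ℕ → ℂ) :=
      { toFun := fun f j => if h : j ∈ X then f ⟨j, h⟩ else 0
        map_add' := by intro f g; ext j; by_cases h : j ∈ X <;> simp [h]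
        map_smul' := by intro c f; ext j; by_cases h : j ∈ X <;> simp [h] }
    apply LinearIndependent.of_comp (ext ∘ₗ W.subtype)
    convert hli using 1
    ext j i
    by_cases h : i ∈ X
    · simp [ext, w, h]
    · simp [ext, w, h, (hu j).1 i h]
  have := hw.fintype_card_le_finrank
  rwa [Fintype.card_coe, hJ] at this

/-- the matrix of the reduced Koszul differential -/
noncomputable def Mat (p : ℕ) : Matrix (Xs 6 p) (Xs 10 (p + 1)) ℂ := fun y j => ((cfR y j : ℤ) : ℂ)

theorem rank_Mat_ge (p R : ℕ) (h : chkR p R = true) : R ≤ (Mat p).rank := by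
  rw [← Matrix.rank_transpose]
  have key := fun hg => loopA_sound (RepP (LamW _ (LinearMap.range (Mat p).transpose.mulVecLin)))
    (RepP_xor _) (fun _ h => h.1) R 0 tabR 6 10 p hg 4096 R Tr.E le_rfl
    (by rw [Nat.sub_self]; exact GoodT_E _) h
  obtain ⟨t, ht⟩ := key (by
    intro A m hA hp hm
    obtain ⟨e1, e2⟩ := (divmod_iff 6 A m _ hm).1 rfl
    have hy : A * 6 + m ∈ Xs 6 p := by
      rw [mem_Xs _ _ _ (by norm_num), e1]; exact ⟨hA, hp⟩
    refine ⟨gen_lt _ _ _ _ _ _ hA le_rfl 12 le_rfl, fun j => cfR (A * 6 + m) j, ⟨?_, ?_⟩, ?_⟩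
    · intro j hj
      by_contra hc
      exact hj (cfR_support p _ j hy hc)
    · refine ⟨Pi.single ⟨_, hy⟩ 1, ?_⟩
      rw [Matrix.mulVecLin_apply, Matrix.mulVec_single_one]
      rfl
    · intro i
      have := gen_bit 0 tabR 6 10 A m i 12
      rw [← this]
      unfold cfR
      rw [e1, e2])
  exact finrank_ge _ _ _ _ ht

theorem ker_Mat_ge (p R : ℕ) (L : List ℕ) (h : loopV 1 tabC 10 6 (p + 1) L R Tr.E = true) :
    R ≤ Module.finrank ℂ (LinearMap.ker (Mat p).mulVecLin) := by
  have key := fun hg => loopV_sound 1 tabC 10 6 (p + 1) (by norm_num) (by norm_num) (by norm_num)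
    (LamW _ (LinearMap.ker (Mat p).mulVecLin)) hg R L R Tr.E le_rfl
    (by rw [Nat.sub_self]; exact GoodT_E _) h
  obtain ⟨t, ht⟩ := key (by
    intro u hu hu2
    refine ⟨hu, ?_⟩
    rw [LinearMap.mem_ker, Matrix.mulVecLin_apply]
    ext ⟨y, hy⟩
    have hy' : y < 65536 := by
      have := ((mem_Xs _ _ _ (by norm_num)).1 hy).1
      omega
    have := hu2 y hy'
    have e : ∑ j ∈ Xs 10 (p + 1), cfR y j * u j = 0 := by
      rw [← this]
      apply Finset.sum_congr rfl
      intro j _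
      rw [← cfC_eq_cfR, mul_comm]; rfl
    simp only [Matrix.mulVec, dotProduct, Mat, Pi.zero_apply]
    rw [Finset.sum_coe_sort (Xs 10 (p + 1)) (fun j => ((cfR y j : ℤ) : ℂ) * ((u j : ℤ) : ℂ))]
    exact_mod_cast e)
  exact finrank_ge _ _ _ _ ht

theorem kerT_Mat_ge (p R : ℕ) (L : List ℕ) (h : loopV 0 tabR 6 10 p L R Tr.E = true) :
    R ≤ Module.finrank ℂ (LinearMap.ker (Mat p).transpose.mulVecLin) := by
  have key := fun hg => loopV_sound 0 tabR 6 10 p (by norm_num) (by norm_num) (by norm_num)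
    (LamW _ (LinearMap.ker (Mat p).transpose.mulVecLin)) hg R L R Tr.E le_rfl
    (by rw [Nat.sub_self]; exact GoodT_E _) h
  obtain ⟨t, ht⟩ := key (by
    intro u hu hu2
    refine ⟨hu, ?_⟩
    rw [LinearMap.mem_ker, Matrix.mulVecLin_apply]
    ext ⟨y, hy⟩
    have hy' : y < 65536 := by
      have := ((mem_Xs _ _ _ (by norm_num)).1 hy).1
      omega
    have := hu2 y hy'
    have e : ∑ j ∈ Xs 6 p, cfR j y * u j = 0 := by
      rw [← this]
      apply Finset.sum_congr rfl
      intro j _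
      rw [mul_comm]; rfl
    simp only [Matrix.mulVec, dotProduct, Mat, Pi.zero_apply, Matrix.transpose_apply]
    rw [Finset.sum_coe_sort (Xs 6 p) (fun j => ((cfR j y : ℤ) : ℂ) * ((u j : ℤ) : ℂ))]
    exact_mod_cast e)
  exact finrank_ge _ _ _ _ ht

theorem rank_Mat_le_of_ker (p R : ℕ)
    (h : R ≤ Module.finrank ℂ (LinearMap.ker (Mat p).mulVecLin)) :
    (Mat p).rank + R ≤ (Xs 10 (p + 1)).card := by
  have := LinearMap.finrank_range_add_finrank_ker (Mat p).mulVecLin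
  rw [Module.finrank_fintype_fun_eq_card, Fintype.card_coe] at this
  unfold Matrix.rank
  omega

theorem rank_Mat_le_of_kerT (p R : ℕ)
    (h : R ≤ Module.finrank ℂ (LinearMap.ker (Mat p).transpose.mulVecLin)) :
    (Mat p).rank + R ≤ (Xs 6 p).card := by
  have := LinearMap.finrank_range_add_finrank_ker (Mat p).transpose.mulVecLin
  rw [Module.finrank_fintype_fun_eq_card, Fintype.card_coe] at this
  rw [← Matrix.rank_transpose]
  unfold Matrix.rank
  omega

theorem rank_Mat_le (p : ℕ) : (Mat p).rank ≤ (Xs 6 p).card ∧ (Mat p).rank ≤ (Xs 10 (p + 1)).card := by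
  have h1 := (Mat p).rank_le_card_height
  have h2 := (Mat p).rank_le_card_width
  rw [Fintype.card_coe] at h1 h2
  exact ⟨h1, h2⟩

/-! ### The rank computations -/

theorem chk_rank_0 : chkR 0 6 = true := by decide +kernel

theorem chk_rank_1 : chkR 1 72 = true := by decide +kernel

theorem chk_rank_2 : chkR 2 396 = true := by decide +kernel

theorem chk_rank_3 : chkR 3 1320 = true := by decide +kernel

theorem chk_rank_4 : chkR 4 2970 = true := by decide +kernel

theorem chk_rank_5 : chkR 5 4752 = true := by decide +kernel

theorem chk_rank_6 : chkR 6 5544 = true := by decide +kernel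

theorem chk_rank_7 : chkR 7 4500 = true := by decide +kernel

theorem chk_rank_8 : chkR 8 2145 = true := by decide +kernel

theorem chk_rank_9 : chkR 9 660 = true := by decide +kernel

theorem chk_rank_10 : chkR 10 120 = true := by decide +kernel

theorem chk_rank_11 : chkR 11 10 = true := by decide +kernel

theorem chk_ker_8 : loopV 1 tabC 10 6 9 datC 55 Tr.E = true := by decide +kernel

theorem chk_kerT_7 : loopV 0 tabR 6 10 7 datR 252 Tr.E = true := by decide +kernel


/-! ### A concrete model of the Koszul complex -/

/-- exponent vectors of the quartic monomials; the last three are the fourth powers -/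
def vec : Fin 15 → Fin 3 → ℕ :=
  ![![3,1,0], ![3,0,1], ![2,2,0], ![2,1,1], ![2,0,2], ![1,3,0], ![1,2,1], ![1,1,2], ![1,0,3],
    ![0,3,1], ![0,2,2], ![0,1,3], ![4,0,0], ![0,4,0], ![0,0,4]]

/-- the index of the fourth power of the variable `i` -/
def zi : Fin 3 → Fin 15 := ![12, 13, 14]

instance decLeVec (u v : Fin 3 → ℕ) : Decidable (u ≤ v) :=
  decidable_of_iff (∀ i, u i ≤ v i) Iff.rfl

/-- functions on pairs (set of quartic monomials, monomial) -/
abbrev KK : Type := Finset (Fin 15) → (Fin 3 → ℕ) → ℂ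

/-- Koszul sign -/
def sg (B : Finset (Fin 15)) (a : Fin 15) : ℂ := (-1) ^ (B.filter (fun b => b < a)).card

theorem sg_sq (B : Finset (Fin 15)) (a : Fin 15) : sg B a * sg B a = 1 := by
  unfold sg
  rw [← pow_add, ← two_mul, pow_mul]; simp

theorem sg_insert_lt (B : Finset (Fin 15)) (a b : Fin 15) (hb : b ∉ B) (h : b < a) :
    sg (insert b B) a = - sg B a := by
  unfold sg
  rw [Finset.filter_insert, if_pos h, Finset.card_insert_of_notMem (by simp [hb]), pow_succ]
  ring

theorem sg_insert_ge (B : Finset (Fin 15)) (a b : Fin 15) (h : ¬ b < a) :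
    sg (insert b B) a = sg B a := by
  unfold sg
  rw [Finset.filter_insert, if_neg h]

theorem sg_swap (B : Finset (Fin 15)) (a b : Fin 15) (ha : a ∉ B) (hb : b ∉ B) (hab : a ≠ b) :
    sg B a * sg (insert a B) b = - (sg B b * sg (insert b B) a) := by
  rcases lt_or_gt_of_ne hab with h | h
  · rw [sg_insert_lt B b a ha h, sg_insert_ge B a b (not_lt.2 h.le)]; ring
  · rw [sg_insert_lt B a b hb h, sg_insert_ge B b a (not_lt.2 h.le)]; ring

/-- the Koszul differential -/
noncomputable def dK : KK →ₗ[ℂ] KK where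
  toFun f B n := ∑ a : Fin 15, if a ∉ B ∧ vec a ≤ n then sg B a * f (insert a B) (n - vec a) else 0
  map_add' f g := by
    funext B n
    simp only [Pi.add_apply]
    rw [← Finset.sum_add_distrib]
    refine Finset.sum_congr rfl (fun a _ => ?_)
    split_ifs
    · ring
    · simp
  map_smul' c f := by
    funext B n
    simp only [Pi.smul_apply, smul_eq_mul, RingHom.id_apply]
    rw [Finset.mul_sum]
    refine Finset.sum_congr rfl (fun a _ => ?_)
    split_ifs
    · ring
    · simp

theorem dK_apply (f : KK) (B : Finset (Fin 15)) (n : Fin 3 → ℕ) : dK f B n =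
    ∑ a : Fin 15, if a ∉ B ∧ vec a ≤ n then sg B a * f (insert a B) (n - vec a) else 0 := rfl

theorem dK_dK (f : KK) : dK (dK f) = 0 := by
  funext B n
  let F : Fin 15 → Fin 15 → ℂ := fun a b =>
    if (a ∉ B ∧ b ∉ B ∧ a ≠ b) ∧ vec a + vec b ≤ n then
      sg B a * sg (insert a B) b * f (insert b (insert a B)) (n - vec a - vec b) else 0
  have hF : ∀ a b, F a b = - F b a := by
    intro a b
    by_cases h : (a ∉ B ∧ b ∉ B ∧ a ≠ b) ∧ vec a + vec b ≤ n
    · have h' : (b ∉ B ∧ a ∉ B ∧ b ≠ a) ∧ vec b + vec a ≤ n :=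
        ⟨⟨h.1.2.1, h.1.1, h.1.2.2.symm⟩, by rw [add_comm]; exact h.2⟩
      simp only [F]
      rw [if_pos h, if_pos h', sg_swap B a b h.1.1 h.1.2.1 h.1.2.2, Finset.insert_comm,
        tsub_right_comm]
      ring
    · have h' : ¬ ((b ∉ B ∧ a ∉ B ∧ b ≠ a) ∧ vec b + vec a ≤ n) := by
        rintro ⟨⟨h1, h2, h3⟩, h4⟩
        exact h ⟨⟨h2, h1, h3.symm⟩, by rw [add_comm]; exact h4⟩
      simp only [F]
      rw [if_neg h, if_neg h', neg_zero]
  have e : dK (dK f) B n = ∑ a, ∑ b, F a b := by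
    rw [dK_apply]
    refine Finset.sum_congr rfl (fun a _ => ?_)
    split_ifs with h
    · rw [dK_apply, Finset.mul_sum]
      refine Finset.sum_congr rfl (fun b _ => ?_)
      have : (b ∉ insert a B ∧ vec b ≤ n - vec a) ↔
          ((a ∉ B ∧ b ∉ B ∧ a ≠ b) ∧ vec a + vec b ≤ n) := by
        rw [le_tsub_iff_left h.2, Finset.mem_insert]
        have := h.1
        constructor
        · rintro ⟨h1, h2⟩
          exact ⟨⟨this, fun hh => h1 (Or.inr hh), fun hh => h1 (Or.inl hh.symm)⟩, h2⟩
        · rintro ⟨⟨_, h1, h3⟩, h2⟩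
          exact ⟨by rintro (hh | hh); exacts [h3 hh.symm, h1 hh], h2⟩
      simp only [F]
      by_cases hc : (a ∉ B ∧ b ∉ B ∧ a ≠ b) ∧ vec a + vec b ≤ n
      · rw [if_pos hc, if_pos (this.2 hc)]; ring
      · rw [if_neg hc, if_neg (fun hh => hc (this.1 hh)), mul_zero]
    · symm
      refine Finset.sum_eq_zero (fun b _ => ?_)
      simp only [F]
      rw [if_neg]
      rintro ⟨⟨h1, _⟩, h4⟩
      exact h ⟨h1, le_trans (by simp) h4⟩
  have e2 : ∑ a, ∑ b, F a b = - ∑ a, ∑ b, F a b := by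
    conv_lhs => rw [Finset.sum_comm]
    rw [← Finset.sum_neg_distrib]
    refine Finset.sum_congr rfl (fun a _ => ?_)
    rw [← Finset.sum_neg_distrib]
    exact Finset.sum_congr rfl (fun b _ => hF b a)
  rw [e]
  exact self_eq_neg.1 e2

/-- the graded pieces -/
def GG (p : ℕ) (e : ℤ) : Submodule ℂ KK where
  carrier := {f | ∀ A m, f A m ≠ 0 → A.card = p ∧ ∑ i, (m i : ℤ) = e}
  add_mem' := by
    intro f g hf hg A m h
    by_cases h1 : f A m = 0
    · by_cases h2 : g A m = 0
      · simp [h1, h2] at h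
      · exact hg A m h2
    · exact hf A m h1
  zero_mem' := by intro A m h; simp at h
  smul_mem' := by
    intro c f hf A m h
    apply hf A m
    intro h1
    simp [h1] at h

theorem mem_GG {p : ℕ} {e : ℤ} {f : KK} :
    f ∈ GG p e ↔ ∀ A m, f A m ≠ 0 → A.card = p ∧ ∑ i, (m i : ℤ) = e := Iff.rfl

theorem vec_sum (a : Fin 15) : ∑ i, (vec a i : ℤ) = 4 := by
  revert a; decide

theorem dK_mem {p : ℕ} {e : ℤ} {f : KK} (hf : f ∈ GG (p + 1) e) : dK f ∈ GG p (e + 4) := by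
  intro B n h
  rw [dK_apply] at h
  obtain ⟨a, _, h⟩ := Finset.exists_ne_zero_of_sum_ne_zero h
  split_ifs at h with hc
  · have := hf _ _ (right_ne_zero_of_mul h)
    rw [Finset.card_insert_of_notMem hc.1] at this
    refine ⟨by omega, ?_⟩
    rw [← this.2, ← vec_sum a, ← Finset.sum_add_distrib]
    refine Finset.sum_congr rfl (fun i _ => ?_)
    have : vec a i ≤ n i := hc.2 i
    simp only [Pi.sub_apply]
    omega
  · exact absurd rfl h

theorem dK_zero {e : ℤ} {f : KK} (hf : f ∈ GG 0 e) : dK f = 0 := by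
  funext B n
  rw [dK_apply]
  refine Finset.sum_eq_zero (fun a _ => ?_)
  split_ifs with hc
  · by_contra h
    have := (hf _ _ (right_ne_zero_of_mul h)).1
    rw [Finset.card_insert_of_notMem hc.1] at this
    omega
  · rfl

/-- the contracting homotopy for the variable `i` -/
noncomputable def hK (i : Fin 3) (f : KK) : KK := fun A m =>
  if zi i ∈ A then sg (A.erase (zi i)) (zi i) * f (A.erase (zi i)) (m + vec (zi i)) else 0

theorem hK_mem {p : ℕ} {e : ℤ} {f : KK} (i : Fin 3) (hf : f ∈ GG p e) :
    hK i f ∈ GG (p + 1) (e - 4) := by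
  intro A m h
  unfold hK at h
  split_ifs at h with hc
  · have := hf _ _ (right_ne_zero_of_mul h)
    rw [Finset.card_erase_of_mem hc] at this
    have h0 : 0 < A.card := Finset.card_pos.2 ⟨_, hc⟩
    refine ⟨by omega, ?_⟩
    have h2 := this.2
    simp only [Pi.add_apply, Nat.cast_add, Finset.sum_add_distrib] at h2
    rw [vec_sum] at h2
    omega
  · exact absurd rfl h

/-- reducedness with respect to the variables in `T` -/
def Redu (T : Finset (Fin 3)) (A : Finset (Fin 15)) (m : Fin 3 → ℕ) : Prop :=
  ∀ i ∈ T, zi i ∉ A ∧ m i < 4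

/-- functions vanishing on the reduced pairs -/
def UU (T : Finset (Fin 3)) : Submodule ℂ KK where
  carrier := {f | ∀ A m, Redu T A m → f A m = 0}
  add_mem' := by
    intro f g hf hg A m h
    simp [hf A m h, hg A m h]
  zero_mem' := by intro A m h; rfl
  smul_mem' := by
    intro c f hf A m h
    simp [hf A m h]

theorem vec_zi (i : Fin 3) : vec (zi i) = Pi.single i 4 := by
  revert i; decide

theorem vec_le (a : Fin 15) (i : Fin 3) : vec a i ≤ 4 := by revert a i; decide

theorem vec_four (a : Fin 15) (i : Fin 3) (h : vec a i = 4) : a = zi i := by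
  revert a i; decide

theorem vec_zi_le (i : Fin 3) (m : Fin 3 → ℕ) : vec (zi i) ≤ m ↔ 4 ≤ m i := by
  rw [vec_zi]
  constructor
  · intro h
    simpa using h i
  · intro h j
    by_cases hj : j = i
    · subst hj; simpa using h
    · simp [Pi.single_eq_of_ne hj]

theorem zi_inj {i j : Fin 3} (h : zi i = zi j) : i = j := by
  revert i j; decide

theorem dK_UU (T : Finset (Fin 3)) {f : KK} (hf : f ∈ UU T) : dK f ∈ UU T := by
  intro B n h
  rw [dK_apply]
  refine Finset.sum_eq_zero (fun a _ => ?_)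
  split_ifs with hc
  · rw [hf, mul_zero]
    intro i hi
    have := h i hi
    refine ⟨?_, ?_⟩
    · rw [Finset.mem_insert]
      rintro (h1 | h1)
      · rw [← h1, vec_zi_le] at hc
        omega
      · exact this.1 h1
    · simp only [Pi.sub_apply]; omega
  · rfl

theorem hK_UU (T : Finset (Fin 3)) (i : Fin 3) (hi : i ∈ T) (f : KK) : hK i f ∈ UU T := by
  intro A m h
  unfold hK
  rw [if_neg (h i hi).1]

theorem UU_mono {T T' : Finset (Fin 3)} (h : T ⊆ T') : UU T ≤ UU T' :=
  fun _ hf A m hr => hf A m (fun i hi => hr i (h hi))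

/-- the homotopy formula off the set -/
theorem homotopy_notMem (i : Fin 3) (f : KK) (A : Finset (Fin 15)) (m : Fin 3 → ℕ)
    (hA : zi i ∉ A) : dK (hK i f) A m = if 4 ≤ m i then f A m else 0 := by
  rw [dK_apply, Finset.sum_eq_single (zi i)]
  · by_cases h : 4 ≤ m i
    · rw [if_pos h, if_pos ⟨hA, (vec_zi_le i m).2 h⟩]
      unfold hK
      rw [if_pos (Finset.mem_insert_self _ _), Finset.erase_insert hA, ← mul_assoc, sg_sq, one_mul,
        tsub_add_cancel_of_le ((vec_zi_le i m).2 h)]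
    · rw [if_neg h, if_neg (fun hh => h ((vec_zi_le i m).1 hh.2))]
  · intro b _ hb
    split_ifs with hc
    · unfold hK
      rw [if_neg, mul_zero]
      rw [Finset.mem_insert]
      rintro (h | h)
      · exact hb h.symm
      · exact hA h
    · rfl
  · simp

theorem homotopy_mem (i : Fin 3) (f : KK) (A : Finset (Fin 15)) (m : Fin 3 → ℕ)
    (hA : zi i ∈ A) : dK (hK i f) A m + hK i (dK f) A m = f A m +
      ∑ b : Fin 15, if b ∉ A ∧ ¬ vec b ≤ m ∧ vec b ≤ m + vec (zi i) then
        sg (A.erase (zi i)) (zi i) * sg (A.erase (zi i)) b *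
          f (insert b (A.erase (zi i))) (m + vec (zi i) - vec b) else 0 := by
  have e1 : hK i (dK f) A m = sg (A.erase (zi i)) (zi i) *
    dK f (A.erase (zi i)) (m + vec (zi i)) := by
    unfold hK; rw [if_pos hA]
  rw [e1, dK_apply, dK_apply, Finset.mul_sum]
  rw [← Finset.add_sum_erase Finset.univ
    (fun b => sg (A.erase (zi i)) (zi i) * if b ∉ A.erase (zi i) ∧ vec b ≤ m + vec (zi i) then
      sg (A.erase (zi i)) b * f (insert b (A.erase (zi i))) (m + vec (zi i) - vec b) else 0)
    (Finset.mem_univ (zi i))]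
  rw [if_pos ⟨Finset.notMem_erase _ _, by simp⟩, Finset.insert_erase hA, add_tsub_cancel_right,
    ← mul_assoc, sg_sq, one_mul, add_left_comm]
  congr 1
  rw [← Finset.add_sum_erase Finset.univ _ (Finset.mem_univ (zi i)),
    ← Finset.add_sum_erase Finset.univ (fun b : Fin 15 =>
      if b ∉ A ∧ ¬ vec b ≤ m ∧ vec b ≤ m + vec (zi i) then
        sg (A.erase (zi i)) (zi i) * sg (A.erase (zi i)) b *
          f (insert b (A.erase (zi i))) (m + vec (zi i) - vec b) else 0) (Finset.mem_univ (zi i)),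
    if_neg (fun h => h.1 hA), if_neg (fun h => h.1 hA), zero_add, zero_add,
    ← Finset.sum_add_distrib]
  refine Finset.sum_congr rfl (fun b hb => ?_)
  have hb : b ≠ zi i := Finset.ne_of_mem_erase hb
  by_cases hbA : b ∈ A
  · rw [if_neg (fun h => h.1 hbA), if_neg (fun h => h.1 (Finset.mem_erase.2 ⟨hb, hbA⟩)),
      if_neg (fun h => h.1 hbA)]
    simp
  have hbE : b ∉ A.erase (zi i) := fun h => hbA (Finset.mem_of_mem_erase h)
  by_cases h1 : vec b ≤ m
  · have h2 : vec b ≤ m + vec (zi i) := h1.trans (by simp)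
    rw [if_pos ⟨hbA, h1⟩, if_pos ⟨hbE, h2⟩, if_neg (fun h => h.2.1 h1)]
    unfold hK
    rw [if_pos (Finset.mem_insert_of_mem hA), Finset.erase_insert_of_ne hb,
      tsub_add_eq_add_tsub h1]
    have := sg_swap (A.erase (zi i)) (zi i) b (Finset.notMem_erase _ _) hbE hb.symm
    rw [Finset.insert_erase hA] at this
    have h3 : sg A b = - (sg (A.erase (zi i)) (zi i) * (sg (A.erase (zi i)) b *
        sg (insert b (A.erase (zi i))) (zi i))) := by
      rw [← neg_eq_iff_eq_neg.2 this, mul_neg, ← mul_assoc, sg_sq]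
      ring
    rw [h3]
    have h4 := sg_sq (insert b (A.erase (zi i))) (zi i)
    linear_combination (- sg (A.erase (zi i)) (zi i) * sg (A.erase (zi i)) b *
      f (insert b (A.erase (zi i))) (m + vec (zi i) - vec b)) * h4
  · rw [if_neg (fun h => h1 h.2), zero_add]
    by_cases h2 : vec b ≤ m + vec (zi i)
    · rw [if_pos ⟨hbE, h2⟩, if_pos ⟨hbA, h1, h2⟩]; ring
    · rw [if_neg (fun h => h2 h.2), if_neg (fun h => h2 h.2.2), mul_zero]

theorem phi_UU (T : Finset (Fin 3)) (i : Fin 3) (u : KK)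
    (hu : u ∈ UU (insert i T)) (hd : dK u = 0) : u - dK (hK i u) ∈ UU T := by
  intro A m hr
  simp only [Pi.sub_apply]
  by_cases hA : zi i ∈ A
  · have h := homotopy_mem i u A m hA
    have h0 : hK i (dK u) A m = 0 := by
      rw [hd]; unfold hK; simp
    rw [h0, add_zero] at h
    rw [h, sub_add_cancel_left, neg_eq_zero]
    refine Finset.sum_eq_zero (fun b _ => ?_)
    split_ifs with hc
    · obtain ⟨hb, h1, h2⟩ := hc
      have hlt : m i < vec b i := by
        by_contra hcon
        apply h1
        intro j
        by_cases hj : j = i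
        · subst hj; exact not_lt.1 hcon
        · have := h2 j
          rw [vec_zi] at this
          simpa [Pi.single_eq_of_ne hj] using this
      rw [hu, mul_zero]
      intro j hj
      by_cases hji : j = i
      · subst hji
        refine ⟨?_, ?_⟩
        · rw [Finset.mem_insert]
          rintro (h | h)
          · rw [← h] at hb; exact hb hA
          · exact Finset.notMem_erase _ _ h
        · simp only [Pi.sub_apply, Pi.add_apply, vec_zi, Pi.single_eq_same]
          omega
      · have hjT : j ∈ T := (Finset.mem_insert.1 hj).resolve_left hji
        have hrj := hr j hjT
        refine ⟨?_, ?_⟩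
        · rw [Finset.mem_insert]
          rintro (h | h)
          · have h3 := h2 j
            rw [← h, vec_zi, vec_zi] at h3
            simp only [Pi.single_eq_same, Pi.add_apply, Pi.single_eq_of_ne hji] at h3
            omega
          · exact hrj.1 (Finset.mem_of_mem_erase h)
        · simp only [Pi.sub_apply, Pi.add_apply, vec_zi, Pi.single_eq_of_ne hji]
          omega
    · rfl
  · rw [homotopy_notMem i u A m hA]
    split_ifs with h
    · exact sub_self _
    · rw [sub_zero]
      apply hu
      intro j hj
      rcases Finset.mem_insert.1 hj with rfl | hj
      · exact ⟨hA, by omega⟩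
      · exact hr j hj

theorem acyclic_UU (p : ℕ) (e : ℤ) (T : Finset (Fin 3)) : ∀ u : KK, u ∈ UU T → u ∈ GG p (e + 4) →
    dK u = 0 → ∃ w ∈ UU T, w ∈ GG (p + 1) e ∧ dK w = u := by
  induction T using Finset.induction_on with
  | empty =>
    intro u hu _ _
    refine ⟨0, Submodule.zero_mem _, Submodule.zero_mem _, ?_⟩
    rw [map_zero]
    funext A m
    exact (hu A m (fun i hi => absurd hi (Finset.notMem_empty i))).symm
  | insert i T hi ih =>
    intro u hu hG hd
    have hh : hK i u ∈ GG (p + 1) e := by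
      have := hK_mem i hG
      rwa [add_sub_cancel_right] at this
    obtain ⟨w, hw, hwG, hdw⟩ := ih (u - dK (hK i u)) (phi_UU T i u hu hd)
      (Submodule.sub_mem _ hG (dK_mem hh)) (by rw [map_sub, hd, dK_dK, sub_zero])
    refine ⟨w + hK i u, ?_, Submodule.add_mem _ hwG hh, ?_⟩
    · exact Submodule.add_mem _ (UU_mono (Finset.subset_insert i T) hw)
        (hK_UU _ i (Finset.mem_insert_self i T) u)
    · rw [map_add, hdw, sub_add_cancel]

/-! ### Dimensions in the concrete model -/

/-- the subset coded by a number -/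
def dcd (c : ℕ) : Finset (Fin 15) := Finset.univ.filter (fun a => c.testBit a = true)

theorem mem_dcd (c : ℕ) (a : Fin 15) : a ∈ dcd c ↔ c.testBit a = true := by
  simp [dcd]

theorem testBit_big (c : ℕ) (hc : c < 4096) (a : ℕ) (ha : 12 ≤ a) : c.testBit a = false := by
  apply Nat.testBit_lt_two_pow
  exact lt_of_lt_of_le hc (le_trans (by norm_num) (Nat.pow_le_pow_right (by norm_num) ha))

theorem dcd_inj (c c' : ℕ) (hc : c < 4096) (hc' : c' < 4096) (h : dcd c = dcd c') : c = c' := by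
  apply Nat.eq_of_testBit_eq
  intro i
  by_cases hi : i < 12
  · have h1 := mem_dcd c ⟨i, by omega⟩
    have h2 := mem_dcd c' ⟨i, by omega⟩
    rw [h] at h1
    rw [Bool.eq_iff_iff]
    exact h1.symm.trans h2
  · rw [testBit_big c hc i (by omega), testBit_big c' hc' i (by omega)]

theorem dcd_flip (c : ℕ) (a : Fin 15) (ha : a ∉ dcd c) :
    dcd (c ^^^ (1 <<< (a : ℕ))) = insert a (dcd c) := by
  ext b
  rw [Finset.mem_insert, mem_dcd, mem_dcd, testBit_flip]
  by_cases hab : b = a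
  · subst hab
    rw [mem_dcd] at ha
    simp [ha]
  · have : (a : ℕ) ≠ (b : ℕ) := fun h => hab (Fin.ext h.symm)
    simp [this, hab]

theorem dcd_popc (c n : ℕ) (hc : c < 4096) (hn : n < 16) :
    ((dcd c).filter (fun b : Fin 15 => (b : ℕ) < n)).card = popc 12 (c % 2 ^ n) := by
  rw [popc_eq, dcd, Finset.filter_filter, Finset.card_filter]
  have e : ∀ a : Fin 15, (if c.testBit a = true ∧ (a : ℕ) < n then 1 else 0) =
      (fun i => ((c % 2 ^ n).testBit i).toNat) (a : ℕ) := by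
    intro a
    simp only [Nat.testBit_mod_two_pow]
    cases h : c.testBit a <;> by_cases h2 : (a : ℕ) < n <;> simp [h2]
  rw [Finset.sum_congr rfl (fun a _ => e a),
    Fin.sum_univ_eq_sum_range (fun i => ((c % 2 ^ n).testBit i).toNat) 15]
  rw [Finset.sum_range_succ, Finset.sum_range_succ, Finset.sum_range_succ]
  simp only [Nat.testBit_mod_two_pow]
  rw [testBit_big c hc 12 le_rfl, testBit_big c hc 13 (by norm_num),
    testBit_big c hc 14 (by norm_num)]
  simp

theorem dcd_card (c : ℕ) (hc : c < 4096) : (dcd c).card = popc 12 c := by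
  have h := dcd_popc c 15 hc (by norm_num)
  rw [Nat.mod_eq_of_lt (lt_trans hc (by norm_num))] at h
  rw [← h, Finset.filter_true_of_mem (fun b _ => b.2)]

theorem sg_dcd (c : ℕ) (hc : c < 4096) (a : Fin 15) :
    sg (dcd c) a = (-1) ^ popc 12 (c % 2 ^ (a : ℕ)) := by
  rw [← dcd_popc c a hc (by omega)]
  rfl

theorem exists_dcd (A : Finset (Fin 15)) : (∀ a ∈ A, (a : ℕ) < 12) → ∃ c, c < 4096 ∧ dcd c = A := by
  induction A using Finset.induction_on with
  | empty =>
    intro _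
    exact ⟨0, by norm_num, by ext b; simp [mem_dcd]⟩
  | insert a A ha ih =>
    intro h
    obtain ⟨c, hc, hcA⟩ := ih (fun b hb => h b (Finset.mem_insert_of_mem hb))
    refine ⟨c ^^^ (1 <<< (a : ℕ)), flip_lt c a hc (h a (Finset.mem_insert_self a A)), ?_⟩
    rw [dcd_flip c a (by rw [hcA]; exact ha), hcA]

theorem zi_lt (A : Finset (Fin 15)) : (∀ i, zi i ∉ A) ↔ ∀ a ∈ A, (a : ℕ) < 12 := by
  constructor
  · intro h a ha
    by_contra hc
    have : ∀ a : Fin 15, ¬ (a : ℕ) < 12 → ∃ i, zi i = a := by decide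
    obtain ⟨i, rfl⟩ := this a hc
    exact h i ha
  · intro h i hi
    have h0 : ∀ i, ¬ ((zi i : Fin 15) : ℕ) < 12 := by decide
    exact h0 i (h _ hi)

/-- the restriction to the reduced pairs -/
noncomputable def rho (k p : ℕ) (S : ℕ → Fin 3 → ℕ) : KK →ₗ[ℂ] (Xs k p → ℂ) where
  toFun f j := f (dcd (j / k)) (S (j % k))
  map_add' _ _ := rfl
  map_smul' _ _ := rfl

/-- `S` lists the reduced monomials of degree `e` -/
structure IsList (k : ℕ) (e : ℤ) (S : ℕ → Fin 3 → ℕ) : Prop where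
  pos : 0 < k
  lt : ∀ i < k, ∀ c, S i c < 4
  deg : ∀ i < k, ∑ c, (S i c : ℤ) = e
  inj : ∀ i < k, ∀ j < k, S i = S j → i = j
  surj : ∀ m : Fin 3 → ℕ, (∀ c, m c < 4) → ∑ c, (m c : ℤ) = e → ∃ i < k, S i = m

theorem rho_eq_zero {k p : ℕ} {e : ℤ} {S : ℕ → Fin 3 → ℕ} (hS : IsList k e S) {f : KK}
    (hf : f ∈ GG p e) : rho k p S f = 0 ↔ f ∈ UU Finset.univ := by
  constructor
  · intro h A m hr
    by_contra hne
    obtain ⟨h1, h2⟩ := hf A m hne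
    obtain ⟨c, hc, rfl⟩ := exists_dcd A ((zi_lt A).1 (fun i => (hr i (Finset.mem_univ i)).1))
    obtain ⟨i, hi, rfl⟩ := hS.surj m (fun i => (hr i (Finset.mem_univ i)).2) h2
    obtain ⟨e1, e2⟩ := (divmod_iff k c i _ hi).1 rfl
    have hj : c * k + i ∈ Xs k p := by
      rw [mem_Xs _ _ _ hS.pos, e1]
      exact ⟨hc, by rw [← dcd_card c hc]; exact h1⟩
    have := congrFun h ⟨_, hj⟩
    simp only [rho, LinearMap.coe_mk, AddHom.coe_mk, e1, e2] at this
    exact hne this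
  · intro h
    funext ⟨j, hj⟩
    have hj' := (mem_Xs _ _ _ hS.pos).1 hj
    apply h
    intro i _
    have hz : ∀ i, zi i ∉ dcd (j / k) := by
      rw [zi_lt]
      intro a ha
      by_contra hc
      rw [mem_dcd, testBit_big _ hj'.1 _ (by omega)] at ha
      exact absurd ha (by simp)
    exact ⟨hz i, hS.lt _ (Nat.mod_lt _ hS.pos) i⟩

theorem rho_surj {k p : ℕ} {e : ℤ} {S : ℕ → Fin 3 → ℕ} (hS : IsList k e S) (w : Xs k p → ℂ) :
    ∃ f ∈ GG p e, rho k p S f = w := by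
  classical
  refine ⟨fun A m => ∑ j : Xs k p, if A = dcd (j / k) ∧ m = S (j % k) then w j else 0, ?_, ?_⟩
  · intro A m h
    obtain ⟨⟨j, hj⟩, _, h⟩ := Finset.exists_ne_zero_of_sum_ne_zero h
    have hj' := (mem_Xs _ _ _ hS.pos).1 hj
    split_ifs at h with hc
    · obtain ⟨rfl, rfl⟩ := hc
      refine ⟨?_, hS.deg _ (Nat.mod_lt _ hS.pos)⟩
      rw [dcd_card _ hj'.1]; exact hj'.2
    · exact absurd rfl h
  · funext j
    simp only [rho, LinearMap.coe_mk, AddHom.coe_mk]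
    rw [Finset.sum_eq_single j]
    · simp
    · intro b _ hb
      rw [if_neg]
      rintro ⟨h1, h2⟩
      apply hb
      have hj' := (mem_Xs _ _ _ hS.pos).1 j.2
      have hb' := (mem_Xs _ _ _ hS.pos).1 b.2
      have e1 := dcd_inj _ _ hj'.1 hb'.1 h1
      have e2 := hS.inj _ (Nat.mod_lt _ hS.pos) _ (Nat.mod_lt _ hS.pos) h2
      apply Subtype.ext
      rw [← Nat.div_add_mod' (b : ℕ) k, ← e1, ← e2, Nat.div_add_mod']
    · simp

/-- reduced monomials of degree 3 -/
def S3 (i : ℕ) : Fin 3 → ℕ :=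
  (![![3,0,0], ![2,1,0], ![2,0,1], ![1,2,0], ![1,1,1], ![1,0,2], ![0,3,0], ![0,2,1], ![0,1,2],
    ![0,0,3]] : Fin 10 → Fin 3 → ℕ) (Fin.ofNat 10 i)

/-- reduced monomials of degree 7 -/
def S7 (i : ℕ) : Fin 3 → ℕ :=
  (![![3,3,1], ![3,2,2], ![3,1,3], ![2,3,2], ![2,2,3], ![1,3,3]] : Fin 6 → Fin 3 → ℕ)
    (Fin.ofNat 6 i)

theorem exists_fin4 (m : Fin 3 → ℕ) (h : ∀ c, m c < 4) :
    ∃ a b c : Fin 4, m = ![(a : ℕ), (b : ℕ), (c : ℕ)] := by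
  refine ⟨⟨m 0, h 0⟩, ⟨m 1, h 1⟩, ⟨m 2, h 2⟩, ?_⟩
  funext i
  fin_cases i <;> rfl

theorem isList3 : IsList 10 3 S3 where
  pos := by norm_num
  lt := by decide +kernel
  deg := by decide +kernel
  inj := by decide +kernel
  surj := by
    intro m hm
    obtain ⟨a, b, c, rfl⟩ := exists_fin4 m hm
    clear hm
    revert a b c
    decide +kernel

theorem isList7 : IsList 6 7 S7 where
  pos := by norm_num
  lt := by decide +kernel
  deg := by decide +kernel
  inj := by decide +kernel
  surj := by
    intro m hm
    obtain ⟨a, b, c, rfl⟩ := exists_fin4 m hm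
    clear hm
    revert a b c
    decide +kernel

theorem tab_vec : ∀ a : Fin 15, (a : ℕ) < 12 → ∀ n < 6, (vec a ≤ S7 n ↔ tb tabR 6 a n ≠ 15) ∧
    (vec a ≤ S7 n → S3 (tb tabR 6 a n) = S7 n - vec a) := by decide +kernel

theorem vec_not_le : ∀ a : Fin 15, ¬ (a : ℕ) < 12 → ∀ n < 6, ¬ vec a ≤ S7 n := by decide +kernel

theorem rho_dK (p : ℕ) (f : KK) :
    rho 6 p S7 (dK f) = (Mat p).mulVecLin (rho 10 (p + 1) S3 f) := by
  funext ⟨y, hy⟩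
  have hy' := (mem_Xs _ _ _ (by norm_num)).1 hy
  have hn : y % 6 < 6 := Nat.mod_lt _ (by norm_num)
  rw [Matrix.mulVecLin_apply]
  simp only [rho, LinearMap.coe_mk, AddHom.coe_mk, Matrix.mulVec, dotProduct, Mat]
  rw [Finset.sum_coe_sort (Xs 10 (p + 1))
    (fun j => ((cfR y j : ℤ) : ℂ) * f (dcd (j / 10)) (S3 (j % 10)))]
  have e1 : ∀ j, ((cfR y j : ℤ) : ℂ) * f (dcd (j / 10)) (S3 (j % 10)) =
      ∑ a ∈ Finset.range 12, if ((((y / 6) >>> a) % 2 = 0 ∧ tb tabR 6 a (y % 6) ≠ 15) ∧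
        tp 10 (y / 6) a (tb tabR 6 a (y % 6)) = j) then
          (-1 : ℂ) ^ popc 12 ((y / 6) % 2 ^ a) * f (dcd (j / 10)) (S3 (j % 10)) else 0 := by
    intro j
    unfold cfR cf
    rw [Int.cast_sum, Finset.sum_mul]
    refine Finset.sum_congr rfl (fun a _ => ?_)
    split_ifs <;> simp
  rw [Finset.sum_congr rfl (fun j _ => e1 j), Finset.sum_comm, dK_apply]
  let F : ℕ → ℂ := fun a => if h : a < 12 then
    (if (⟨a, by omega⟩ : Fin 15) ∉ dcd (y / 6) ∧ vec ⟨a, by omega⟩ ≤ S7 (y % 6) then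
      sg (dcd (y / 6)) ⟨a, by omega⟩ * f (insert ⟨a, by omega⟩ (dcd (y / 6)))
        (S7 (y % 6) - vec ⟨a, by omega⟩) else 0) else 0
  have e2 : ∀ a : Fin 15, (if a ∉ dcd (y / 6) ∧ vec a ≤ S7 (y % 6) then
      sg (dcd (y / 6)) a * f (insert a (dcd (y / 6))) (S7 (y % 6) - vec a) else 0) = F a := by
    intro a
    simp only [F]
    by_cases h : (a : ℕ) < 12
    · rw [dif_pos h]
    · rw [dif_neg h, if_neg (fun hh => vec_not_le a h _ hn hh.2)]
  rw [Finset.sum_congr rfl (fun a _ => e2 a), Fin.sum_univ_eq_sum_range F 15]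
  have e3 : ∑ i ∈ Finset.range 15, F i = ∑ i ∈ Finset.range 12, F i := by
    rw [Finset.sum_range_succ, Finset.sum_range_succ, Finset.sum_range_succ]
    simp [F]
  rw [e3]
  refine Finset.sum_congr rfl (fun a ha => ?_)
  have ha : a < 12 := Finset.mem_range.1 ha
  obtain ⟨t1, t2⟩ := tab_vec ⟨a, by omega⟩ ha _ hn
  simp only [F]
  rw [dif_pos ha]
  have hbit : (((y / 6) >>> a) % 2 = 0) ↔ (⟨a, by omega⟩ : Fin 15) ∉ dcd (y / 6) := by
    rw [shr_mod_two, mem_dcd]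
    cases (y / 6).testBit a <;> simp
  by_cases hc : (⟨a, by omega⟩ : Fin 15) ∉ dcd (y / 6) ∧ vec ⟨a, by omega⟩ ≤ S7 (y % 6)
  · have h15 := t1.1 hc.2
    obtain ⟨h4, h5⟩ := tabR_ok a ha _ hn h15
    have hmem : tp 10 (y / 6) a (tb tabR 6 a (y % 6)) ∈ Xs 10 (p + 1) := by
      obtain ⟨g1, g2⟩ := (tp_eq_iff _ _ _ _ _ h4).1 rfl
      rw [mem_Xs _ _ _ (by norm_num), g1]
      refine ⟨flip_lt _ _ hy'.1 ha, ?_⟩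
      rw [popc_flip _ _ ha, hy'.2]
      have := hc.1
      rw [mem_dcd] at this
      simpa using this
    rw [if_pos hc, Finset.sum_eq_single (tp 10 (y / 6) a (tb tabR 6 a (y % 6)))]
    · rw [if_pos ⟨⟨hbit.2 hc.1, h15⟩, rfl⟩]
      obtain ⟨g1, g2⟩ := (tp_eq_iff _ _ _ _ _ h4).1 rfl
      rw [g1, g2, sg_dcd _ hy'.1, ← dcd_flip _ _ hc.1]
      have t2' := t2 hc.2
      simp only at t2'
      rw [t2']
    · intro b _ hb
      rw [if_neg (fun hh => hb hh.2.symm)]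
    · intro h; exact absurd hmem h
  · rw [if_neg hc]
    symm
    refine Finset.sum_eq_zero (fun j _ => ?_)
    rw [if_neg]
    rintro ⟨⟨h1, h2⟩, _⟩
    exact hc ⟨hbit.1 h1, t1.2 h2⟩

/-! ### Homology of the concrete model -/

instance finGG (p : ℕ) (e : ℤ) : FiniteDimensional ℂ (GG p e) := by
  let N := e.toNat + 1
  let r : GG p e →ₗ[ℂ] (Finset (Fin 15) → (Fin 3 → Fin N) → ℂ) :=
    { toFun := fun f A m => f.1 A (fun i => (m i : ℕ))
      map_add' := fun _ _ => rfl
      map_smul' := fun _ _ => rfl }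
  apply FiniteDimensional.of_injective r
  rw [← LinearMap.ker_eq_bot, LinearMap.ker_eq_bot']
  intro f hf
  apply Subtype.ext
  funext A m
  by_contra hne
  have h1 := (f.2 A m hne).2
  have h2 : ∀ i, m i < N := by
    intro i
    have h3 : (m i : ℤ) ≤ ∑ j, (m j : ℤ) :=
      Finset.single_le_sum (f := fun j => (m j : ℤ)) (fun j _ => Int.natCast_nonneg _)
        (Finset.mem_univ i)
    simp only [N]
    omega
  exact hne (congrFun (congrFun hf A) (fun i => ⟨m i, h2 i⟩))

/-- cycles -/
noncomputable def ZZ (p : ℕ) (e : ℤ) : Submodule ℂ KK := GG p e ⊓ LinearMap.ker dK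

/-- boundaries -/
noncomputable def BB (p : ℕ) (e : ℤ) : Submodule ℂ KK := (GG (p + 1) (e - 4)).map dK

theorem BB_le_ZZ (p : ℕ) (e : ℤ) : BB p e ≤ ZZ p e := by
  rintro _ ⟨f, hf, rfl⟩
  refine ⟨?_, dK_dK f⟩
  have := dK_mem hf
  rwa [sub_add_cancel] at this

instance finZZ (p : ℕ) (e : ℤ) : FiniteDimensional ℂ (ZZ p e) :=
  Submodule.finiteDimensional_of_le (inf_le_left : ZZ p e ≤ GG p e)

theorem finrank_map_ker {W : Type*} [AddCommGroup W] [Module ℂ W] (ρ : KK →ₗ[ℂ] W)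
    (Z : Submodule ℂ KK) [FiniteDimensional ℂ Z] :
    Module.finrank ℂ (Z.map ρ) + Module.finrank ℂ (Z ⊓ LinearMap.ker ρ : Submodule ℂ KK) =
      Module.finrank ℂ Z := by
  rw [← LinearMap.finrank_range_add_finrank_ker (ρ.domRestrict Z)]
  congr 1
  · rw [LinearMap.range_domRestrict]
  · rw [LinearMap.ker_domRestrict]
    rw [← Submodule.map_comap_subtype]
    exact Submodule.finrank_map_subtype_eq _ _

theorem dim_quot {W : Type*} [AddCommGroup W] [Module ℂ W] (ρ : KK →ₗ[ℂ] W)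
    (Z B : Submodule ℂ KK) [FiniteDimensional ℂ Z] (hB : B ≤ Z)
    (h : Z ⊓ LinearMap.ker ρ ≤ B) :
    Module.finrank ℂ Z - Module.finrank ℂ B =
      Module.finrank ℂ (Z.map ρ) - Module.finrank ℂ (B.map ρ) := by
  have : FiniteDimensional ℂ B := Submodule.finiteDimensional_of_le hB
  have e : Z ⊓ LinearMap.ker ρ = B ⊓ LinearMap.ker ρ :=
    le_antisymm (le_inf h inf_le_right) (inf_le_inf_right _ hB)
  have h1 := finrank_map_ker ρ Z
  have h2 := finrank_map_ker ρ B
  rw [e] at h1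
  omega

/-- dimension of the homology -/
noncomputable def HH (p : ℕ) (e : ℤ) : ℕ :=
  Module.finrank ℂ (ZZ p e) - Module.finrank ℂ (BB p e)

theorem ZZ_UU (p : ℕ) (e : ℤ) (f : KK) (hf : f ∈ ZZ p e) (hU : f ∈ UU Finset.univ) :
    f ∈ BB p e := by
  obtain ⟨w, _, hw, hd⟩ := acyclic_UU p (e - 4) Finset.univ f hU
    (by rw [sub_add_cancel]; exact hf.1) hf.2
  exact ⟨w, hw, hd⟩

/-- lifting approximate cycles -/
theorem lift_cycle (p : ℕ) (e : ℤ) (f : KK) (hf : f ∈ GG (p + 1) e)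
    (h : dK f ∈ UU Finset.univ) : ∃ g ∈ ZZ (p + 1) e, f - g ∈ UU Finset.univ := by
  obtain ⟨w, hwU, hw, hd⟩ := acyclic_UU p e Finset.univ (dK f) h (dK_mem hf) (dK_dK f)
  refine ⟨f - w, ⟨Submodule.sub_mem _ hf hw, ?_⟩, by simpa using hwU⟩
  rw [SetLike.mem_coe, LinearMap.mem_ker, map_sub, hd, sub_self]

theorem HH_rho {k p : ℕ} {e : ℤ} {S : ℕ → Fin 3 → ℕ} (hS : IsList k e S) :
    HH p e = Module.finrank ℂ ((ZZ p e).map (rho k p S)) -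
      Module.finrank ℂ ((BB p e).map (rho k p S)) := by
  apply dim_quot _ _ _ (BB_le_ZZ p e)
  rintro f ⟨hf, hf'⟩
  exact ZZ_UU p e f hf ((rho_eq_zero hS hf.1).1 hf')

theorem GG_neg (p : ℕ) (e : ℤ) (he : e < 0) : GG p e = ⊥ := by
  rw [eq_bot_iff]
  intro f hf
  rw [Submodule.mem_bot]
  funext A m
  by_contra hne
  have := (hf A m hne).2
  have h2 : 0 ≤ ∑ i, (m i : ℤ) := Finset.sum_nonneg (fun _ _ => Int.natCast_nonneg _)
  omega

theorem GG_big (p : ℕ) (e : ℤ) (he : 9 < e) : GG p e ≤ UU Finset.univ := by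
  intro f hf A m hr
  by_contra hne
  have := (hf A m hne).2
  have h0 := (hr 0 (Finset.mem_univ _)).2
  have h1 := (hr 1 (Finset.mem_univ _)).2
  have h2 := (hr 2 (Finset.mem_univ _)).2
  rw [Fin.sum_univ_three] at this
  omega

theorem HH_neg (p : ℕ) (e : ℤ) (he : e < 0) : HH p e = 0 := by
  have : ZZ p e = ⊥ := by
    rw [eq_bot_iff, ← GG_neg p e he]; exact inf_le_left
  unfold HH
  rw [this]
  simp

theorem HH_big (p : ℕ) (e : ℤ) (he : 9 < e) : HH p e = 0 := by
  have : ZZ p e = BB p e :=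
    le_antisymm (fun f hf => ZZ_UU p e f hf (GG_big p e he hf.1)) (BB_le_ZZ p e)
  unfold HH
  rw [this, Nat.sub_self]

theorem HH_zero_three : HH 0 3 = (Xs 10 0).card := by
  rw [HH_rho isList3]
  have h1 : (ZZ 0 3).map (rho 10 0 S3) = ⊤ := by
    rw [eq_top_iff]
    intro w _
    obtain ⟨f, hf, rfl⟩ := rho_surj (p := 0) isList3 w
    exact ⟨f, ⟨hf, dK_zero hf⟩, rfl⟩
  have h2 : BB 0 3 = ⊥ := by
    unfold BB; rw [GG_neg _ _ (by norm_num)]; simp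
  rw [h1, h2, Submodule.map_bot]
  simp

theorem HH_succ_three (p : ℕ) : HH (p + 1) 3 = (Xs 10 (p + 1)).card - (Mat p).rank := by
  rw [HH_rho isList3]
  have h1 : (ZZ (p + 1) 3).map (rho 10 (p + 1) S3) = LinearMap.ker (Mat p).mulVecLin := by
    apply le_antisymm
    · rintro _ ⟨f, hf, rfl⟩
      rw [LinearMap.mem_ker, ← rho_dK, LinearMap.mem_ker.1 hf.2, map_zero]
    · intro w hw
      obtain ⟨f, hf, rfl⟩ := rho_surj isList3 w
      rw [LinearMap.mem_ker, ← rho_dK, rho_eq_zero isList7 (dK_mem hf)] at hw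
      obtain ⟨g, hg, hU⟩ := lift_cycle p 3 f hf hw
      refine ⟨g, hg, ?_⟩
      have := (rho_eq_zero isList3 (Submodule.sub_mem _ hf hg.1)).2 hU
      rw [map_sub, sub_eq_zero] at this
      exact this.symm
  have h2 : BB (p + 1) 3 = ⊥ := by
    unfold BB; rw [GG_neg _ _ (by norm_num)]; simp
  rw [h1, h2, Submodule.map_bot]
  have := LinearMap.finrank_range_add_finrank_ker (Mat p).mulVecLin
  rw [Module.finrank_fintype_fun_eq_card, Fintype.card_coe] at this
  unfold Matrix.rank
  simp only [finrank_bot]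
  omega

theorem HH_seven (p : ℕ) : HH p 7 = (Xs 6 p).card - (Mat p).rank := by
  rw [HH_rho isList7]
  have h1 : (ZZ p 7).map (rho 6 p S7) = ⊤ := by
    rw [eq_top_iff]
    intro w _
    obtain ⟨f, hf, rfl⟩ := rho_surj isList7 w
    cases p with
    | zero => exact ⟨f, ⟨hf, dK_zero hf⟩, rfl⟩
    | succ p =>
      obtain ⟨g, hg, hU⟩ := lift_cycle p 7 f hf (GG_big p _ (by norm_num) (dK_mem hf))
      refine ⟨g, hg, ?_⟩
      have := (rho_eq_zero isList7 (Submodule.sub_mem _ hf hg.1)).2 hU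
      rw [map_sub, sub_eq_zero] at this
      exact this.symm
  have h2 : (BB p 7).map (rho 6 p S7) = LinearMap.range (Mat p).mulVecLin := by
    apply le_antisymm
    · rintro _ ⟨_, ⟨f, hf, rfl⟩, rfl⟩
      rw [rho_dK]
      exact LinearMap.mem_range_self _ _
    · rintro _ ⟨w, rfl⟩
      obtain ⟨f, hf, rfl⟩ := rho_surj (p := p + 1) isList3 w
      rw [← rho_dK]
      exact ⟨_, ⟨f, by norm_num; exact hf, rfl⟩, rfl⟩
  rw [h1, h2, finrank_top, Module.finrank_fintype_fun_eq_card, Fintype.card_coe]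
  rfl

/-! ### Comparison of the concrete model with the Koszul complex -/

/-- exponent vectors as finitely supported functions -/
noncomputable def fsm (m : Fin 3 → ℕ) : Fin 3 →₀ ℕ := Finsupp.equivFunOnFinite.symm m

theorem fsm_inj {m n : Fin 3 → ℕ} (h : fsm m = fsm n) : m = n :=
  Finsupp.equivFunOnFinite.symm.injective h

theorem fsm_add (m n : Fin 3 → ℕ) : fsm m + fsm n = fsm (m + n) := by
  ext i; simp [fsm]

theorem fsm_coe (σ : Fin 3 →₀ ℕ) : fsm (fun i => σ i) = σ := by
  ext i; simp [fsm]

theorem monomial_mem_Sdeg {e : ℤ} {m : Fin 3 → ℕ} (h : ∑ i, (m i : ℤ) = e) :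
    MvPolynomial.monomial (fsm m) (1 : ℂ) ∈ Sdeg 3 e := by
  have h0 : 0 ≤ e := by rw [← h]; exact Finset.sum_nonneg (fun i _ => Int.natCast_nonneg _)
  rw [Sdeg, if_pos h0, MvPolynomial.mem_homogeneousSubmodule]
  apply MvPolynomial.isHomogeneous_monomial
  rw [Finsupp.degree_eq_sum]
  have : ∑ i, m i = e.toNat := by
    have : ((∑ i, m i : ℕ) : ℤ) = e := by push_cast; exact h
    omega
  simpa [fsm] using this

theorem coeff_Sdeg {e : ℤ} {f : PolyC 3} (hf : f ∈ Sdeg 3 e) {m : Fin 3 → ℕ}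
    (h : MvPolynomial.coeff (fsm m) f ≠ 0) : ∑ i, (m i : ℤ) = e := by
  by_cases h0 : 0 ≤ e
  · rw [Sdeg, if_pos h0, MvPolynomial.mem_homogeneousSubmodule] at hf
    have h1 := hf h
    rw [Pi.one_def, ← Finsupp.degree_eq_weight_one, Finsupp.degree_eq_sum] at h1
    have h2 : ∑ i, m i = e.toNat := by simpa [fsm] using h1
    have : ((∑ i, m i : ℕ) : ℤ) = e := by omega
    rw [← this]; push_cast; rfl
  · rw [Sdeg, if_neg h0, Submodule.mem_bot] at hf
    exact absurd (by rw [hf]; simp) h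

/-- monomial basis of the graded piece -/
noncomputable def monB {ι : Type} (e : ℤ) (v : ι → Fin 3 → ℕ) (hi : Function.Injective v)
    (hv : ∀ i, ∑ j, (v i j : ℤ) = e) (hs : ∀ m : Fin 3 → ℕ, ∑ j, (m j : ℤ) = e → ∃ i, v i = m) :
    Module.Basis ι ℂ (Sdeg 3 e) :=
  Module.Basis.mk (v := fun i => (⟨_, monomial_mem_Sdeg (hv i)⟩ : Sdeg 3 e))
    (by
      apply LinearIndependent.of_comp (Sdeg 3 e).subtype
      have h := (MvPolynomial.basisMonomials (Fin 3) ℂ).linearIndependent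
      have h2 := h.comp (fun i => fsm (v i)) (fun i j hij => hi (fsm_inj hij))
      have h3 : ((Sdeg 3 e).subtype ∘ fun i => (⟨_, monomial_mem_Sdeg (hv i)⟩ : Sdeg 3 e)) =
          (MvPolynomial.basisMonomials (Fin 3) ℂ) ∘ fun i => fsm (v i) := by
        funext i
        simp
      rw [h3]
      exact h2)
    (by
      rintro ⟨f, hf⟩ -
      have key : f ∈ Submodule.span ℂ (Set.range
          (fun i => MvPolynomial.monomial (fsm (v i)) (1 : ℂ))) := by
        rw [f.as_sum]
        apply Submodule.sum_mem
        intro σ hσ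
        have h1 : MvPolynomial.coeff (fsm (fun i => σ i)) f ≠ 0 := by
          rw [fsm_coe]; exact MvPolynomial.mem_support_iff.1 hσ
        obtain ⟨i, h2⟩ := hs _ (coeff_Sdeg hf h1)
        have h3 : MvPolynomial.monomial σ (MvPolynomial.coeff σ f) =
            MvPolynomial.coeff σ f • MvPolynomial.monomial (fsm (v i)) (1 : ℂ) := by
          rw [h2, fsm_coe, MvPolynomial.smul_monomial, smul_eq_mul, mul_one]
        rw [h3]
        exact Submodule.smul_mem _ _ (Submodule.subset_span ⟨i, rfl⟩)
      have key2 : Set.range (fun i => MvPolynomial.monomial (fsm (v i)) (1 : ℂ)) =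
          Set.image (Sdeg 3 e).subtype (Set.range
            (fun i => (⟨_, monomial_mem_Sdeg (hv i)⟩ : Sdeg 3 e))) := by
        rw [← Set.range_comp]; rfl
      rw [key2, ← Submodule.map_span] at key
      obtain ⟨g, hg, hgf⟩ := key
      have : g = ⟨f, hf⟩ := Subtype.ext hgf
      rwa [← this])

theorem monB_coe {ι : Type} (e : ℤ) (v : ι → Fin 3 → ℕ) (hi : Function.Injective v)
    (hv : ∀ i, ∑ j, (v i j : ℤ) = e) (hs : ∀ m : Fin 3 → ℕ, ∑ j, (m j : ℤ) = e → ∃ i, v i = m)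
    (i : ι) : (monB e v hi hv hs i : PolyC 3) = MvPolynomial.monomial (fsm (v i)) 1 := by
  rw [monB, Module.Basis.mk_apply]

theorem vec_inj : Function.Injective vec := by
  intro a b; revert a b; decide

theorem vec_surj (m : Fin 3 → ℕ) (h : ∑ j, (m j : ℤ) = 4) : ∃ i, vec i = m := by
  have key : ∀ a b c : Fin 5, a.1 + b.1 + c.1 = 4 → ∃ i, vec i 0 = a.1 ∧ vec i 1 = b.1 ∧
      vec i 2 = c.1 := by decide
  rw [Fin.sum_univ_three] at h
  obtain ⟨i, h1, h2, h3⟩ := key ⟨m 0, by omega⟩ ⟨m 1, by omega⟩ ⟨m 2, by omega⟩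
    (by simp only; omega)
  refine ⟨i, ?_⟩
  funext j
  fin_cases j
  · exact h1
  · exact h2
  · exact h3

/-- basis of quartics -/
noncomputable def bq : Module.Basis (Fin 15) ℂ (Sdeg 3 4) := monB 4 vec vec_inj vec_sum vec_surj

theorem bq_coe (a : Fin 15) : (bq a : PolyC 3) = MvPolynomial.monomial (fsm (vec a)) 1 :=
  monB_coe _ _ _ _ _ a

/-- exponent vectors of degree `e` -/
abbrev Mo (e : ℤ) : Type := {m : Fin 3 → ℕ // ∑ j, (m j : ℤ) = e}

instance finMo (e : ℤ) : Finite (Mo e) := by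
  let N := e.toNat + 1
  have hb : ∀ m : Mo e, ∀ i, m.1 i < N := by
    intro m i
    have h3 : (m.1 i : ℤ) ≤ ∑ j, (m.1 j : ℤ) :=
      Finset.single_le_sum (f := fun j => (m.1 j : ℤ)) (fun j _ => Int.natCast_nonneg _)
        (Finset.mem_univ i)
    have := m.2
    simp only [N]
    omega
  apply Finite.of_injective (fun m : Mo e => fun i => (⟨m.1 i, hb m i⟩ : Fin N))
  intro m n h
  apply Subtype.ext
  funext i
  exact congrArg Fin.val (congrFun h i)

noncomputable instance ftMo (e : ℤ) : Fintype (Mo e) := Fintype.ofFinite _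

/-- basis of degree `e` forms -/
noncomputable def be (e : ℤ) : Module.Basis (Mo e) ℂ (Sdeg 3 e) :=
  monB e (fun m => m.1) Subtype.val_injective (fun m => m.2) (fun m h => ⟨⟨m, h⟩, rfl⟩)

theorem be_coe (e : ℤ) (m : Mo e) : (be e m : PolyC 3) = MvPolynomial.monomial (fsm m.1) 1 :=
  monB_coe _ _ _ _ _ m

theorem be_repr (e : ℤ) (f : Sdeg 3 e) (m : Mo e) :
    (be e).repr f m = MvPolynomial.coeff (fsm m.1) (f : PolyC 3) := by
  have : ((be e).coord m) = (MvPolynomial.lcoeff ℂ (fsm m.1)).comp (Sdeg 3 e).subtype := by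
    apply (be e).ext
    intro n
    classical
    simp only [Module.Basis.coord_apply, Module.Basis.repr_self, LinearMap.comp_apply,
      Submodule.subtype_apply, MvPolynomial.lcoeff_apply, be_coe, MvPolynomial.coeff_monomial,
      Finsupp.single_apply]
    by_cases h : n = m
    · simp [h]
    · rw [if_neg h, if_neg]
      intro h2
      exact h (Subtype.ext (fsm_inj h2))
  exact LinearMap.congr_fun this f

/-- basis of the exterior power -/
noncomputable def bw (p : ℕ) : Module.Basis (Set.powersetCard (Fin 15) p) ℂ (⋀[ℂ]^p (Sdeg 3 4)) :=
  bq.exteriorPower p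

/-- coordinate on the exterior power -/
noncomputable def lamA (p : ℕ) (A : Finset (Fin 15)) : (⋀[ℂ]^p (Sdeg 3 4)) →ₗ[ℂ] ℂ :=
  if h : A.card = p then (bw p).coord ⟨A, h⟩ else 0

/-- comparison map -/
noncomputable def Psi (p : ℕ) : (⋀[ℂ]^p (Sdeg 3 4)) ⊗[ℂ] (PolyC 3) →ₗ[ℂ] KK :=
  LinearMap.pi (fun A => LinearMap.pi (fun m =>
    (TensorProduct.lid ℂ ℂ).toLinearMap.comp
      (TensorProduct.map (lamA p A) (MvPolynomial.lcoeff ℂ (fsm m)))))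

theorem Psi_tmul (p : ℕ) (w : ⋀[ℂ]^p (Sdeg 3 4)) (f : PolyC 3) (A : Finset (Fin 15))
    (m : Fin 3 → ℕ) : Psi p (w ⊗ₜ f) A m = lamA p A w * MvPolynomial.coeff (fsm m) f := by
  simp [Psi]

/-- comparison map on graded pieces -/
noncomputable def Phi (p : ℕ) (e : ℤ) : KosModule 3 4 p e →ₗ[ℂ] KK :=
  (Psi p).comp (TensorProduct.map LinearMap.id (Sdeg 3 e).subtype)

theorem Phi_tmul (p : ℕ) (e : ℤ) (w : ⋀[ℂ]^p (Sdeg 3 4)) (f : Sdeg 3 e) (A : Finset (Fin 15))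
    (m : Fin 3 → ℕ) :
    Phi p e (w ⊗ₜ f) A m = lamA p A w * MvPolynomial.coeff (fsm m) (f : PolyC 3) := by
  rw [Phi, LinearMap.comp_apply, TensorProduct.map_tmul, Psi_tmul]; rfl

/-- basis of the Koszul module -/
noncomputable def bK (p : ℕ) (e : ℤ) :
    Module.Basis (Set.powersetCard (Fin 15) p × Mo e) ℂ (KosModule 3 4 p e) :=
  (bw p).tensorProduct (be e)

theorem Phi_repr (p : ℕ) (e : ℤ) (x : KosModule 3 4 p e) (s : Set.powersetCard (Fin 15) p)
    (m : Mo e) : Phi p e x s.1 m.1 = (bK p e).repr x (s, m) := by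
  induction x using TensorProduct.induction_on with
  | zero => simp
  | tmul w f =>
    rw [Phi_tmul, bK, Module.Basis.tensorProduct_repr_tmul_apply, be_repr]
    have hs : s.1.card = p := s.2
    rw [lamA, dif_pos hs]
    simp [Module.Basis.coord_apply, mul_comm]
  | add x y hx hy => 
    rw [map_add, map_add, Finsupp.add_apply, ← hx, ← hy]; rfl

theorem Phi_mem (p : ℕ) (e : ℤ) (x : KosModule 3 4 p e) : Phi p e x ∈ GG p e := by
  induction x using TensorProduct.induction_on with
  | zero => rw [map_zero]; exact Submodule.zero_mem _
  | tmul w f =>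
    intro A m h
    rw [Phi_tmul] at h
    refine ⟨?_, coeff_Sdeg f.2 (right_ne_zero_of_mul h)⟩
    by_contra hA
    apply left_ne_zero_of_mul h
    rw [lamA, dif_neg hA]; rfl
  | add x y hx hy => rw [map_add]; exact Submodule.add_mem _ hx hy

theorem Phi_inj (p : ℕ) (e : ℤ) : Function.Injective (Phi p e) := by
  intro x y h
  apply (bK p e).repr.injective
  ext ⟨s, m⟩
  rw [← Phi_repr, ← Phi_repr, h]

theorem Phi_range (p : ℕ) (e : ℤ) : LinearMap.range (Phi p e) = GG p e := by
  apply le_antisymm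
  · rintro _ ⟨x, rfl⟩
    exact Phi_mem p e x
  · intro f hf
    let g : (Set.powersetCard (Fin 15) p × Mo e) →₀ ℂ :=
      Finsupp.equivFunOnFinite.symm (fun sm => f sm.1.1 sm.2.1)
    refine ⟨(bK p e).repr.symm g, ?_⟩
    funext A m
    by_cases h : A.card = p ∧ ∑ i, (m i : ℤ) = e
    · have := Phi_repr p e ((bK p e).repr.symm g) ⟨A, h.1⟩ ⟨m, h.2⟩
      simp only [LinearEquiv.apply_symm_apply] at this
      exact this
    · have h1 : f A m = 0 := by
        by_contra h2; exact h (hf A m h2)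
      have h3 : Phi p e ((bK p e).repr.symm g) A m = 0 := by
        by_contra h2; exact h (Phi_mem p e _ A m h2)
      rw [h1, h3]

theorem wedge_basis (p : ℕ) (s : Finset (Fin 15)) (hs : s.card = p) :
    wedgeE ℂ (Sdeg 3 4) p (fun i => bq (s.orderEmbOfFin hs i)) = bw p ⟨s, hs⟩ := by
  rw [bw, exteriorPower.basis_apply]
  rfl

theorem lamA_wedge (p : ℕ) (A s : Finset (Fin 15)) (hs : s.card = p) :
    lamA p A (wedgeE ℂ (Sdeg 3 4) p (fun i => bq (s.orderEmbOfFin hs i))) =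
      if A = s then 1 else 0 := by
  rw [wedge_basis, lamA]
  by_cases h : A = s
  · subst h
    rw [dif_pos hs, if_pos rfl]
    simp
  · rw [if_neg h]
    split_ifs with h1
    · rw [Module.Basis.coord_apply, Module.Basis.repr_self, Finsupp.single_apply, if_neg]
      intro h2
      exact h (congrArg Subtype.val h2).symm
    · rfl

theorem Psi_wedge (p : ℕ) (s : Finset (Fin 15)) (hs : s.card = p) (m : Fin 3 → ℕ)
    (B : Finset (Fin 15)) (n : Fin 3 → ℕ) :
    Psi p (wedgeE ℂ (Sdeg 3 4) p (fun i => bq (s.orderEmbOfFin hs i)) ⊗ₜ[ℂ]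
      MvPolynomial.monomial (fsm m) 1) B n = if B = s ∧ n = m then 1 else 0 := by
  classical
  rw [Psi_tmul, lamA_wedge, MvPolynomial.coeff_monomial]
  by_cases h1 : B = s <;> by_cases h2 : n = m
  · simp [h1, h2]
  · have : ¬ fsm m = fsm n := fun h => h2 (fsm_inj h).symm
    simp [h2, this]
  · simp [h1]
  · simp [h1]

theorem card_filter_lt (p : ℕ) (s : Finset (Fin 15)) (hs : s.card = p + 1) (k : Fin (p + 1)) :
    ((s.erase (s.orderEmbOfFin hs k)).filter (fun b => b < s.orderEmbOfFin hs k)).card = k := by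
  have : (s.erase (s.orderEmbOfFin hs k)).filter (fun b => b < s.orderEmbOfFin hs k) =
      (Finset.Iio k).map (s.orderEmbOfFin hs).toEmbedding := by
    ext b
    simp only [Finset.mem_filter, Finset.mem_erase, Finset.mem_map, Finset.mem_Iio]
    constructor
    · rintro ⟨⟨h1, h2⟩, h3⟩
      rw [← Finset.image_orderEmbOfFin_univ s hs] at h2
      obtain ⟨j, -, rfl⟩ := Finset.mem_image.1 h2
      exact ⟨j, (s.orderEmbOfFin hs).lt_iff_lt.1 h3, rfl⟩
    · rintro ⟨j, h1, rfl⟩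
      have := (s.orderEmbOfFin hs).lt_iff_lt.2 h1
      exact ⟨⟨ne_of_lt this, Finset.orderEmbOfFin_mem _ _ _⟩, this⟩
  rw [this, Finset.card_map, Fin.card_Iio]

theorem erase_emb (p : ℕ) (s : Finset (Fin 15)) (hs : s.card = p + 1) (k : Fin (p + 1))
    (h : (s.erase (s.orderEmbOfFin hs k)).card = p) (i : Fin p) :
    s.orderEmbOfFin hs (k.succAbove i) = (s.erase (s.orderEmbOfFin hs k)).orderEmbOfFin h i := by
  have := Finset.orderEmbOfFin_unique h (f := fun i => s.orderEmbOfFin hs (k.succAbove i))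
    (fun i => Finset.mem_erase.2 ⟨fun hh => Fin.succAbove_ne k i
      ((s.orderEmbOfFin hs).injective hh), Finset.orderEmbOfFin_mem _ _ _⟩)
    (fun i j hij => (s.orderEmbOfFin hs).lt_iff_lt.2 ((Fin.strictMono_succAbove k) hij))
  exact congrFun this i

theorem dK_basis (p : ℕ) (s : Finset (Fin 15)) (hs : s.card = p + 1) (m : Fin 3 → ℕ) (f : KK)
    (hf : ∀ A n, f A n = if A = s ∧ n = m then 1 else 0) (B : Finset (Fin 15)) (n : Fin 3 → ℕ) :
    dK f B n = ∑ k : Fin (p + 1), (-1 : ℂ) ^ (k : ℕ) *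
      (if B = s.erase (s.orderEmbOfFin hs k) ∧ n = vec (s.orderEmbOfFin hs k) + m
        then 1 else 0) := by
  rw [dK_apply]
  have h1 : ∑ a : Fin 15, (if a ∉ B ∧ vec a ≤ n then sg B a * f (insert a B) (n - vec a) else 0) =
      ∑ a ∈ s, (if a ∉ B ∧ vec a ≤ n then sg B a * f (insert a B) (n - vec a) else 0) := by
    symm
    apply Finset.sum_subset (Finset.subset_univ _)
    intro a _ ha
    split_ifs with h
    · rw [hf, if_neg, mul_zero]
      rintro ⟨h2, -⟩
      exact ha (h2 ▸ Finset.mem_insert_self a B)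
    · rfl
  rw [h1]
  conv_lhs => rw [← Finset.map_orderEmbOfFin_univ s hs]
  rw [Finset.sum_map]
  refine Finset.sum_congr rfl (fun k _ => ?_)
  have hk : (s.orderEmbOfFin hs).toEmbedding k = s.orderEmbOfFin hs k := rfl
  rw [hk]
  have hc := card_filter_lt p s hs k
  have hm : s.orderEmbOfFin hs k ∈ s := Finset.orderEmbOfFin_mem _ _ _
  generalize s.orderEmbOfFin hs k = a at hc hm
  by_cases h : B = s.erase a ∧ n = vec a + m
  · rw [if_pos h, h.1, h.2, if_pos ⟨Finset.notMem_erase _ _, le_self_add⟩, hf,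
      if_pos ⟨Finset.insert_erase hm, add_tsub_cancel_left _ _⟩, sg, hc]
  · rw [if_neg h, mul_zero]
    split_ifs with h2
    · rw [hf, if_neg, mul_zero]
      rintro ⟨h3, h4⟩
      apply h
      refine ⟨?_, ?_⟩
      · rw [← h3, Finset.erase_insert h2.1]
      · rw [← h4, add_tsub_cancel_of_le h2.2]
    · rfl

theorem Phi_D (p : ℕ) (e e' : ℤ) (D : KosModule 3 4 (p + 1) e →ₗ[ℂ] KosModule 3 4 p e')
    (hD : IsKoszulDiff 3 4 e e' p D) (x : KosModule 3 4 (p + 1) e) :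
    Phi p e' (D x) = - dK (Phi (p + 1) e x) := by
  have key : (Phi p e').comp D = - dK.comp (Phi (p + 1) e) := by
    apply (bK (p + 1) e).ext
    rintro ⟨⟨s, hs⟩, m⟩
    have hs' : s.card = p + 1 := hs
    rw [bK, Module.Basis.tensorProduct_apply, ← wedge_basis (p + 1) s hs', LinearMap.comp_apply,
      LinearMap.neg_apply, LinearMap.comp_apply]
    have h1 := hD (fun i => bq (s.orderEmbOfFin hs' i)) (be e m)
    rw [Phi, LinearMap.comp_apply, h1, map_sum]
    funext B n
    have h2 : ∀ A n, Phi (p + 1) e (wedgeE ℂ (Sdeg 3 4) (p + 1)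
        (fun i => bq (s.orderEmbOfFin hs' i)) ⊗ₜ[ℂ] be e m) A n =
        if A = s ∧ n = m.1 then 1 else 0 := by
      intro A n
      rw [Phi, LinearMap.comp_apply, TensorProduct.map_tmul, LinearMap.id_apply,
        Submodule.subtype_apply, be_coe, Psi_wedge]
    rw [Pi.neg_apply, Pi.neg_apply, dK_basis p s hs' m.1 _ h2, Finset.sum_apply,
      Finset.sum_apply, ← Finset.sum_neg_distrib]
    refine Finset.sum_congr rfl (fun k _ => ?_)
    have hc : (s.erase (s.orderEmbOfFin hs' k)).card = p := by
      rw [Finset.card_erase_of_mem (Finset.orderEmbOfFin_mem _ _ _), hs']; rfl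
    simp only [erase_emb p s hs' k hc]
    rw [bq_coe, be_coe, MvPolynomial.monomial_mul, fsm_add, mul_one, map_smul, Pi.smul_apply,
      Pi.smul_apply, Psi_wedge, smul_eq_mul, pow_succ]
    ring
  exact LinearMap.congr_fun key x

theorem finrank_map_Phi (p : ℕ) (e : ℤ) (U : Submodule ℂ (KosModule 3 4 p e)) :
    Module.finrank ℂ U = Module.finrank ℂ (U.map (Phi p e)) :=
  LinearEquiv.finrank_eq (Submodule.equivMapOfInjective _ (Phi_inj p e) U)

theorem map_range_D (p : ℕ) (e e' : ℤ) (he : e' = e + 4)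
    (D : KosModule 3 4 (p + 1) e →ₗ[ℂ] KosModule 3 4 p e')
    (hD : IsKoszulDiff 3 4 e e' p D) : (LinearMap.range D).map (Phi p e') = BB p e' := by
  have h4 : e' - 4 = e := by omega
  rw [BB, h4, ← Phi_range]
  apply le_antisymm
  · rintro _ ⟨_, ⟨x, rfl⟩, rfl⟩
    rw [Phi_D p e e' D hD]
    exact ⟨Phi (p + 1) e ((-1 : ℂ) • x), ⟨_, rfl⟩, by
      rw [LinearMap.map_smul, LinearMap.map_smul, neg_one_smul]⟩
  · rintro _ ⟨_, ⟨x, rfl⟩, rfl⟩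
    refine ⟨D ((-1 : ℂ) • x), ⟨_, rfl⟩, ?_⟩
    rw [Phi_D p e e' D hD, LinearMap.map_smul, LinearMap.map_smul, neg_one_smul, neg_neg]

theorem map_ker_D (p : ℕ) (e e' : ℤ)
    (D : KosModule 3 4 (p + 1) e →ₗ[ℂ] KosModule 3 4 p e')
    (hD : IsKoszulDiff 3 4 e e' p D) :
    (LinearMap.ker D).map (Phi (p + 1) e) = ZZ (p + 1) e := by
  rw [ZZ, ← Phi_range]
  apply le_antisymm
  · rintro _ ⟨x, hx, rfl⟩
    refine ⟨⟨x, rfl⟩, ?_⟩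
    have h := Phi_D p e e' D hD x
    have hx' : D x = 0 := hx
    rw [hx', map_zero] at h
    exact neg_eq_zero.1 h.symm
  · rintro _ ⟨⟨x, rfl⟩, hx⟩
    refine ⟨x, ?_, rfl⟩
    have h := Phi_D p e e' D hD x
    have hx' : dK (Phi (p + 1) e x) = 0 := hx
    rw [hx', neg_zero] at h
    exact Phi_inj p e' (by rw [h, map_zero])

theorem range_le_ker_D (p : ℕ) (e e' e'' : ℤ)
    (D : KosModule 3 4 (p + 1 + 1) e →ₗ[ℂ] KosModule 3 4 (p + 1) e')
    (D' : KosModule 3 4 (p + 1) e' →ₗ[ℂ] KosModule 3 4 p e'')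
    (hD : IsKoszulDiff 3 4 e e' (p + 1) D) (hD' : IsKoszulDiff 3 4 e' e'' p D') :
    LinearMap.range D ≤ LinearMap.ker D' := by
  rintro _ ⟨x, rfl⟩
  apply Phi_inj p e''
  rw [Phi_D p e' e'' D' hD', Phi_D (p + 1) e e' D hD, map_neg, dK_dK, map_zero, neg_zero, neg_zero]

theorem Kdim_eq_HH (D : KFam 3 4) (hD : IsKoszulFam 3 4 D) (p : ℕ) (q : ℤ) :
    Kdim 3 4 D 3 p q = HH p (3 + q * 4) := by
  have e1 : 3 + q * 4 = 3 + (q - 1) * 4 + 4 := by ring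
  have e2 : 3 + (q + 1) * 4 = 3 + q * 4 + 4 := by ring
  cases p with
  | zero =>
    have h1 := map_range_D 0 _ _ e1 _ (hD 0 _ _ e1)
    have h2 := finrank_map_Phi 0 _ (LinearMap.range (D 0 (3 + (q - 1) * 4) (3 + q * 4)))
    rw [h1] at h2
    have hZ : ZZ 0 (3 + q * 4) = GG 0 (3 + q * 4) := by
      rw [ZZ]; exact inf_eq_left.2 (fun f hf => dK_zero hf)
    have h3 : Module.finrank ℂ (KosModule 3 4 0 (3 + q * 4)) =
        Module.finrank ℂ (ZZ 0 (3 + q * 4)) := by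
      rw [hZ, ← Phi_range]
      exact LinearEquiv.finrank_eq (LinearEquiv.ofInjective _ (Phi_inj 0 _))
    exact congrArg₂ (fun a b : ℕ => a - b) h3 h2
  | succ p =>
    have hle := range_le_ker_D p _ _ _ _ _ (hD (p + 1) _ _ e1) (hD p _ _ e2)
    have h1 := map_range_D (p + 1) _ _ e1 _ (hD (p + 1) _ _ e1)
    have h2 := finrank_map_Phi (p + 1) _
      (LinearMap.range (D (p + 1) (3 + (q - 1) * 4) (3 + q * 4)))
    rw [h1, ← inf_eq_left.2 hle] at h2
    have h3 := finrank_map_Phi (p + 1) _ (LinearMap.ker (D p (3 + q * 4) (3 + (q + 1) * 4)))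
    rw [map_ker_D p _ _ _ (hD p _ _ e2)] at h3
    exact congrArg₂ (fun a b : ℕ => a - b) h3 h2

/-! ### Conclusion -/

theorem rank_val_0 : (Mat 0).rank = 6 := by
  have h1 := rank_Mat_ge 0 6 chk_rank_0
  have h2 := rank_Mat_le 0
  rw [card_Xs 6 0 (by norm_num), card_Xs 10 (0 + 1) (by norm_num)] at h2
  have h3 := cntP_val
  norm_num at h2 h3
  omega

theorem rank_val_1 : (Mat 1).rank = 72 := by
  have h1 := rank_Mat_ge 1 72 chk_rank_1
  have h2 := rank_Mat_le 1
  rw [card_Xs 6 1 (by norm_num), card_Xs 10 (1 + 1) (by norm_num)] at h2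
  have h3 := cntP_val
  norm_num at h2 h3
  omega

theorem rank_val_2 : (Mat 2).rank = 396 := by
  have h1 := rank_Mat_ge 2 396 chk_rank_2
  have h2 := rank_Mat_le 2
  rw [card_Xs 6 2 (by norm_num), card_Xs 10 (2 + 1) (by norm_num)] at h2
  have h3 := cntP_val
  norm_num at h2 h3
  omega

theorem rank_val_3 : (Mat 3).rank = 1320 := by
  have h1 := rank_Mat_ge 3 1320 chk_rank_3
  have h2 := rank_Mat_le 3
  rw [card_Xs 6 3 (by norm_num), card_Xs 10 (3 + 1) (by norm_num)] at h2
  have h3 := cntP_val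
  norm_num at h2 h3
  omega

theorem rank_val_4 : (Mat 4).rank = 2970 := by
  have h1 := rank_Mat_ge 4 2970 chk_rank_4
  have h2 := rank_Mat_le 4
  rw [card_Xs 6 4 (by norm_num), card_Xs 10 (4 + 1) (by norm_num)] at h2
  have h3 := cntP_val
  norm_num at h2 h3
  omega

theorem rank_val_5 : (Mat 5).rank = 4752 := by
  have h1 := rank_Mat_ge 5 4752 chk_rank_5
  have h2 := rank_Mat_le 5
  rw [card_Xs 6 5 (by norm_num), card_Xs 10 (5 + 1) (by norm_num)] at h2
  have h3 := cntP_val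
  norm_num at h2 h3
  omega

theorem rank_val_6 : (Mat 6).rank = 5544 := by
  have h1 := rank_Mat_ge 6 5544 chk_rank_6
  have h2 := rank_Mat_le 6
  rw [card_Xs 6 6 (by norm_num), card_Xs 10 (6 + 1) (by norm_num)] at h2
  have h3 := cntP_val
  norm_num at h2 h3
  omega

theorem rank_val_7 : (Mat 7).rank = 4500 := by
  have h1 := rank_Mat_ge 7 4500 chk_rank_7
  have h2 := rank_Mat_le_of_kerT 7 252 (kerT_Mat_ge 7 252 datR chk_kerT_7)
  rw [card_Xs 6 7 (by norm_num)] at h2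
  have h3 := cntP_val
  norm_num at h2 h3
  omega

theorem rank_val_8 : (Mat 8).rank = 2145 := by
  have h1 := rank_Mat_ge 8 2145 chk_rank_8
  have h2 := rank_Mat_le_of_ker 8 55 (ker_Mat_ge 8 55 datC chk_ker_8)
  rw [card_Xs 10 (8 + 1) (by norm_num)] at h2
  have h3 := cntP_val
  norm_num at h2 h3
  omega

theorem rank_val_9 : (Mat 9).rank = 660 := by
  have h1 := rank_Mat_ge 9 660 chk_rank_9
  have h2 := rank_Mat_le 9
  rw [card_Xs 6 9 (by norm_num), card_Xs 10 (9 + 1) (by norm_num)] at h2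
  have h3 := cntP_val
  norm_num at h2 h3
  omega

theorem rank_val_10 : (Mat 10).rank = 120 := by
  have h1 := rank_Mat_ge 10 120 chk_rank_10
  have h2 := rank_Mat_le 10
  rw [card_Xs 6 10 (by norm_num), card_Xs 10 (10 + 1) (by norm_num)] at h2
  have h3 := cntP_val
  norm_num at h2 h3
  omega

theorem rank_val_11 : (Mat 11).rank = 10 := by
  have h1 := rank_Mat_ge 11 10 chk_rank_11
  have h2 := rank_Mat_le 11
  rw [card_Xs 6 11 (by norm_num), card_Xs 10 (11 + 1) (by norm_num)] at h2
  have h3 := cntP_val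
  norm_num at h2 h3
  omega

theorem rank_val_big (p : ℕ) (hp : 12 ≤ p) : (Mat p).rank = 0 := by
  have h2 := (rank_Mat_le p).2
  rw [card_Xs 10 (p + 1) (by norm_num), cntP_zero (p + 1) (by omega)] at h2
  omega

theorem H3 (p : ℕ) : HH p 3 = [10, 114, 588, 1804, 3630, 4950, 4488, 2376, 450, 55].getD p 0 := by
  have h3 := cntP_val
  by_cases hp : 13 ≤ p
  · obtain ⟨k, rfl⟩ : ∃ k, p = k + 1 := ⟨p - 1, by omega⟩
    rw [HH_succ_three, card_Xs 10 (k + 1) (by norm_num), cntP_zero (k + 1) (by omega),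
      List.getD_eq_default _ _ (by simp; omega)]
    omega
  · push Not at hp
    interval_cases p
    · rw [HH_zero_three, card_Xs 10 0 (by norm_num)]
      simp [h3]
    · rw [HH_succ_three 0, card_Xs 10 (0 + 1) (by norm_num), rank_val_0]
      simp [h3]
    · rw [HH_succ_three 1, card_Xs 10 (1 + 1) (by norm_num), rank_val_1]
      simp [h3]
    · rw [HH_succ_three 2, card_Xs 10 (2 + 1) (by norm_num), rank_val_2]
      simp [h3]
    · rw [HH_succ_three 3, card_Xs 10 (3 + 1) (by norm_num), rank_val_3]
      simp [h3]
    · rw [HH_succ_three 4, card_Xs 10 (4 + 1) (by norm_num), rank_val_4]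
      simp [h3]
    · rw [HH_succ_three 5, card_Xs 10 (5 + 1) (by norm_num), rank_val_5]
      simp [h3]
    · rw [HH_succ_three 6, card_Xs 10 (6 + 1) (by norm_num), rank_val_6]
      simp [h3]
    · rw [HH_succ_three 7, card_Xs 10 (7 + 1) (by norm_num), rank_val_7]
      simp [h3]
    · rw [HH_succ_three 8, card_Xs 10 (8 + 1) (by norm_num), rank_val_8]
      simp [h3]
    · rw [HH_succ_three 9, card_Xs 10 (9 + 1) (by norm_num), rank_val_9]
      simp [h3]
    · rw [HH_succ_three 10, card_Xs 10 (10 + 1) (by norm_num), rank_val_10]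
      simp [h3]
    · rw [HH_succ_three 11, card_Xs 10 (11 + 1) (by norm_num), rank_val_11]
      simp [h3]

theorem H7 (p : ℕ) : HH p 7 =
    [0, 0, 0, 0, 0, 0, 0, 252, 825, 660, 276, 62, 6].getD p 0 := by
  have h3 := cntP_val
  by_cases hp : 13 ≤ p
  · rw [HH_seven, card_Xs 6 p (by norm_num), cntP_zero p (by omega),
      List.getD_eq_default _ _ (by simp; omega)]
    omega
  · push Not at hp
    interval_cases p
    · rw [HH_seven, card_Xs 6 0 (by norm_num), rank_val_0]
      simp [h3]
    · rw [HH_seven, card_Xs 6 1 (by norm_num), rank_val_1]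
      simp [h3]
    · rw [HH_seven, card_Xs 6 2 (by norm_num), rank_val_2]
      simp [h3]
    · rw [HH_seven, card_Xs 6 3 (by norm_num), rank_val_3]
      simp [h3]
    · rw [HH_seven, card_Xs 6 4 (by norm_num), rank_val_4]
      simp [h3]
    · rw [HH_seven, card_Xs 6 5 (by norm_num), rank_val_5]
      simp [h3]
    · rw [HH_seven, card_Xs 6 6 (by norm_num), rank_val_6]
      simp [h3]
    · rw [HH_seven, card_Xs 6 7 (by norm_num), rank_val_7]
      simp [h3]
    · rw [HH_seven, card_Xs 6 8 (by norm_num), rank_val_8]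
      simp [h3]
    · rw [HH_seven, card_Xs 6 9 (by norm_num), rank_val_9]
      simp [h3]
    · rw [HH_seven, card_Xs 6 10 (by norm_num), rank_val_10]
      simp [h3]
    · rw [HH_seven, card_Xs 6 11 (by norm_num), rank_val_11]
      simp [h3]
    · rw [HH_seven, card_Xs 6 12 (by norm_num), rank_val_big 12 (by norm_num)]
      simp [h3]


/-- Betti table of the pushforward of O(b=3) under the 4-uple Veronese embedding of P^2. -/
theorem veronese_betti_P2_b3_d4 (D : KFam 3 4) (hD : IsKoszulFam 3 4 D) :
    Kdim 3 4 D 3 0 0 = 10 ∧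
    Kdim 3 4 D 3 1 0 = 114 ∧
    Kdim 3 4 D 3 2 0 = 588 ∧
    Kdim 3 4 D 3 3 0 = 1804 ∧
    Kdim 3 4 D 3 4 0 = 3630 ∧
    Kdim 3 4 D 3 5 0 = 4950 ∧
    Kdim 3 4 D 3 6 0 = 4488 ∧
    Kdim 3 4 D 3 7 0 = 2376 ∧
    Kdim 3 4 D 3 8 0 = 450 ∧
    Kdim 3 4 D 3 9 0 = 55 ∧
    Kdim 3 4 D 3 7 1 = 252 ∧
    Kdim 3 4 D 3 8 1 = 825 ∧
    Kdim 3 4 D 3 9 1 = 660 ∧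
    Kdim 3 4 D 3 10 1 = 276 ∧
    Kdim 3 4 D 3 11 1 = 62 ∧
    Kdim 3 4 D 3 12 1 = 6 ∧
    (∀ (p : ℕ) (q : ℤ), ¬((p ≤ 9 ∧ q = 0) ∨ (7 ≤ p ∧ p ≤ 12 ∧ q = 1)) →
      Kdim 3 4 D 3 p q = 0) := by
  have h0 : ∀ p, Kdim 3 4 D 3 p 0 =
      [10, 114, 588, 1804, 3630, 4950, 4488, 2376, 450, 55].getD p 0 := by
    intro p
    rw [Kdim_eq_HH D hD p 0, ← H3 p]
    norm_num
  have h1 : ∀ p, Kdim 3 4 D 3 p 1 =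
      [0, 0, 0, 0, 0, 0, 0, 252, 825, 660, 276, 62, 6].getD p 0 := by
    intro p
    rw [Kdim_eq_HH D hD p 1, ← H7 p]
    norm_num
  refine ⟨h0 0, h0 1, h0 2, h0 3, h0 4, h0 5, h0 6, h0 7, h0 8, h0 9, h1 7, h1 8, h1 9, h1 10,
    h1 11, h1 12, ?_⟩
  intro p q h
  push Not at h
  by_cases hq0 : q = 0
  · subst hq0
    rw [h0, List.getD_eq_default]
    have := fun hp : p ≤ 9 => h.1 hp rfl
    simp only [List.length_cons, List.length_nil]
    omega
  · by_cases hq1 : q = 1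
    · subst hq1
      rw [h1]
      have h2 := fun (ha : 7 ≤ p) (hb : p ≤ 12) => h.2 ha hb rfl
      by_cases hp : p < 7
      · interval_cases p <;> rfl
      · rw [List.getD_eq_default]
        simp only [List.length_cons, List.length_nil]
        have h3 : ¬ p ≤ 12 := fun hb => h2 (by omega) hb
        omega
    · rw [Kdim_eq_HH D hD p q]
      by_cases hq : q < 0
      · exact HH_neg _ _ (by omega)
      · exact HH_big _ _ (by omega)
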